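/- arXiv:1312.5305 — 6 statements merged into one kernel-verified Lean document; each statement's English description precedes it below -/
import Mathlib

section
/- Let K be a field of characteristic zero and let f : ℕ → K be a sequence satisfying a linear recurrence f(n) = a₁ f(n−1) + a₂ f(n−2) + ⋯ + a_r f(n−r) for all n ≥ r, where a₁, …, a_r ∈ K. Then the set S := {n ≥ 1 : f(n) = 0} of zeros of the recurrence has the one-sided SML property. -/
/-- A set `S ⊆ ℕ` has the (one-sided) SML property if it is a finite union of
arithmetic progressions `{a*n + b : n ∈ ℕ}` with `a, b > 0`, together with a
(possibly empty) finite set. -/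
def OneSidedSML (S : Set ℕ) : Prop :=
  ∃ (P : Finset (ℕ × ℕ)) (F : Set ℕ), F.Finite ∧ (∀ q ∈ P, 0 < q.1 ∧ 0 < q.2) ∧
    S = (⋃ q ∈ P, {k : ℕ | ∃ n : ℕ, k = q.1 * n + q.2}) ∪ F

/-- For an odd prime `p`, the quotients `p ^ k / k!` are `p`-adic integers, with valuation tending to
infinity. -/
theorem PadicInt.exists_mul_factorial_eq_pow {p : ℕ} [hp : Fact p.Prime] (hp2 : 2 < p) (k : ℕ) :
    ∃ c : ℤ_[p], c * (k.factorial : ℤ_[p]) = (p : ℤ_[p]) ^ k ∧ (p : ℤ_[p]) ^ (k / 2) ∣ c := by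
  obtain ⟨m, hm⟩ := pow_padicValNat_dvd (p := p) (n := k.factorial)
  set e := padicValNat p k.factorial with he
  have hv : 2 * e ≤ k := by
    have h := sub_one_mul_padicValNat_factorial (p := p) k
    rw [← he] at h
    have h' : 2 * e ≤ (p - 1) * e :=
      Nat.mul_le_mul_right _ (by omega)
    omega
  have hpm : ¬ p ∣ m := by
    rintro ⟨l, rfl⟩
    exact pow_succ_padicValNat_not_dvd (p := p) k.factorial_ne_zero
      ⟨l, by rw [← he, pow_succ, mul_assoc, ← hm]⟩
  have hu : IsUnit (m : ℤ_[p]) := by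
    rw [PadicInt.isUnit_iff, PadicInt.norm_natCast_eq_one_iff]
    exact (Nat.Prime.coprime_iff_not_dvd hp.out).2 hpm
  obtain ⟨w, hw⟩ := hu.exists_left_inv
  refine ⟨p ^ (k - e) * w, ?_, ?_⟩
  · rw [hm]
    push_cast
    calc (p : ℤ_[p]) ^ (k - e) * w * (p ^ e * m)
        = p ^ (k - e) * p ^ e * (w * m) := by ring
      _ = p ^ k := by rw [hw, mul_one, ← pow_add]; congr 1; omega
  · exact Dvd.dvd.mul_right (pow_dvd_pow _ (by omega)) _

open Polynomial in
/-- A polynomial of degree less than `k` over a quotient of a domain vanishes as soon as it lifts to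
a polynomial with `k` distinct roots. -/
theorem Polynomial.map_eq_zero_of_card_le_roots {R A : Type*} [CommRing R] [IsDomain R] [CommRing A]
    (φ : R →+* A) (P : R[X]) (s : Finset R) (hs : ∀ x ∈ s, P.eval x = 0)
    (hdeg : (P.map φ).degree < s.card) : P.map φ = 0 := by
  rcases subsingleton_or_nontrivial A with h | h
  · exact Subsingleton.elim _ _
  by_contra hne
  have hP : P ≠ 0 := by rintro rfl; simp at hne
  have hdvd : (s.val.map fun a => X - C a).prod ∣ P := by
    rw [Multiset.prod_X_sub_C_dvd_iff_le_roots hP, Multiset.le_iff_subset s.nodup]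
    intro x hx
    rw [mem_roots hP]
    exact hs x hx
  have hmonic : (s.val.map fun a => X - C a).prod.Monic :=
    monic_multiset_prod_of_monic _ _ fun a _ => monic_X_sub_C a
  refine (hmonic.map φ).not_dvd_of_degree_lt hne ?_ (Polynomial.map_dvd φ hdvd)
  rw [hmonic.degree_map, degree_eq_natDegree hmonic.ne_zero,
    natDegree_multiset_prod_X_sub_C_eq_card]
  exact hdeg

open Polynomial in
open scoped Classical in
/-- Skolem's theorem in the elementary form due to Hansel: a `p`-adic Mahler series
`∑ k, d k * p ^ k * n.choose k`, with `p` odd, that vanishes at infinitely many natural numbers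
vanishes at all of them. -/
theorem eq_zero_of_infinite_zeros_of_eq_sum_choose {p : ℕ} [hp : Fact p.Prime] (hp2 : 2 < p)
    (b d : ℕ → ℤ)
    (hb : ∀ n, b n = ∑ k ∈ Finset.range (n + 1), (n.choose k : ℤ) * p ^ k * d k)
    (hinf : {n | b n = 0}.Infinite) (n : ℕ) : b n = 0 := by
  choose c hc hcdvd using PadicInt.exists_mul_factorial_eq_pow (p := p) hp2
  have key : ∀ M : ℕ, (p : ℤ_[p]) ^ M ∣ (b n : ℤ_[p]) := by
    intro M
    obtain ⟨s, hs, hcard⟩ := hinf.exists_subset_card_eq (2 * M)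
    set L := n + s.sup id + 1 with hL
    let P : ℤ_[p][X] :=
      ∑ k ∈ Finset.range L, C (c k * (d k : ℤ_[p])) * descPochhammer ℤ_[p] k
    have heval : ∀ t < L, P.eval (t : ℤ_[p]) = (b t : ℤ_[p]) := by
      intro t ht
      rw [hb t, eval_finsetSum]
      push_cast
      symm
      apply Finset.sum_subset_zero_on_sdiff
      · intro k; simp only [Finset.mem_range]; omega
      · intro k hk
        simp only [Finset.mem_sdiff, Finset.mem_range] at hk
        rw [eval_mul, descPochhammer_eval_eq_descFactorial,
          Nat.descFactorial_eq_zero_iff_lt.2 (by omega)]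
        simp
      · intro k _
        rw [eval_mul, descPochhammer_eval_eq_descFactorial, eval_C,
          Nat.descFactorial_eq_factorial_mul_choose, ← hc k]
        push_cast
        ring
    have hzero : P.map (PadicInt.toZModPow M) = 0 := by
      apply map_eq_zero_of_card_le_roots (s := s.image ((↑) : ℕ → ℤ_[p]))
      · intro x hx
        obtain ⟨t, ht, rfl⟩ := Finset.mem_image.1 hx
        have h1 : t ≤ s.sup id := Finset.le_sup (f := id) ht
        have h2 : b t = 0 := hs ht
        rw [heval t (by omega), h2, Int.cast_zero]
      · rw [Finset.card_image_of_injective _ Nat.cast_injective, hcard, Polynomial.map_sum]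
        refine (degree_lt_iff_coeff_zero _ _).2 fun m hm => ?_
        rw [finsetSum_coeff]
        refine Finset.sum_eq_zero fun k _ => ?_
        rw [coeff_map, coeff_C_mul]
        rcases lt_or_ge k m with hk | hk
        · rw [coeff_eq_zero_of_natDegree_lt (by rw [descPochhammer_natDegree]; exact hk)]
          simp
        · have : PadicInt.toZModPow M (c k) = 0 := by
            rw [← RingHom.mem_ker, PadicInt.ker_toZModPow, Ideal.mem_span_singleton]
            exact (pow_dvd_pow _ (by omega)).trans (hcdvd k)
          rw [map_mul, map_mul, this]
          simp
    rw [← Ideal.mem_span_singleton, ← PadicInt.ker_toZModPow, RingHom.mem_ker,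
      ← heval n (by omega), ← Polynomial.eval_map_apply, hzero, eval_zero]
  by_contra hne
  have hpu : ¬ IsUnit (p : ℤ_[p]) := PadicInt.prime_p.not_isUnit
  obtain ⟨M, hM⟩ := FiniteMultiplicity.of_not_isUnit (a := (p : ℤ_[p])) (b := (b n : ℤ_[p])) hpu
    (by exact_mod_cast hne)
  exact hM (key _)

open Matrix in
/-- For an integer matrix congruent to `1` modulo an odd prime, a bilinear expression
in its powers that vanishes infinitely often vanishes identically. -/
theorem Matrix.dotProduct_pow_mulVec_eq_zero_of_infinite {m : Type*} [Fintype m] [DecidableEq m]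
    {p : ℕ} [Fact p.Prime] (hp2 : 2 < p) (A : Matrix m m ℤ)
    (hA : A.map (Int.castRingHom (ZMod p)) = 1) (u v : m → ℤ)
    (hinf : {n : ℕ | u ⬝ᵥ (A ^ n) *ᵥ v = 0}.Infinite) (n : ℕ) : u ⬝ᵥ (A ^ n) *ᵥ v = 0 := by
  have h : ∀ i j, ∃ c, A i j = (1 : Matrix m m ℤ) i j + p * c := by
    intro i j
    have h1 := congrFun (congrFun hA i) j
    have h2 : ((A i j - (1 : Matrix m m ℤ) i j : ℤ) : ZMod p) = 0 := by
      have h3 : (((1 : Matrix m m ℤ) i j : ℤ) : ZMod p) = (1 : Matrix m m (ZMod p)) i j := by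
        simp [Matrix.one_apply, apply_ite]
      rw [Matrix.map_apply, eq_intCast] at h1
      rw [Int.cast_sub, h1, h3, sub_self]
    obtain ⟨c, hc⟩ := (ZMod.intCast_zmod_eq_zero_iff_dvd _ _).1 h2
    exact ⟨c, by linarith⟩
  choose B hB using h
  have hAB : A = (p : ℤ) • (Matrix.of B) + 1 := by
    ext i j
    simp [hB i j, add_comm]
  refine eq_zero_of_infinite_zeros_of_eq_sum_choose hp2 _ (fun k => u ⬝ᵥ (Matrix.of B ^ k) *ᵥ v)
    (fun n => ?_) hinf n
  rw [hAB, (Commute.one_right _).add_pow, Matrix.sum_mulVec, dotProduct_sum]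
  refine Finset.sum_congr rfl fun k _ => ?_
  rw [one_pow, mul_one, smul_pow, ← nsmul_eq_mul', ← Nat.cast_smul_eq_nsmul ℤ, Matrix.smul_mulVec,
    Matrix.smul_mulVec, dotProduct_smul, dotProduct_smul, smul_eq_mul, smul_eq_mul, mul_assoc]

open Matrix in
/-- Skolem–Mahler–Lech for powers of a nonsingular matrix over a polynomial ring over `ℤ`, with a
period depending only on the matrix. -/
theorem MvPolynomial.exists_period_dotProduct_pow_mulVec {ι m : Type*} [Fintype m] [DecidableEq m]
    (A : Matrix m m (MvPolynomial ι ℤ)) (hA : A.det ≠ 0) :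
    ∃ N > 0, ∀ u v : m → MvPolynomial ι ℤ, {n : ℕ | u ⬝ᵥ (A ^ (N * n)) *ᵥ v = 0}.Infinite →
      ∀ n, u ⬝ᵥ (A ^ (N * n)) *ᵥ v = 0 := by
  obtain ⟨x₀, hx₀⟩ : ∃ x, eval x A.det ≠ 0 := by
    by_contra! h
    exact hA (MvPolynomial.funext fun x => by simp [h x])
  obtain ⟨p, hpge, hp⟩ := Nat.exists_infinite_primes (max 3 ((eval x₀ A.det).natAbs + 1))
  have : Fact p.Prime := ⟨hp⟩
  have hp2 : 2 < p := by omega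
  let φ := (Int.castRingHom (ZMod p)).comp (eval x₀)
  have hdet : φ A.det ≠ 0 := by
    intro h
    have h' := Int.natAbs_dvd_natAbs.2 ((ZMod.intCast_zmod_eq_zero_iff_dvd _ p).1 h)
    have := Nat.le_of_dvd (Int.natAbs_pos.2 hx₀) h'
    rw [Int.natAbs_natCast] at this
    omega
  obtain ⟨g, hg⟩ : IsUnit (A.map φ) := by
    rw [Matrix.isUnit_iff_isUnit_det, ← RingHom.mapMatrix_apply, ← RingHom.map_det]
    exact hdet.isUnit
  refine ⟨orderOf g, orderOf_pos g, fun u v hinf n => ?_⟩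
  refine MvPolynomial.funext_set (fun i => Set.range fun y : ℤ => x₀ i + p * y)
    (fun i => Set.infinite_range_of_injective fun y z h => ?_) fun x hx => ?_
  · simpa [hp.ne_zero] using h
  have hφ : φ = (Int.castRingHom (ZMod p)).comp (eval x) := by
    ext i
    · simp [φ]
    · obtain ⟨y, hy⟩ := hx i trivial
      simp [φ, ← hy]
  have heval : ∀ n, eval x (u ⬝ᵥ (A ^ (orderOf g * n)) *ᵥ v) =
      (eval x ∘ u) ⬝ᵥ (((A.map (eval x)) ^ orderOf g) ^ n) *ᵥ (eval x ∘ v) := by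
    intro n
    rw [RingHom.map_dotProduct, ← pow_mul, ← RingHom.mapMatrix_apply, ← map_pow]
    congr 1
    ext i
    simp [RingHom.map_mulVec]
  rw [heval, map_zero]
  refine Matrix.dotProduct_pow_mulVec_eq_zero_of_infinite hp2 _ ?_ _ _ (hinf.mono fun k hk => ?_) n
  · rw [← RingHom.mapMatrix_apply, ← RingHom.mapMatrix_apply, map_pow, RingHom.mapMatrix_apply,
      RingHom.mapMatrix_apply, Matrix.map_map, ← RingHom.coe_comp, ← hφ, ← hg,
      ← Units.val_pow_eq_pow_val,
      pow_orderOf_eq_one, Units.val_one]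
  · change _ = 0
    rw [← heval, Set.mem_ofPred.1 hk, map_zero]

open Matrix in
/-- Skolem–Mahler–Lech for an injective endomorphism of a finite-dimensional vector space over the
fraction field of a polynomial ring over `ℤ`. -/
theorem MvPolynomial.exists_period_linearMap_pow {ι F V : Type*} [Field F]
    [Algebra (MvPolynomial ι ℤ) F] [IsFractionRing (MvPolynomial ι ℤ) F] [AddCommGroup V]
    [Module F V] [FiniteDimensional F V] (T : V →ₗ[F] V) (hT : Function.Injective T) :
    ∃ N > 0, ∀ (v : V) (l : V →ₗ[F] F), {n : ℕ | l ((T ^ (N * n)) v) = 0}.Infinite →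
      ∀ n, l ((T ^ (N * n)) v) = 0 := by
  let R := MvPolynomial ι ℤ
  let b := Module.finBasis F V
  let M := LinearMap.toMatrix b b T
  have hne : ∀ c : nonZeroDivisors R, algebraMap R F c ≠ 0 := fun c =>
    IsFractionRing.to_map_ne_zero_of_mem_nonZeroDivisors c.2
  obtain ⟨c, hc⟩ := IsLocalization.exist_integer_multiples_of_finite (nonZeroDivisors R)
    fun ij : _ × _ => M ij.1 ij.2
  obtain ⟨A, hA⟩ : ∃ A : Matrix _ _ R, A.map (algebraMap R F) = algebraMap R F c • M := by
    choose A hA using hc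
    refine ⟨Matrix.of fun i j => A (i, j), ?_⟩
    ext i j
    simpa [Algebra.smul_def] using hA (i, j)
  have hdetM : M.det ≠ 0 := by
    rw [LinearMap.det_toMatrix]
    have := (LinearMap.isUnit_iff_ker_eq_bot T).2 (LinearMap.ker_eq_bot.2 hT)
    exact (this.map LinearMap.det).ne_zero
  have hdet : A.det ≠ 0 := by
    intro h
    have h' := congrArg (algebraMap R F) h
    rw [RingHom.map_det, RingHom.mapMatrix_apply, hA, map_zero, Matrix.det_smul] at h'
    exact mul_ne_zero (pow_ne_zero _ (hne c)) hdetM h'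
  obtain ⟨N, hN, hper⟩ := MvPolynomial.exists_period_dotProduct_pow_mulVec _ hdet
  refine ⟨N, hN, fun v l => ?_⟩
  obtain ⟨cv, hcv⟩ := IsLocalization.exist_integer_multiples_of_finite (nonZeroDivisors R)
    fun i => b.repr v i
  obtain ⟨cl, hcl⟩ := IsLocalization.exist_integer_multiples_of_finite (nonZeroDivisors R)
    fun i => l (b i)
  choose v' hv' using hcv
  choose l' hl' using hcl
  have hv'' : algebraMap R F ∘ v' = algebraMap R F cv • ⇑(b.repr v) := by
    ext i
    simpa [Algebra.smul_def] using hv' i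
  have hl'' : algebraMap R F ∘ l' = algebraMap R F cl • fun i => l (b i) := by
    ext i
    simpa [Algebra.smul_def] using hl' i
  have hl : ∀ w, l w = (fun i => l (b i)) ⬝ᵥ ⇑(b.repr w) := by
    intro w
    conv_lhs => rw [← b.sum_repr w, map_sum]
    simp [dotProduct, mul_comm]
  have hmap : ∀ n, algebraMap R F (l' ⬝ᵥ (A ^ n) *ᵥ v') =
      algebraMap R F cl * (algebraMap R F c ^ n * (algebraMap R F cv * l ((T ^ n) v))) := by
    intro n
    have h1 : algebraMap R F ∘ ((A ^ n) *ᵥ v') =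
        (algebraMap R F c • M) ^ n *ᵥ (algebraMap R F ∘ v') := by
      ext i
      rw [← hA, ← RingHom.mapMatrix_apply, ← map_pow]
      simp [RingHom.map_mulVec]
    rw [RingHom.map_dotProduct, h1, hv'', hl'', smul_pow, Matrix.smul_mulVec, Matrix.mulVec_smul,
      show M ^ n = LinearMap.toMatrix b b (T ^ n) from LinearMap.toMatrix_pow b T n,
      LinearMap.toMatrix_mulVec_repr, smul_dotProduct, dotProduct_smul,
      dotProduct_smul, ← hl]
    simp only [smul_eq_mul]
  have hiff : ∀ n, l' ⬝ᵥ (A ^ n) *ᵥ v' = 0 ↔ l ((T ^ n) v) = 0 := by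
    intro n
    rw [← (IsFractionRing.injective R F).eq_iff, hmap, map_zero]
    simp only [mul_eq_zero, hne, pow_eq_zero_iff', false_and, false_or]
  simpa only [hiff] using hper l' v'

/-- Skolem–Mahler–Lech for an injective endomorphism of a finite-dimensional vector space over a
finite extension of the fraction field of a polynomial ring over `ℤ`. -/
theorem MvPolynomial.exists_period_linearMap_pow_of_finiteDimensional (ι F : Type*)
    {L V : Type*} [Field F] [Algebra (MvPolynomial ι ℤ) F] [IsFractionRing (MvPolynomial ι ℤ) F]
    [Field L] [Algebra F L] [FiniteDimensional F L] [AddCommGroup V] [Module L V] [Module F V]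
    [IsScalarTower F L V] [FiniteDimensional L V] (T : V →ₗ[L] V) (hT : Function.Injective T) :
    ∃ N > 0, ∀ (v : V) (l : V →ₗ[L] L), {n : ℕ | l ((T ^ (N * n)) v) = 0}.Infinite →
      ∀ n, l ((T ^ (N * n)) v) = 0 := by
  have : FiniteDimensional F V := Module.Finite.trans L V
  obtain ⟨N, hN, h⟩ := MvPolynomial.exists_period_linearMap_pow (ι := ι) (T.restrictScalars F) hT
  have hpow : ∀ n v, ((T.restrictScalars F) ^ n) v = (T ^ n) v := fun n v => by
    simp only [Module.End.pow_apply, LinearMap.coe_restrictScalars]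
  simp only [hpow] at h
  let b := Module.finBasis F L
  refine ⟨N, hN, fun v l hinf n => b.ext_elem fun i => ?_⟩
  simpa using h v (b.coord i ∘ₗ l.restrictScalars F)
    (hinf.mono fun k hk => by simp [Set.mem_ofPred.1 hk]) n

/-- Skolem–Mahler–Lech for a linear recurrence with nonzero last coefficient: the sequence splits
into finitely many progressions, on each of which it is zero or has finitely many zeros. -/
theorem exists_period_of_linearRecurrence {K : Type*} [Field K] [CharZero K] (r : ℕ)
    (a : Fin (r + 1) → K) (ha : a 0 ≠ 0) (f : ℕ → K)
    (hf : ∀ n : ℕ, f (n + (r + 1)) = ∑ i, a i * f (n + i)) :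
    ∃ N > 0, ∀ j, {n | f (N * n + j) = 0}.Infinite → ∀ n, f (N * n + j) = 0 := by
  obtain ⟨ι, x, hx⟩ := exists_isTranscendenceBasis' ℤ K
  let R := MvPolynomial ι ℤ
  let : Algebra R K := (MvPolynomial.aeval x).toAlgebra
  have hinj : Function.Injective (algebraMap R K) := hx.1
  have : FaithfulSMul R K := (faithfulSMul_iff_algebraMap_injective R K).2 hinj
  have halg : Algebra.IsAlgebraic R K := by
    have := hx.isAlgebraic
    let e := hx.1.aevalEquiv
    refine ⟨fun y => ?_⟩
    obtain ⟨q, hq0, hq⟩ := Algebra.IsAlgebraic.isAlgebraic (R := Algebra.adjoin ℤ (Set.range x)) y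
    refine ⟨q.map (e.symm : _ →+* _), ?_, ?_⟩
    · rwa [Ne, Polynomial.map_eq_zero_iff e.symm.injective]
    · rw [← hq, Polynomial.aeval_def, Polynomial.aeval_def, Polynomial.eval₂_map]
      congr 1
      ext z
      obtain ⟨z, rfl⟩ := e.surjective z
      change MvPolynomial.aeval x (e.symm (e z)) = (e z : K)
      simp [e]
  let F := FractionRing R
  let : Algebra F K := FractionRing.liftAlgebra R K
  have : IsScalarTower R F K := FractionRing.isScalarTower_liftAlgebra R K
  have : Algebra.IsAlgebraic F K := (IsFractionRing.comap_isAlgebraic_iff (A := R)).1 halg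
  let S : Set K := Set.range a ∪ Set.range fun i : Fin (r + 1) => f i
  have : Finite S := ((Set.finite_range _).union (Set.finite_range _)).to_subtype
  let L := IntermediateField.adjoin F S
  have : FiniteDimensional F L := IntermediateField.finiteDimensional_adjoin fun y _ =>
    (Algebra.IsAlgebraic.isAlgebraic y).isIntegral
  have haL : ∀ i, a i ∈ L := fun i =>
    IntermediateField.subset_adjoin F S (Or.inl (Set.mem_range_self i))
  have hfL : ∀ n, f n ∈ L := by
    intro n
    induction n using Nat.strong_induction_on with
    | _ n ih =>
      rcases lt_or_ge n (r + 1) with hn | hn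
      · exact IntermediateField.subset_adjoin F S (Or.inr ⟨⟨n, hn⟩, rfl⟩)
      · obtain ⟨k, rfl⟩ := Nat.exists_eq_add_of_le' hn
        rw [hf k]
        exact sum_mem fun i _ => mul_mem (haL i) (ih _ (by omega))
  let E : LinearRecurrence L := ⟨r + 1, fun i => ⟨a i, haL i⟩⟩
  have : FiniteDimensional L E.solSpace := Module.Finite.of_basis E.basis
  have hshift : ∀ u ∈ E.solSpace, LinearMap.funLeft L L Nat.succ u ∈ E.solSpace := by
    intro u hu n
    have := hu (n + 1)
    simp only [LinearMap.funLeft_apply, Nat.succ_eq_add_one]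
    simpa only [add_right_comm] using this
  let T : E.solSpace →ₗ[L] E.solSpace := (LinearMap.funLeft L L Nat.succ).restrict hshift
  have hTapply : ∀ u : E.solSpace, ∀ n, (T u).1 n = u.1 (n + 1) := fun u n => rfl
  have hT : Function.Injective T := by
    rw [← LinearMap.ker_eq_bot, LinearMap.ker_eq_bot']
    intro u hu
    have hsucc : ∀ n, u.1 (n + 1) = 0 := fun n => by rw [← hTapply, hu]; rfl
    have h0 : u.1 0 = 0 := by
      have h := u.2 0
      change u.1 (0 + (r + 1)) = ∑ i : Fin (r + 1), (⟨a i, haL i⟩ : L) * u.1 (0 + i) at h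
      rw [← add_assoc, hsucc, Fin.sum_univ_succ] at h
      simp only [Fin.val_succ, ← add_assoc, hsucc, mul_zero, Finset.sum_const_zero, add_zero] at h
      refine (mul_eq_zero.1 h.symm).resolve_left fun h' => ha ?_
      exact congrArg Subtype.val h'
    ext n
    rcases n with - | n
    · simp [h0]
    · simp [hsucc]
  have hTpow : ∀ n (u : E.solSpace) k, ((T ^ n) u).1 k = u.1 (k + n) := by
    intro n
    induction n with
    | zero => simp
    | succ n ih =>
      intro u k
      rw [pow_succ, Module.End.mul_apply, ih, hTapply, add_assoc]
  let f' : E.solSpace := ⟨fun n => ⟨f n, hfL n⟩, fun n => Subtype.ext <| by simpa [E] using hf n⟩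
  obtain ⟨N, hN, h⟩ :=
    MvPolynomial.exists_period_linearMap_pow_of_finiteDimensional ι F T hT
  refine ⟨N, hN, fun j => ?_⟩
  have hj := h ((T ^ j) f') (LinearMap.proj 0 ∘ₗ E.solSpace.subtype)
  have hval : ∀ n, (LinearMap.proj 0 ∘ₗ E.solSpace.subtype) ((T ^ (N * n)) ((T ^ j) f')) = 0 ↔
      f (N * n + j) = 0 := by
    intro n
    simp only [LinearMap.comp_apply, Submodule.subtype_apply, LinearMap.proj_apply, hTpow,
      zero_add, f']
    exact Subtype.ext_iff
  simpa only [hval] using hj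

/-- The **Skolem–Mahler–Lech theorem**: the zeros of a linear recurrence sequence are eventually
governed by finitely many progressions. -/
theorem exists_eventual_period_of_linearRecurrence {K : Type*} [Field K] [CharZero K] (r : ℕ)
    (a : Fin r → K) (f : ℕ → K) (hf : ∀ n : ℕ, f (n + r) = ∑ i, a i * f (n + i)) :
    ∃ N > 0, ∃ m, ∀ j ≥ m, {n | f (N * n + j) = 0}.Infinite → ∀ n, f (N * n + j) = 0 := by
  induction r generalizing f with
  | zero => exact ⟨1, one_pos, 0, fun j _ _ n => by simpa using hf (1 * n + j)⟩
  | succ r ih =>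
    by_cases ha : a 0 = 0
    · obtain ⟨N, hN, m, h⟩ := ih (fun i => a i.succ) (fun n => f (n + 1)) fun n => by
        have := hf n
        rw [Fin.sum_univ_succ, ha, zero_mul, zero_add] at this
        rw [add_assoc, this]
        simp only [Fin.val_succ, add_assoc]
      refine ⟨N, hN, m + 1, fun j hj => ?_⟩
      obtain ⟨j, rfl⟩ := Nat.exists_eq_add_of_le' (show 1 ≤ j by omega)
      exact h j (by omega)
    · obtain ⟨N, hN, h⟩ := exists_period_of_linearRecurrence r a ha f hf
      exact ⟨N, hN, 0, fun j _ => h j⟩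

/-- A set of positive integers that eventually meets each class modulo `N` in a finite set or
contains it has the one-sided SML property. -/
theorem OneSidedSML.of_eventual_period {Z : Set ℕ} {N m : ℕ} (hN : 0 < N)
    (hZ : ∀ j ≥ m, {n | N * n + j ∈ Z}.Infinite → ∀ n, N * n + j ∈ Z) :
    OneSidedSML {n | 1 ≤ n ∧ n ∈ Z} := by
  classical
  let J := (Finset.Ico (m + 1) (m + 1 + N)).filter fun j => {n | N * n + j ∈ Z}.Infinite
  let U : Set ℕ := ⋃ q ∈ J.image (Prod.mk N), {k | ∃ n, k = q.1 * n + q.2}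
  have hU : ∀ k, k ∈ U ↔ ∃ j ∈ J, ∃ n, k = N * n + j := by simp [U]
  refine ⟨J.image (Prod.mk N), {n | 1 ≤ n ∧ n ∈ Z} \ U, ?_, ?_, ?_⟩
  · have hfin : (Set.Iic m ∪ ⋃ j ∈ {j ∈ Finset.Ico (m + 1) (m + 1 + N) | j ∉ J},
        (fun n => N * n + j) '' {n | N * n + j ∈ Z}).Finite := by
      refine (Set.finite_Iic m).union (Set.Finite.biUnion (Finset.finite_toSet _) fun j hj => ?_)
      refine Set.Finite.image _ ?_
      by_contra hinf
      simp only [Finset.coe_filter, Set.mem_ofPred_eq] at hj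
      exact hj.2 (Finset.mem_filter.2 ⟨hj.1, hinf⟩)
    refine hfin.subset fun k hk => ?_
    rcases le_or_gt k m with hkm | hkm
    · exact Or.inl hkm
    · obtain ⟨i, rfl⟩ := Nat.exists_eq_add_of_le (show m + 1 ≤ k from hkm)
      have hi : m + 1 + i = N * (i / N) + (m + 1 + i % N) := by
        have := Nat.div_add_mod i N
        omega
      have hmod := Nat.mod_lt i hN
      refine Or.inr (Set.mem_biUnion (x := m + 1 + i % N) ?_ ⟨i / N, ?_, hi.symm⟩)
      · simp only [Finset.coe_filter, Set.mem_ofPred_eq, Finset.mem_Ico]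
        exact ⟨by omega, fun hJ => hk.2 ((hU _).2 ⟨_, hJ, _, hi⟩)⟩
      · rw [Set.mem_ofPred_eq, ← hi]
        exact hk.1.2
  · simp only [Finset.mem_image]
    rintro q ⟨j, hj, rfl⟩
    have := Finset.mem_Ico.1 (Finset.mem_filter.1 hj).1
    exact ⟨hN, by dsimp only; omega⟩
  · refine (Set.union_sdiff_cancel fun k hk => ?_).symm
    obtain ⟨j, hj, n, rfl⟩ := (hU k).1 hk
    have hj' := Finset.mem_filter.1 hj
    have := Finset.mem_Ico.1 hj'.1
    exact ⟨by omega, hZ j (by omega) hj'.2 n⟩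

/-- **Skolem–Mahler–Lech theorem, recurrence form.**
Let `K` be a field of characteristic zero and let `f : ℕ → K` satisfy a linear
recurrence of order `r` with coefficients in `K`. Then the set of zeros
`{n ≥ 1 : f n = 0}` has the one-sided SML property. -/
theorem stmt1 {K : Type*} [Field K] [CharZero K] (r : ℕ) (a : Fin r → K)
    (f : ℕ → K) (hf : ∀ n : ℕ, f (n + r) = ∑ i : Fin r, a i * f (n + i)) :
    OneSidedSML {n : ℕ | 1 ≤ n ∧ f n = 0} := by
  obtain ⟨N, hN, m, h⟩ := exists_eventual_period_of_linearRecurrence r a f hf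
  exact OneSidedSML.of_eventual_period (Z := {n | f n = 0}) hN h
end

section
/- Let K be a field of characteristic zero, let σ : K^n → K^n be an invertible linear map, let v ∈ K^n, and let W be a vector subspace of K^n of codimension 1. Then the set S := {m ∈ ℕ : σ^m(v) ∈ W} has the one-sided SML property. -/
section

open Polynomial

/-- **Strassmann's bound** for Newton series over `ℤ_[p]`: if `a N` is not divisible by `p` but all
later coefficients are, then `∑ a k * m (m - 1) ⋯ (m - k + 1)` has at most `N` zeros. -/
theorem card_zeros_newtonSeries_le {p : ℕ} [Fact p.Prime] (a : ℕ → ℤ_[p]) (N : ℕ)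
    (hN : PadicInt.toZMod (a N) ≠ 0) (ha : ∀ k, N < k → PadicInt.toZMod (a k) = 0)
    (T : Finset ℕ)
    (hT : ∀ m ∈ T, ∑ k ∈ Finset.range (m + 1), a k * (m.descFactorial k : ℤ_[p]) = 0) :
    T.card ≤ N := by
  set M := N + T.sup id + 1 with hM
  set P : ℤ_[p][X] := ∑ k ∈ Finset.range M, C (a k) * descPochhammer ℤ_[p] k with hP
  have hroot : ∀ m ∈ T, P.eval (m : ℤ_[p]) = 0 := by
    intro m hm
    have hmM : m + 1 ≤ M := by
      have : m ≤ T.sup id := Finset.le_sup (f := id) hm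
      omega
    rw [← hT m hm, hP, eval_finsetSum]
    symm
    simp only [eval_mul, eval_C, descPochhammer_eval_eq_descFactorial]
    refine Finset.sum_subset (Finset.range_mono hmM) fun k _ hk => ?_
    rw [Finset.mem_range, not_lt] at hk
    rw [Nat.descFactorial_of_lt (by omega), Nat.cast_zero, mul_zero]
  set Q : ℤ_[p][X] := ∏ m ∈ T, (X - C (m : ℤ_[p])) with hQ
  have hdvd : Q ∣ P := by
    by_cases hP0 : P = 0
    · simp [hP0]
    have : Q = ((T.val.map fun m : ℕ => (m : ℤ_[p])).map fun z => X - C z).prod := by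
      rw [hQ, Multiset.map_map]; rfl
    rw [this, Multiset.prod_X_sub_C_dvd_iff_le_roots hP0, Multiset.le_iff_subset]
    · intro z hz
      obtain ⟨m, hm, rfl⟩ := Multiset.mem_map.1 hz
      exact (mem_roots hP0).2 (hroot m hm)
    · exact T.nodup.map Nat.cast_injective
  have hPmap : P.map PadicInt.toZMod =
      ∑ k ∈ Finset.range M, C (PadicInt.toZMod (a k)) * descPochhammer (ZMod p) k := by
    simp [hP, Polynomial.map_sum]
  have hcoeff : (P.map PadicInt.toZMod).coeff N = PadicInt.toZMod (a N) := by
    rw [hPmap, finsetSum_coeff, Finset.sum_eq_single N]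
    · have h := (monic_descPochhammer (ZMod p) N).coeff_natDegree
      rw [descPochhammer_natDegree] at h
      rw [coeff_C_mul, h, mul_one]
    · intro k _ hk
      rcases lt_or_gt_of_ne hk with h | h
      · rw [coeff_C_mul, coeff_eq_zero_of_natDegree_lt (by rwa [descPochhammer_natDegree]),
          mul_zero]
      · rw [ha k h, C_0, zero_mul, coeff_zero]
    · intro h
      exact absurd (Finset.mem_range.2 (by omega)) h
  have hne : P.map PadicInt.toZMod ≠ 0 := by
    intro h
    rw [h, coeff_zero] at hcoeff
    exact hN hcoeff.symm
  have hdeg : (P.map PadicInt.toZMod).natDegree ≤ N := by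
    rw [hPmap]
    refine natDegree_sum_le_of_forall_le _ _ fun k _ => ?_
    rcases le_or_gt k N with h | h
    · exact (natDegree_C_mul_le _ _).trans (by rwa [descPochhammer_natDegree])
    · simp [ha k h]
  have hQdeg : (Q.map PadicInt.toZMod).natDegree = T.card := by
    have hmonic : Q.Monic := monic_prod_X_sub_C _ _
    rw [hmonic.natDegree_map, hQ, natDegree_finsetProd_X_sub_C_eq_card]
  rw [← hQdeg]
  exact (natDegree_le_of_dvd (Polynomial.map_dvd _ hdvd) hne).trans hdeg

/-- A Newton series over `ℤ_[p]` whose `k`-th coefficient is divisible by `p ^ k` has only finitely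
many zeros in `ℕ`, unless all coefficients vanish. -/
theorem finite_zeros_newtonSeries {p : ℕ} [hp : Fact p.Prime] (a : ℕ → ℤ_[p])
    (ha : ∀ k, (p : ℤ_[p]) ^ k ∣ a k) (hne : ∃ k, a k ≠ 0) :
    {m : ℕ | ∑ k ∈ Finset.range (m + 1), a k * (m.descFactorial k : ℤ_[p]) = 0}.Finite := by
  have hp0 : (p : ℤ_[p]) ≠ 0 := PadicInt.prime_p.ne_zero
  have hker : ∀ x : ℤ_[p], PadicInt.toZMod x = 0 ↔ (p : ℤ_[p]) ∣ x := fun x => by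
    rw [← RingHom.mem_ker, PadicInt.ker_toZMod, PadicInt.maximalIdeal_eq_span_p,
      Ideal.mem_span_singleton]
  obtain ⟨v, b, hb, j, hj⟩ : ∃ (v : ℕ) (b : ℕ → ℤ_[p]),
      (∀ k, a k = (p : ℤ_[p]) ^ v * b k) ∧ ∃ j, ¬ (p : ℤ_[p]) ∣ b j := by
    by_contra! hcon
    have hall : ∀ v : ℕ, ∀ k, (p : ℤ_[p]) ^ v ∣ a k := by
      intro v
      induction v with
      | zero => simp
      | succ v ih =>
        choose b hb using ih
        intro k
        rw [hb k, pow_succ]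
        exact mul_dvd_mul_left _ (hcon v b hb k)
    obtain ⟨k, hk⟩ := hne
    have hfin := FiniteMultiplicity.of_not_isUnit PadicInt.prime_p.not_isUnit hk
    exact hfin.not_pow_dvd_of_multiplicity_lt (Nat.lt_succ_self _) (hall _ k)
  have hbv : ∀ k, v < k → (p : ℤ_[p]) ∣ b k := by
    intro k hk
    have h := ha k
    rw [hb k, show k = v + (k - v - 1 + 1) by omega, pow_add,
      mul_dvd_mul_iff_left (pow_ne_zero _ hp0), ← show k = v + (k - v - 1 + 1) by omega] at h
    exact (dvd_pow_self _ (Nat.succ_ne_zero _)).trans h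
  classical
  have hjv : j ≤ v := le_of_not_gt fun h => hj (hbv j h)
  set N := Nat.findGreatest (fun k => ¬ (p : ℤ_[p]) ∣ b k) v with hN
  have hN1 : ¬ (p : ℤ_[p]) ∣ b N :=
    Nat.findGreatest_spec (P := fun k => ¬ (p : ℤ_[p]) ∣ b k) hjv hj
  have hN2 : ∀ k, N < k → (p : ℤ_[p]) ∣ b k := by
    intro k hk
    rcases le_or_gt k v with h | h
    · exact not_not.1 (Nat.findGreatest_is_greatest hk h)
    · exact hbv k h
  by_contra hinf
  obtain ⟨T, hT, hcard⟩ := Set.Infinite.exists_subset_card_eq hinf (N + 1)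
  have := card_zeros_newtonSeries_le b N (by rwa [Ne, hker]) (fun k hk => (hker _).2 (hN2 k hk)) T
    fun m hm => by
      have h := hT hm
      simp only [Set.mem_ofPred_eq, hb, mul_assoc, ← Finset.mul_sum] at h
      exact (mul_eq_zero.1 h).resolve_left (pow_ne_zero _ hp0)
  omega

end

/-- The valuation of `k!` is at most `k`. -/
theorem PadicInt.factorial_dvd_pow (p : ℕ) [hp : Fact p.Prime] (k : ℕ) :
    (k.factorial : ℤ_[p]) ∣ (p : ℤ_[p]) ^ k := by
  obtain ⟨u, hu⟩ := pow_padicValNat_dvd (p := p) (n := k.factorial)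
  have hpu : ¬ p ∣ u := by
    intro ⟨w, hw⟩
    refine pow_succ_padicValNat_not_dvd (p := p) k.factorial_ne_zero ⟨w, ?_⟩
    rwa [hw, ← mul_assoc, ← pow_succ] at hu
  have hunit : IsUnit (u : ℤ_[p]) := by
    rw [PadicInt.isUnit_iff, PadicInt.norm_natCast_eq_one_iff]
    exact (hp.out.coprime_iff_not_dvd.2 hpu)
  rw [hu, Nat.cast_mul, Nat.cast_pow]
  exact hunit.mul_right_dvd.2 (pow_dvd_pow _ (padicValNat_factorial_le p k))

/-- A binomial series with integer coefficients `p ^ (2 * k) * d k` that vanishes at infinitely many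
natural numbers vanishes at all of them. -/
theorem sum_choose_mul_eq_zero_of_infinite {p : ℕ} [hp : Fact p.Prime] (d : ℕ → ℤ)
    (hinf : {m : ℕ | ∑ k ∈ Finset.range (m + 1),
      (m.choose k : ℤ) * ((p : ℤ) ^ (2 * k) * d k) = 0}.Infinite) (k : ℕ) : d k = 0 := by
  have hp0 : (p : ℤ_[p]) ≠ 0 := PadicInt.prime_p.ne_zero
  choose c hc using PadicInt.factorial_dvd_pow p
  by_contra hk
  refine hinf ((finite_zeros_newtonSeries (p := p) (fun k => (p : ℤ_[p]) ^ k * (c k * d k))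
    (fun k => dvd_mul_right _ _) ⟨k, ?_⟩).subset fun m hm => ?_)
  · refine mul_ne_zero (pow_ne_zero _ hp0) (mul_ne_zero ?_ (by exact_mod_cast hk))
    intro h
    exact pow_ne_zero k hp0 (by rw [hc k, h, mul_zero])
  · have h := congrArg (Int.cast : ℤ → ℤ_[p]) hm
    push_cast at h
    rw [Set.mem_ofPred_eq, ← h]
    refine Finset.sum_congr rfl fun k _ => ?_
    rw [Nat.descFactorial_eq_factorial_mul_choose, Nat.cast_mul, two_mul, pow_add]
    nth_rw 3 [hc k]
    ring

section

open Matrix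

/-- An integer matrix congruent to `1` modulo `p ^ 2` generates only sequences `w ⬝ B ^ m v` that
are identically zero or have finitely many zeros. -/
theorem dotProduct_one_add_pow_mulVec_eq_zero {p : ℕ} [Fact p.Prime] {ι : Type*} [Fintype ι]
    [DecidableEq ι] (D : Matrix ι ι ℤ) (v w : ι → ℤ)
    (hinf : {m : ℕ | w ⬝ᵥ ((1 + (p : ℤ) ^ 2 • D) ^ m *ᵥ v) = 0}.Infinite) (m : ℕ) :
    w ⬝ᵥ ((1 + (p : ℤ) ^ 2 • D) ^ m *ᵥ v) = 0 := by
  have key : ∀ m : ℕ, w ⬝ᵥ ((1 + (p : ℤ) ^ 2 • D) ^ m *ᵥ v) =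
      ∑ k ∈ Finset.range (m + 1),
        (m.choose k : ℤ) * ((p : ℤ) ^ (2 * k) * (w ⬝ᵥ (D ^ k *ᵥ v))) := by
    intro m
    rw [add_comm, (Commute.one_right _).add_pow, Matrix.sum_mulVec, dotProduct_sum]
    refine Finset.sum_congr rfl fun k _ => ?_
    rw [one_pow, mul_one, smul_pow, ← pow_mul, ← nsmul_eq_mul', Matrix.smul_mulVec,
      Matrix.smul_mulVec, dotProduct_smul, dotProduct_smul]
    simp
  simp only [key] at hinf ⊢
  have := sum_choose_mul_eq_zero_of_infinite _ hinf
  simp [this]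

/-- For a matrix over `ℤ[X]` with nonzero determinant, there is a common period such that each
sequence `w ⬝ A ^ (N * m) v` with infinitely many zeros is identically zero. -/
theorem exists_period_matrix_mvPolynomial {τ ι : Type*} [Fintype ι] [DecidableEq ι]
    (A : Matrix ι ι (MvPolynomial τ ℤ)) (hA : A.det ≠ 0) :
    ∃ N : ℕ, 0 < N ∧ ∀ v w : ι → MvPolynomial τ ℤ,
      {m : ℕ | w ⬝ᵥ (A ^ (N * m) *ᵥ v) = 0}.Infinite → ∀ m, w ⬝ᵥ (A ^ (N * m) *ᵥ v) = 0 := by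
  obtain ⟨a, ha⟩ : ∃ a : τ → ℤ, MvPolynomial.eval a A.det ≠ 0 := by
    by_contra! h
    exact hA (MvPolynomial.funext fun x => by rw [h x, map_zero])
  obtain ⟨p, hpgt, hp⟩ := Nat.exists_infinite_primes ((MvPolynomial.eval a A.det).natAbs + 1)
  have : Fact p.Prime := ⟨hp⟩
  have hpa : ¬ (p : ℤ) ∣ MvPolynomial.eval a A.det := fun h =>
    absurd (Nat.le_of_dvd (Int.natAbs_pos.2 ha) (Int.natCast_dvd.1 h)) (by omega)
  have : NeZero (p ^ 2) := ⟨pow_ne_zero _ hp.ne_zero⟩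
  refine ⟨Nat.card (GL ι (ZMod (p ^ 2))), Nat.card_pos, fun v w hinf m => ?_⟩
  set N := Nat.card (GL ι (ZMod (p ^ 2))) with hN
  refine MvPolynomial.funext_set (fun i => Set.range fun s : ℤ => a i + p * s)
    (fun i => Set.infinite_range_of_injective fun s t h => ?_) fun x hx => ?_
  · simpa [hp.ne_zero] using h
  set f := MvPolynomial.eval x with hf
  have hxa : (p : ℤ) ∣ f A.det - MvPolynomial.eval a A.det := by
    rw [← ZMod.intCast_zmod_eq_zero_iff_dvd, Int.cast_sub, sub_eq_zero]
    have h (y : τ → ℤ) : ((MvPolynomial.eval y A.det : ℤ) : ZMod p) =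
        MvPolynomial.eval₂ (Int.castRingHom (ZMod p)) (fun i => (y i : ZMod p)) A.det :=
      MvPolynomial.eval₂_comp_left (Int.castRingHom (ZMod p)) (RingHom.id ℤ) y A.det
    rw [hf, h, h]
    congr 1
    ext i
    obtain ⟨s, hs⟩ := hx i trivial
    simp [← hs]
  have hdet : ¬ (p : ℤ) ∣ (f.mapMatrix A).det := by
    rw [← RingHom.map_det]
    exact fun h => hpa ((dvd_sub_right h).1 hxa)
  have hunit : IsUnit ((Int.castRingHom (ZMod (p ^ 2))).mapMatrix (f.mapMatrix A)) := by
    rw [Matrix.isUnit_iff_isUnit_det, ← RingHom.map_det, eq_intCast,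
      ZMod.coe_int_isUnit_iff_isCoprime]
    push_cast
    exact ((Nat.prime_iff_prime_int.1 hp).coprime_iff_not_dvd.2 hdet).pow_left
  obtain ⟨D, hD⟩ : ∃ D : Matrix ι ι ℤ, f.mapMatrix A ^ N = 1 + (p : ℤ) ^ 2 • D := by
    have h1 : (Int.castRingHom (ZMod (p ^ 2))).mapMatrix (f.mapMatrix A ^ N) = 1 := by
      rw [map_pow, ← hunit.unit_spec, ← Units.val_pow_eq_pow_val, hN, pow_card_eq_one',
        Units.val_one]
    have h2 : ∀ i j, ((p ^ 2 : ℕ) : ℤ) ∣ (f.mapMatrix A ^ N - 1) i j := by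
      intro i j
      rw [← ZMod.intCast_zmod_eq_zero_iff_dvd]
      have h3 : (Int.castRingHom (ZMod (p ^ 2))).mapMatrix (f.mapMatrix A ^ N - 1) = 0 := by
        rw [map_sub, h1, map_one, sub_self]
      exact congrFun (congrFun h3 i) j
    choose D hD using h2
    refine ⟨Matrix.of D, ?_⟩
    rw [← sub_eq_iff_eq_add']
    ext i j
    rw [hD]
    simp
  have key : ∀ m, f (w ⬝ᵥ (A ^ (N * m) *ᵥ v)) =
      (f ∘ w) ⬝ᵥ ((1 + (p : ℤ) ^ 2 • D) ^ m *ᵥ (f ∘ v)) := by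
    intro m
    rw [← hD, ← pow_mul, ← map_pow, RingHom.map_dotProduct]
    congr 1
    ext i
    simp [RingHom.map_mulVec]
  rw [map_zero, key]
  refine dotProduct_one_add_pow_mulVec_eq_zero D _ _ (hinf.mono fun m hm => ?_) m
  rw [Set.mem_ofPred_eq, ← key, hm, map_zero]

/-- A finite family over a fraction field has a common denominator. -/
theorem exists_common_denominator (R : Type*) {F κ : Type*} [CommRing R] [IsDomain R] [Field F]
    [Algebra R F] [IsFractionRing R F] [Finite κ] (g : κ → F) :
    ∃ (c : R) (g' : κ → R), c ≠ 0 ∧ ∀ i, algebraMap R F (g' i) = algebraMap R F c * g i := by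
  obtain ⟨c, hc⟩ := IsLocalization.exist_integer_multiples_of_finite (nonZeroDivisors R) g
  choose g' hg' using hc
  exact ⟨c, g', nonZeroDivisors.coe_ne_zero c, fun i => by rw [hg', Algebra.smul_def]⟩

/-- Over the fraction field of a polynomial ring `ℤ[X]`, an injective endomorphism `T` of a
finite-dimensional space has a common period `N` such that each sequence `φ (T ^ (N * m) v)` with
infinitely many zeros is identically zero. -/
theorem exists_period_end_fractionRing (τ : Type*) {F V : Type*} [Field F]
    [Algebra (MvPolynomial τ ℤ) F] [IsFractionRing (MvPolynomial τ ℤ) F] [AddCommGroup V]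
    [Module F V] [FiniteDimensional F V] (T : Module.End F V) (hT : Function.Injective T) :
    ∃ N : ℕ, 0 < N ∧ ∀ (v : V) (φ : Module.Dual F V),
      {m : ℕ | φ ((T ^ (N * m)) v) = 0}.Infinite → ∀ m, φ ((T ^ (N * m)) v) = 0 := by
  classical
  let b := Module.finBasis F V
  let f := algebraMap (MvPolynomial τ ℤ) F
  have hf : Function.Injective f := IsFractionRing.injective _ F
  set B := LinearMap.toMatrix b b T with hB
  obtain ⟨c, A', hc, hA'⟩ := exists_common_denominator (MvPolynomial τ ℤ)
    fun ij : Fin (Module.finrank F V) × Fin (Module.finrank F V) => B ij.1 ij.2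
  let A : Matrix _ _ (MvPolynomial τ ℤ) := Matrix.of fun i j => A' (i, j)
  have hA : f.mapMatrix A = f c • B := by
    ext i j
    exact hA' (i, j)
  have hfc : f c ≠ 0 := (map_ne_zero_iff f hf).2 hc
  have hdet : A.det ≠ 0 := by
    rw [← map_ne_zero_iff f hf, RingHom.map_det, hA, Matrix.det_smul, hB, LinearMap.det_toMatrix]
    refine mul_ne_zero (pow_ne_zero _ hfc) ?_
    exact ((LinearMap.isUnit_iff_isUnit_det T).1
      ((LinearMap.isUnit_iff_ker_eq_bot T).2 (LinearMap.ker_eq_bot.2 hT))).ne_zero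
  obtain ⟨N, hN, h⟩ := exists_period_matrix_mvPolynomial A hdet
  refine ⟨N, hN, fun v φ => ?_⟩
  obtain ⟨cv, v', hcv, hv'⟩ := exists_common_denominator (MvPolynomial τ ℤ) (b.repr v)
  obtain ⟨cw, w', hcw, hw'⟩ := exists_common_denominator (MvPolynomial τ ℤ) fun i => φ (b i)
  have key : ∀ m, φ ((T ^ (N * m)) v) = 0 ↔ w' ⬝ᵥ (A ^ (N * m) *ᵥ v') = 0 := by
    intro m
    have hφ : ∀ x, φ x = (fun i => φ (b i)) ⬝ᵥ b.repr x := by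
      intro x
      conv_lhs => rw [← b.sum_repr x]
      rw [map_sum]
      simp only [map_smul, smul_eq_mul, dotProduct, mul_comm]
    have hw : f ∘ w' = f cw • fun i => φ (b i) := funext hw'
    have hv : f ∘ v' = f cv • ⇑(b.repr v) := funext hv'
    have : f (w' ⬝ᵥ (A ^ (N * m) *ᵥ v')) =
        f cw * (f c ^ (N * m) * (f cv * φ ((T ^ (N * m)) v))) := by
      have h1 : f ∘ (A ^ (N * m) *ᵥ v') = f.mapMatrix (A ^ (N * m)) *ᵥ (f ∘ v') := by
        ext i
        simp [RingHom.map_mulVec]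
      rw [RingHom.map_dotProduct, h1, map_pow, hA, hw, hv, smul_pow, Matrix.smul_mulVec,
        Matrix.mulVec_smul, hB, LinearMap.toMatrix_pow, LinearMap.toMatrix_mulVec_repr,
        smul_dotProduct, dotProduct_smul, dotProduct_smul, ← hφ]
      rfl
    rw [← map_eq_zero_iff f hf, this]
    simp [hfc, (map_ne_zero_iff f hf).2 hcv, (map_ne_zero_iff f hf).2 hcw]
  simpa only [key] using h v' w'

/-- Descent of the period statement along an algebraic extension. -/
theorem exists_period_end_of_isAlgebraic (τ : Type*) (F : Type*) {K ι : Type*} [Field F]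
    [Algebra (MvPolynomial τ ℤ) F] [IsFractionRing (MvPolynomial τ ℤ) F] [Field K] [Algebra F K]
    [Algebra.IsAlgebraic F K] [Fintype ι] (T : Module.End K (ι → K)) (hT : Function.Injective T)
    (v : ι → K) (W : Submodule K (ι → K)) :
    ∃ N : ℕ, 0 < N ∧ ∀ r, {m : ℕ | (T ^ (N * m + r)) v ∈ W}.Infinite →
      ∀ m, (T ^ (N * m + r)) v ∈ W := by
  classical
  set A := LinearMap.toMatrix' T with hA
  set E : Set K := Set.range (fun ij : ι × ι => A ij.1 ij.2) ∪ Set.range v with hE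
  let L := Algebra.adjoin F E
  have : Module.Finite F L := Algebra.finite_adjoin_of_finite_of_isIntegral
    ((Set.finite_range _).union (Set.finite_range _))
    fun x _ => Algebra.IsIntegral.isIntegral x
  let A' : Matrix ι ι L := Matrix.of fun i j =>
    ⟨A i j, Algebra.subset_adjoin (Or.inl ⟨(i, j), rfl⟩)⟩
  let v' : ι → L := fun i => ⟨v i, Algebra.subset_adjoin (Or.inr ⟨i, rfl⟩)⟩
  let T' : Module.End F (ι → L) := (Matrix.toLin' A').restrictScalars F
  let j : (ι → L) →ₗ[F] (ι → K) := LinearMap.compLeft L.val.toLinearMap ι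
  have hj : Function.Injective j := fun x y h => funext fun i => Subtype.ext (congrFun h i)
  have hTj : ∀ x, j (T' x) = T (j x) := by
    intro x
    rw [← Matrix.toLin'_toMatrix' T, Matrix.toLin'_apply, ← hA]
    ext i
    simp [j, T', A', Matrix.mulVec, dotProduct]
  have hTpow : ∀ m x, j ((T' ^ m) x) = (T ^ m) (j x) := by
    intro m
    induction m with
    | zero => simp
    | succ m ih => intro x; rw [pow_succ, pow_succ, Module.End.mul_apply, ih, hTj]; rfl
  obtain ⟨N, hN, h⟩ := exists_period_end_fractionRing τ T' fun x y hxy =>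
    hj (hT (by rw [← hTj, ← hTj, hxy]))
  refine ⟨N, hN, fun r hinf m => ?_⟩
  have key : ∀ (ℓ : Module.Dual F ((ι → K) ⧸ W)) (m : ℕ),
      (ℓ ∘ₗ W.mkQ.restrictScalars F ∘ₗ j) ((T' ^ (N * m)) ((T' ^ r) v')) =
        ℓ (W.mkQ ((T ^ (N * m + r)) v)) := by
    intro ℓ m
    rw [pow_add, LinearMap.comp_apply, LinearMap.comp_apply, hTpow, hTpow]
    rfl
  rw [← Submodule.Quotient.mk_eq_zero, ← Submodule.mkQ_apply,
    ← Module.forall_dual_apply_eq_zero_iff F]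
  intro ℓ
  rw [← key]
  refine h _ _ (hinf.mono fun m hm => ?_) m
  rw [Set.mem_ofPred_eq, key, Submodule.mkQ_apply, (Submodule.Quotient.mk_eq_zero W).2 hm, map_zero]

/-- An injective endomorphism `T` of `K ^ ι` has a period `N` such that the set of `m` with
`T ^ m v ∈ W` meets each residue class modulo `N` in a finite set or contains it. -/
theorem exists_period_end {K ι : Type*} [Field K] [CharZero K] [Fintype ι]
    (T : Module.End K (ι → K)) (hT : Function.Injective T) (v : ι → K)
    (W : Submodule K (ι → K)) :
    ∃ N : ℕ, 0 < N ∧ ∀ r, {m : ℕ | (T ^ (N * m + r)) v ∈ W}.Infinite →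
      ∀ m, (T ^ (N * m + r)) v ∈ W := by
  obtain ⟨τ, x, hx⟩ := exists_isTranscendenceBasis' ℤ K
  let := (MvPolynomial.aeval (R := ℤ) x).toRingHom.toAlgebra
  have : FaithfulSMul (MvPolynomial τ ℤ) K :=
    (faithfulSMul_iff_algebraMap_injective _ _).2 hx.1
  let := FractionRing.liftAlgebra (MvPolynomial τ ℤ) K
  have := FractionRing.isScalarTower_liftAlgebra (MvPolynomial τ ℤ) K
  have : Algebra.IsAlgebraic (MvPolynomial τ ℤ) K := by
    have := hx.isAlgebraic
    let e := hx.1.aevalEquiv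
    refine ⟨fun y => ?_⟩
    have hy := Algebra.IsAlgebraic.isAlgebraic (R := Algebra.adjoin ℤ (Set.range x)) y
    refine hy.of_ringHom_of_comp_eq e.toRingHom (RingHom.id K) e.surjective Function.injective_id ?_
    ext z
    · simp
    · exact hx.1.algebraMap_aevalEquiv _
  have : Algebra.IsAlgebraic (FractionRing (MvPolynomial τ ℤ)) K :=
    (IsFractionRing.comap_isAlgebraic_iff (A := MvPolynomial τ ℤ)).1 this
  exact exists_period_end_of_isAlgebraic τ (FractionRing (MvPolynomial τ ℤ)) T hT v W

end

/-- A set that is finite or everything on each residue class modulo `N` has the SML property. -/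
theorem oneSidedSML_of_period {S : Set ℕ} {N : ℕ} (hN : 0 < N)
    (h : ∀ r, {m : ℕ | N * m + r ∈ S}.Infinite → ∀ m, N * m + r ∈ S) : OneSidedSML S := by
  classical
  set I := (Finset.range N).filter fun r => {m : ℕ | N * m + r ∈ S}.Infinite with hI
  set U : Set ℕ := ⋃ q ∈ I.image fun r => (N, N + r), {k : ℕ | ∃ n : ℕ, k = q.1 * n + q.2} with hU
  have hUS : U ⊆ S := by
    intro k hk
    simp only [hU, Set.mem_iUnion, Finset.mem_image] at hk
    obtain ⟨_, ⟨r, hr, rfl⟩, n, rfl⟩ := hk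
    have := h r (Finset.mem_filter.1 hr).2 (n + 1)
    rwa [mul_add, mul_one, add_assoc] at this
  refine ⟨I.image fun r => (N, N + r), S \ U, ?_, ?_, (Set.union_sdiff_cancel hUS).symm⟩
  · refine ((Set.finite_lt_nat N).union (Set.Finite.biUnion (s := {r | r < N ∧ r ∉ I})
      ((Set.finite_lt_nat N).subset fun r hr => hr.1)
      (t := fun r => (fun m => N * m + r) '' {m : ℕ | N * m + r ∈ S}) fun r hr => ?_)).subset ?_
    · refine Set.Finite.image _ (Set.not_infinite.1 fun hinf => hr.2 ?_)
      exact Finset.mem_filter.2 ⟨Finset.mem_range.2 hr.1, hinf⟩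
    · rintro k ⟨hkS, hkU⟩
      rcases lt_or_ge k N with hk | hk
      · exact Or.inl hk
      have hkdiv : N * (k / N) + k % N = k := Nat.div_add_mod k N
      refine Or.inr (Set.mem_biUnion (x := k % N) ⟨Nat.mod_lt _ hN, fun hr => hkU ?_⟩
        ⟨k / N, by rwa [Set.mem_ofPred_eq, hkdiv], hkdiv⟩)
      refine Set.mem_biUnion (x := (N, N + k % N)) (Finset.mem_image_of_mem _ hr) ⟨k / N - 1, ?_⟩
      have h1 : k / N = k / N - 1 + 1 := by have := Nat.div_pos hk hN; omega
      rw [h1] at hkdiv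
      rw [← add_assoc, ← Nat.mul_succ]
      exact hkdiv.symm
  · intro q hq
    obtain ⟨r, _, rfl⟩ := Finset.mem_image.1 hq
    exact ⟨hN, Nat.add_pos_left hN r⟩

/-- **Skolem–Mahler–Lech theorem, linear map form.**
Let `K` be a field of characteristic zero, `σ : K^n → K^n` an invertible linear
map, `v ∈ K^n`, and `W ⊆ K^n` a subspace of codimension `1`. Then the set
`{m ∈ ℕ : σ^m v ∈ W}` has the one-sided SML property. -/
theorem stmt2 {K : Type*} [Field K] [CharZero K] (n : ℕ)
    (σ : (Fin n → K) ≃ₗ[K] (Fin n → K)) (v : Fin n → K)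
    (W : Submodule K (Fin n → K))
    (hW : Module.finrank K ((Fin n → K) ⧸ W) = 1) :
    OneSidedSML {m : ℕ | (σ ^ m) v ∈ W} := by
  have hpow : ∀ m : ℕ, (σ ^ m) v = ((σ : Module.End K (Fin n → K)) ^ m) v := by
    intro m
    induction m with
    | zero => rfl
    | succ m ih => rw [pow_succ', pow_succ', Module.End.mul_apply, ← ih]; rfl
  obtain ⟨N, hN, h⟩ := exists_period_end (σ : Module.End K (Fin n → K)) σ.injective v W
  refine oneSidedSML_of_period hN fun r => ?_
  simpa only [Set.mem_ofPred_eq, hpow] using h r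
end

section
/- Let K be an algebraically closed field of characteristic zero, let A be a finitely generated reduced commutative K-algebra, and let σ : A → A be a K-algebra automorphism. If M is a maximal ideal of A and J is a radical ideal of A, then the set S := {n ∈ ℤ : σ^n(M) ⊇ J} has the two-sided SML property. -/
/-- A set `S ⊆ ℤ` has the two-sided SML property if it is a finite union of
complete doubly infinite arithmetic progressions `{a*n + b : n ∈ ℤ}` (allowing
`a = 0`, which gives singletons), together with a finite set. -/
def TwoSidedSML (S : Set ℤ) : Prop :=
  ∃ (P : Finset (ℤ × ℤ)) (F : Set ℤ), F.Finite ∧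
    S = (⋃ q ∈ P, {k : ℤ | ∃ n : ℤ, k = q.1 * n + q.2}) ∪ F

open Polynomial Filter Topology in
/-- **Strassmann's theorem** for Newton series: a series `∑ a k * n.descFactorial k` with `p`-adic
coefficients tending to zero that vanishes at infinitely many `n : ℕ` is zero. -/
theorem padic_newton_series_eq_zero {p : ℕ} [Fact p.Prime] (a : ℕ → ℚ_[p])
    (ha : Tendsto a atTop (𝓝 0))
    (hz : {n : ℕ | ∑ k ∈ Finset.range (n + 1), a k * (n.descFactorial k : ℚ_[p]) = 0}.Infinite) :
    ∀ k, a k = 0 := by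
  by_contra! hne
  obtain ⟨k₀, hk₀⟩ := hne
  have hfin : {k | ‖a k₀‖ ≤ ‖a k‖}.Finite := by
    have h := ha.norm.eventually_lt_const (u := ‖a k₀‖) (by simpa using hk₀)
    rw [← Nat.cofinite_eq_atTop, Filter.eventually_cofinite] at h
    simpa using h
  obtain ⟨N, hN, hmax⟩ := hfin.toFinset.exists_max_image (fun k ↦ toLex (‖a k‖, k))
    ⟨k₀, by simp⟩
  simp only [Set.Finite.mem_toFinset, Set.mem_ofPred_eq] at hN hmax
  have hN0 : a N ≠ 0 := by
    intro h
    rw [h, norm_zero] at hN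
    exact hk₀ (norm_le_zero_iff.1 hN)
  have hle : ∀ k, ‖a k‖ ≤ ‖a N‖ := fun k ↦ by
    rcases le_total ‖a k₀‖ ‖a k‖ with h | h
    · rcases (Prod.Lex.toLex_le_toLex.1 (hmax k h)) with h | h
      exacts [h.le, h.1.le]
    · exact h.trans hN
  have hlt : ∀ k, N < k → ‖a k‖ < ‖a N‖ := fun k hk ↦ by
    rcases le_or_gt ‖a k₀‖ ‖a k‖ with h | h
    · rcases (Prod.Lex.toLex_le_toLex.1 (hmax k h)) with h | h
      exacts [h, absurd h.2 (not_le.2 hk)]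
    · exact h.trans_le hN
  let b : ℕ → ℤ_[p] := fun k ↦ ⟨a k / a N, by
    rw [norm_div]; exact div_le_one_of_le₀ (hle k) (norm_nonneg _)⟩
  have hb : ∀ k, (b k : ℚ_[p]) = a k / a N := fun k ↦ rfl
  obtain ⟨s, hs, hcard⟩ := hz.exists_subset_card_eq (N + 1)
  obtain ⟨B, hB⟩ : ∃ B, N ≤ B ∧ ∀ n ∈ s, n ≤ B :=
    ⟨max N (s.sup id), le_max_left _ _, fun n hn ↦ le_max_of_le_right (Finset.le_sup (f := id) hn)⟩
  let H : ℤ_[p][X] := ∑ k ∈ Finset.range (B + 1), C (b k) * descPochhammer ℤ_[p] k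
  have hroot : ∀ n ∈ s, H.eval (n : ℤ_[p]) = 0 := by
    intro n hn
    have h1 : (∑ k ∈ Finset.range (n + 1), a k * (n.descFactorial k : ℚ_[p])) = 0 := hs hn
    have h2 : H.eval (n : ℤ_[p]) =
        ∑ k ∈ Finset.range (n + 1), b k * (n.descFactorial k : ℤ_[p]) := by
      simp only [H, eval_finsetSum, eval_mul, eval_C, descPochhammer_eval_eq_descFactorial]
      symm
      apply Finset.sum_subset (Finset.range_mono (by have := hB.2 n hn; omega))
      intro k _ hk
      rw [Nat.descFactorial_of_lt (by simpa using hk)]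
      simp
    have h3 : ((H.eval (n : ℤ_[p]) : ℤ_[p]) : ℚ_[p]) =
        (∑ k ∈ Finset.range (n + 1), a k * (n.descFactorial k : ℚ_[p])) / a N := by
      rw [h2, PadicInt.coe_sum, Finset.sum_div]
      refine Finset.sum_congr rfl fun k _ ↦ ?_
      rw [PadicInt.coe_mul, hb, PadicInt.coe_natCast, div_mul_eq_mul_div]
    rw [h1, zero_div] at h3
    exact PadicInt.ext h3
  let f : ℤ_[p] →+* ZMod p := PadicInt.toZMod
  have hbN : b N = 1 := by
    apply Subtype.ext; rw [hb]; exact div_self hN0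
  have hbk : ∀ k, N < k → f (b k) = 0 := by
    intro k hk
    rw [← RingHom.mem_ker, PadicInt.ker_toZMod, IsLocalRing.mem_maximalIdeal,
      PadicInt.mem_nonunits, ← PadicInt.padic_norm_e_of_padicInt, hb, norm_div,
      div_lt_one (norm_pos_iff.2 hN0)]
    exact hlt k hk
  have hHf : H.map f = descPochhammer (ZMod p) N +
      ∑ k ∈ Finset.range N, C (f (b k)) * descPochhammer (ZMod p) k := by
    simp only [H, Polynomial.map_sum, Polynomial.map_mul, map_C, descPochhammer_map]
    rw [← Finset.sum_subset (Finset.range_mono (show N + 1 ≤ B + 1 by omega)),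
      Finset.sum_range_succ, hbN]
    · simp [add_comm]
    · intro k _ hk
      rw [hbk k (by simpa using hk)]
      simp
  have hdeg : (∑ k ∈ Finset.range N, C (f (b k)) * descPochhammer (ZMod p) k).degree
      < (descPochhammer (ZMod p) N).degree := by
    rw [degree_eq_natDegree (monic_descPochhammer _ _).ne_zero, descPochhammer_natDegree]
    refine (degree_sum_le _ _).trans_lt ((Finset.sup_lt_iff (WithBot.bot_lt_coe N)).2 ?_)
    intro k hk
    rw [← smul_eq_C_mul]
    refine (degree_smul_le _ _).trans_lt ?_
    rw [degree_eq_natDegree (monic_descPochhammer _ _).ne_zero, descPochhammer_natDegree]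
    exact Nat.cast_lt.2 (Finset.mem_range.1 hk)
  have hmonic : (H.map f).Monic := by
    rw [hHf]; exact (monic_descPochhammer _ _).add_of_left hdeg
  have hHdeg : (H.map f).natDegree = N := by
    rw [hHf, natDegree_add_eq_left_of_degree_lt hdeg, descPochhammer_natDegree]
  have hH0 : H ≠ 0 := by
    intro h; rw [h, Polynomial.map_zero] at hmonic; exact hmonic.ne_zero rfl
  have hdvd : (∏ n ∈ s, (X - C (n : ℤ_[p]))) ∣ H := by
    have : (s.val.map (fun n : ℕ ↦ (n : ℤ_[p]))) ≤ H.roots := by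
      rw [Multiset.le_iff_subset (s.nodup.map Nat.cast_injective)]
      intro x hx
      obtain ⟨n, hn, rfl⟩ := Multiset.mem_map.1 hx
      exact (mem_roots hH0).2 (hroot n hn)
    have := (Multiset.prod_X_sub_C_dvd_iff_le_roots hH0 _).2 this
    rwa [Multiset.map_map] at this
  have hdvd' := Polynomial.map_dvd f hdvd
  have hle' := natDegree_le_of_dvd hdvd' hmonic.ne_zero
  rw [hHdeg, Polynomial.map_prod] at hle'
  simp only [Polynomial.map_sub, map_X, map_C] at hle'
  rw [natDegree_prod_of_monic _ _ (fun n _ ↦ monic_X_sub_C _)] at hle'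
  simp only [natDegree_X_sub_C, Finset.sum_const, hcard, smul_eq_mul] at hle'
  omega

open Filter Topology in
theorem padicInt_mahler_series_eq_zero {p : ℕ} [Fact p.Prime] (c : ℕ → ℤ_[p])
    (hc : ∀ k, (p : ℤ_[p]) ^ (2 * k) ∣ c k)
    (hz : {n : ℕ | ∑ k ∈ Finset.range (n + 1), n.choose k • c k = 0}.Infinite) :
    ∀ k, c k = 0 := by
  have hp : (1 : ℝ) < p := by exact_mod_cast (Fact.out : p.Prime).one_lt
  have hfac : ∀ k : ℕ, ((k.factorial : ℕ) : ℚ_[p]) ≠ 0 := fun k ↦ by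
    exact_mod_cast k.factorial_ne_zero
  have hv : ∀ k : ℕ, ((p : ℝ) ^ k)⁻¹ ≤ ‖((k.factorial : ℕ) : ℚ_[p])‖ := by
    intro k
    rw [Padic.norm_eq_zpow_neg_valuation (hfac k), Padic.valuation_natCast, zpow_neg,
      zpow_natCast]
    have h1 : padicValNat p k.factorial ≤ k := by
      have h := sub_one_mul_padicValNat_factorial (p := p) k
      have : 1 ≤ p - 1 := by have := (Fact.out : p.Prime).two_le; omega
      nlinarith [Nat.sub_le k (p.digits k).sum]
    gcongr
    exact hp.le
  have key := padic_newton_series_eq_zero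
    (fun k ↦ (c k : ℚ_[p]) / ((k.factorial : ℕ) : ℚ_[p])) ?_ ?_
  · intro k
    have := key k
    rw [div_eq_zero_iff, or_iff_left (hfac k)] at this
    exact PadicInt.ext this
  · refine squeeze_zero_norm (a := fun k ↦ ((p : ℝ)⁻¹) ^ k) ?_
      (tendsto_pow_atTop_nhds_zero_of_lt_one (by positivity) (inv_lt_one_of_one_lt₀ hp))
    intro k
    have h2 : ‖c k‖ ≤ (p : ℝ) ^ (-((2 * k : ℕ) : ℤ)) := by
      rw [PadicInt.norm_le_pow_iff_mem_span_pow, Ideal.mem_span_singleton]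
      exact hc k
    rw [zpow_neg, zpow_natCast, two_mul, pow_add, mul_inv] at h2
    rw [norm_div, PadicInt.padic_norm_e_of_padicInt, inv_pow, div_le_iff₀ (norm_pos_iff.2 (hfac k))]
    exact h2.trans (by gcongr; exact hv k)
  · refine hz.mono fun n hn ↦ ?_
    simp only [Set.mem_ofPred_eq] at hn ⊢
    rw [← PadicInt.coe_eq_zero] at hn
    rw [← hn, PadicInt.coe_sum]
    refine Finset.sum_congr rfl fun k _ ↦ ?_
    rw [nsmul_eq_mul, PadicInt.coe_mul, PadicInt.coe_natCast,
      Nat.descFactorial_eq_factorial_mul_choose]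
    have := hfac k
    push_cast
    field_simp

theorem mahler_series_eq_zero_of_free {p : ℕ} [Fact p.Prime] {O : Type*} [CommRing O]
    [Algebra ℤ_[p] O] [Module.Free ℤ_[p] O] (c : ℕ → O)
    (hc : ∀ k, (p : O) ^ (2 * k) ∣ c k)
    (hz : {n : ℕ | ∑ k ∈ Finset.range (n + 1), n.choose k • c k = 0}.Infinite) :
    ∀ k, c k = 0 := by
  let b := Module.Free.chooseBasis ℤ_[p] O
  intro k
  refine b.ext_elem fun i ↦ ?_
  rw [map_zero, Finsupp.zero_apply]
  refine padicInt_mahler_series_eq_zero (fun k ↦ b.coord i (c k)) (fun k ↦ ?_) ?_ k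
  · obtain ⟨d, hd⟩ := hc k
    have : c k = (p : ℤ_[p]) ^ (2 * k) • d := by
      rw [hd, Algebra.smul_def, map_pow, map_natCast]
    simp only [this, map_smul, smul_eq_mul]
    exact dvd_mul_right _ _
  · refine hz.mono fun n hn ↦ ?_
    simp only [Set.mem_ofPred_eq] at hn ⊢
    rw [← map_zero (b.coord i), ← hn, map_sum]
    exact Finset.sum_congr rfl fun k _ ↦ (map_nsmul _ _ _).symm

theorem sub_one_pow_mem_pow {B : Type*} [CommRing B] (τ : B →+* B) (I : Ideal B)
    (hτ : ∀ x, τ x - x ∈ I ^ 2) (k : ℕ) (x : B) :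
    ((τ.toIntAlgHom.toLinearMap - 1) ^ k : Module.End ℤ B) x ∈ I ^ k := by
  have hI : ∀ x ∈ I, τ x ∈ I := fun x hx ↦ by
    have := I.add_mem (Ideal.pow_le_self two_ne_zero (hτ x)) hx
    simpa using this
  have step : ∀ k, ∀ x ∈ I ^ k, τ x - x ∈ I ^ (k + 1) := by
    intro k
    induction k with
    | zero => exact fun x _ ↦ by simpa using Ideal.pow_le_self two_ne_zero (hτ x)
    | succ k ih =>
      intro x hx
      rw [pow_succ] at hx
      refine Submodule.mul_induction_on hx (fun m hm n hn ↦ ?_) (fun x y hx hy ↦ ?_)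
      · have : τ (m * n) - m * n = (τ m - m) * τ n + m * (τ n - n) := by
          rw [map_mul]; ring
        rw [this]
        refine add_mem ?_ ?_
        · rw [pow_succ]; exact Ideal.mul_mem_mul (ih m hm) (hI n hn)
        · rw [show k + 1 + 1 = k + 2 from rfl, pow_add]; exact Ideal.mul_mem_mul hm (hτ n)
      · rw [map_add, add_sub_add_comm]; exact add_mem hx hy
  induction k with
  | zero => simp
  | succ k ih =>
    have h := step k _ ih
    rwa [pow_succ' (τ.toIntAlgHom.toLinearMap - 1)]

/-- If `τ` is the identity modulo `I ^ 2` and `φ` maps `I` into `p ^ 2 O`, then `φ (τ^[n] f)`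
vanishes for all `n` as soon as it vanishes for infinitely many `n`. -/
theorem forall_apply_iterate_eq_zero {p : ℕ} [Fact p.Prime] {O B : Type*} [CommRing O]
    [Algebra ℤ_[p] O] [Module.Free ℤ_[p] O] [CommRing B] (φ : B →+* O) (τ : B →+* B)
    (I : Ideal B) (hI : ∀ x ∈ I, (p : O) ^ 2 ∣ φ x) (hτ : ∀ x, τ x - x ∈ I ^ 2) (f : B)
    (hz : {n : ℕ | φ (τ^[n] f) = 0}.Infinite) (n : ℕ) : φ (τ^[n] f) = 0 := by
  let T : Module.End ℤ B := τ.toIntAlgHom.toLinearMap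
  let c : ℕ → O := fun k ↦ φ (((T - 1) ^ k : Module.End ℤ B) f)
  have hexp : ∀ n, φ (τ^[n] f) = ∑ k ∈ Finset.range (n + 1), n.choose k • c k := by
    intro n
    have h1 : τ^[n] f = (T ^ n) f := by
      rw [Module.End.pow_apply]; rfl
    rw [h1, ← sub_add_cancel T 1, (Commute.one_right (T - 1)).add_pow, LinearMap.sum_apply,
      map_sum]
    refine Finset.sum_congr rfl fun k _ ↦ ?_
    rw [one_pow, mul_one, ← nsmul_eq_mul', LinearMap.smul_apply, map_nsmul]
  have hc : ∀ k, c k = 0 := by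
    refine mahler_series_eq_zero_of_free (p := p) c (fun k ↦ ?_) (by simpa only [hexp] using hz)
    have hle : I.map φ ≤ Ideal.span {(p : O) ^ 2} :=
      Ideal.map_le_iff_le_comap.2 fun x hx ↦ Ideal.mem_span_singleton.2 (hI x hx)
    have := Ideal.mem_map_of_mem φ (sub_one_pow_mem_pow τ I hτ k f)
    rw [Ideal.map_pow] at this
    have := Ideal.pow_right_mono hle k this
    rwa [Ideal.span_singleton_pow, Ideal.mem_span_singleton, ← pow_mul] at this
  rw [hexp]
  simp [hc]

theorem exists_pow_sub_mem {B : Type*} [CommRing B] [Algebra.FiniteType ℤ B] (σ : B ≃+* B)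
    (I : Ideal B) [Finite (B ⧸ I)] : ∃ b : ℕ, 0 < b ∧ ∀ x, (σ ^ b) x - x ∈ I := by
  obtain ⟨s, hs⟩ := (inferInstance : Algebra.FiniteType ℤ B).out
  let π := Ideal.Quotient.mk I
  obtain ⟨m, n, hmn, h⟩ := Finite.exists_ne_map_eq_of_infinite
    (fun (n : ℕ) (x : s) ↦ π ((σ ^ n) x))
  wlog hlt : m < n generalizing m n
  · exact this n m hmn.symm h.symm (lt_of_le_of_ne (not_lt.1 hlt) hmn.symm)
  have key : ∀ x, π ((σ ^ m) x) = π ((σ ^ n) x) := by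
    have : (π.comp (σ ^ m : B ≃+* B).toRingHom).toIntAlgHom =
        (π.comp (σ ^ n : B ≃+* B).toRingHom).toIntAlgHom :=
      AlgHom.ext_of_adjoin_eq_top hs fun x hx ↦ congrFun h ⟨x, hx⟩
    exact fun x ↦ DFunLike.congr_fun this x
  refine ⟨n - m, by omega, fun x ↦ ?_⟩
  rw [← Ideal.Quotient.eq]
  have := key ((σ ^ m)⁻¹ x)
  rw [← RingAut.mul_apply, ← RingAut.mul_apply, mul_inv_cancel, ← pow_sub σ hlt.le] at this
  exact this.symm

theorem finite_quotient_span_prime_pow {p : ℕ} [Fact p.Prime] {O : Type*} [CommRing O]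
    [Algebra ℤ_[p] O] [Module.Finite ℤ_[p] O] (n : ℕ) :
    Finite (O ⧸ Ideal.span {(p : O) ^ n}) := by
  have : Finite (ℤ_[p] ⧸ Ideal.span {(p : ℤ_[p]) ^ n}) := by
    rw [← PadicInt.ker_toZModPow]
    have : NeZero (p ^ n) := ⟨pow_ne_zero _ (Fact.out : p.Prime).ne_zero⟩
    exact Finite.of_injective _ (RingHom.kerLift_injective (PadicInt.toZModPow (p := p) n))
  have h := Submodule.finite_quotient_smul (M := O) (Ideal.span {(p : ℤ_[p]) ^ n}) (N := ⊤)
    Module.Finite.fg_top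
  let q : O →ₗ[ℤ_[p]] O ⧸ Ideal.span {(p : O) ^ n} := (Ideal.Quotient.mkₐ ℤ_[p] _).toLinearMap
  refine Finite.of_surjective
    (Submodule.liftQ (Ideal.span {(p : ℤ_[p]) ^ n} • (⊤ : Submodule ℤ_[p] O)) q ?_) fun y ↦ ?_
  · refine Submodule.smul_le.2 fun r hr x _ ↦ ?_
    obtain ⟨d, rfl⟩ := Ideal.mem_span_singleton.1 hr
    refine Ideal.Quotient.eq_zero_iff_mem.2 ?_
    rw [Algebra.smul_def, map_mul, map_pow, map_natCast, mul_assoc]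
    exact Ideal.mul_mem_right _ _ (Ideal.mem_span_singleton_self _)
  · obtain ⟨x, rfl⟩ := Ideal.Quotient.mk_surjective y
    exact ⟨Submodule.Quotient.mk x, rfl⟩

open Cardinal in
theorem PadicInt.exists_algebraicIndependent (p : ℕ) [Fact p.Prime] (n : ℕ) :
    ∃ t : Fin n → ℤ_[p], AlgebraicIndependent ℤ t := by
  have : FaithfulSMul ℤ ℤ_[p] :=
    (faithfulSMul_iff_algebraMap_injective _ _).2 (algebraMap ℤ ℤ_[p]).injective_int
  obtain ⟨s, hs⟩ := exists_isTranscendenceBasis ℤ ℤ_[p]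
  have hc : ℵ₀ < #ℤ_[p] := by
    by_contra! h
    have h1 : #ℚ_[p] ≤ ℵ₀ := by
      have := (mk_le_aleph0_iff.1 h)
      have hinj : Function.Surjective (fun x : ℤ_[p] × ℤ_[p] ↦ (x.1 : ℚ_[p]) / x.2) := by
        intro y
        obtain ⟨a, b, _, h⟩ := IsFractionRing.div_surjective (A := ℤ_[p]) y
        exact ⟨(a, b), h⟩
      exact mk_le_aleph0_iff.2 hinj.countable
    exact absurd ((continuum_le_cardinal_of_nontriviallyNormedField ℚ_[p]).trans h1)
      (not_le.2 aleph0_lt_continuum)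
  have hinf : s.Infinite := by
    intro hfin
    have : Algebra.IsAlgebraic (Algebra.adjoin ℤ (Set.range ((↑) : s → ℤ_[p]))) ℤ_[p] :=
      hs.isAlgebraic
    have h1 := Algebra.IsAlgebraic.cardinalMk_le_max
      (Algebra.adjoin ℤ (Set.range ((↑) : s → ℤ_[p]))) ℤ_[p]
    have hfin' : Finite s := hfin
    have h2 : #(Algebra.adjoin ℤ (Set.range ((↑) : s → ℤ_[p]))) ≤ ℵ₀ := by
      rw [← mk_congr hs.1.aevalEquiv.toEquiv]
      refine (MvPolynomial.cardinalMk_le_max_lift).trans ?_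
      simp
    exact absurd (h1.trans (max_le h2 le_rfl)) (not_le.2 hc)
  have : Infinite s := hinf.to_subtype
  let e : Fin n ↪ s := Fin.valEmbedding.trans (Infinite.natEmbedding s)
  exact ⟨_, hs.1.comp e e.injective⟩

theorem exists_prime_forall_not_dvd_den (D : Finset ℚ) :
    ∃ p : ℕ, p.Prime ∧ ∀ q ∈ D, ¬ p ∣ q.den := by
  obtain ⟨p, hp, hp'⟩ := Nat.exists_infinite_primes (D.sup Rat.den + 1)
  refine ⟨p, hp', fun q hq h ↦ ?_⟩
  have h1 := Nat.le_of_dvd q.den_pos h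
  have h2 := Finset.le_sup (f := Rat.den) hq
  omega

theorem RingHom.apply_mem_adjoin_image {S B C : Type*} [CommRing S] [CommRing B] [CommRing C]
    [Algebra S C] (θ : B →+* C) {s : Set B} (hs : Algebra.adjoin ℤ s = ⊤) (x : B) :
    θ x ∈ Algebra.adjoin S (θ '' s) := by
  have hx : x ∈ Algebra.adjoin ℤ s := hs ▸ Algebra.mem_top
  induction hx using Algebra.adjoin_induction with
  | mem x hx => exact Algebra.subset_adjoin ⟨x, hx, rfl⟩
  | algebraMap r => simp
  | add x y _ _ hx hy => rw [map_add]; exact add_mem hx hy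
  | mul x y _ _ hx hy => rw [map_mul]; exact mul_mem hx hy

/-- **Lech's embedding**: a finitely generated subring of a field of characteristic zero embeds
into a finite free `ℤ_[p]`-algebra for some prime `p`. -/
theorem exists_padicInt_algebra_ringHom {B K : Type*} [CommRing B] [Algebra.FiniteType ℤ B]
    [Field K] [CharZero K] (χ : B →+* K) :
    ∃ (p : ℕ) (_ : Fact p.Prime) (O : Type) (_ : CommRing O) (_ : Algebra ℤ_[p] O)
      (_ : Module.Finite ℤ_[p] O) (_ : Module.Free ℤ_[p] O) (φ : B →+* O),
      ∀ x, φ x = 0 ↔ χ x = 0 := by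
  classical
  obtain ⟨s, hs⟩ := (inferInstance : Algebra.FiniteType ℤ B).out
  let R : Subalgebra ℚ K := Algebra.adjoin ℚ (χ '' s)
  have : Algebra.FiniteType ℚ R :=
    R.fg_iff_finiteType.1 (Subalgebra.fg_def.2 ⟨_, s.finite_toSet.image χ, rfl⟩)
  have hχR : ∀ x, χ x ∈ R := RingHom.apply_mem_adjoin_image χ hs
  let χR : B →+* R := χ.codRestrict R hχR
  obtain ⟨n, g, hg, hint⟩ := exists_integral_inj_algHom_of_fg ℚ R
  choose P hPm hP using fun x : B ↦ hint (χR x)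
  let D : Finset ℚ := s.biUnion fun x ↦ (P x).coeffs.biUnion fun q ↦ q.support.image q.coeff
  obtain ⟨p, hp, hpD⟩ := exists_prime_forall_not_dvd_den D
  have : Fact p.Prime := ⟨hp⟩
  obtain ⟨t, ht⟩ := PadicInt.exists_algebraicIndependent p n
  have : Algebra.IsAlgebraic ℤ ℚ := IsLocalization.isAlgebraic ℚ (nonZeroDivisors ℤ)
  have htQ : AlgebraicIndependent ℚ (fun i ↦ (t i : ℚ_[p])) :=
    (ht.map' (f := (algebraMap ℤ_[p] ℚ_[p]).toIntAlgHom)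
      (IsFractionRing.injective ℤ_[p] ℚ_[p])).extendScalars ℚ
  let e : MvPolynomial (Fin n) ℚ →ₐ[ℚ] ℚ_[p] := MvPolynomial.aeval fun i ↦ (t i : ℚ_[p])
  let Ω := AlgebraicClosure ℚ_[p]
  let e' : MvPolynomial (Fin n) ℚ →+* Ω := (algebraMap ℚ_[p] Ω).comp e.toRingHom
  have he' : Function.Injective e' := (algebraMap ℚ_[p] Ω).injective.comp htQ
  algebraize [g.toRingHom, e']
  have : Module.IsTorsionFree (MvPolynomial (Fin n) ℚ) R :=
    Module.isTorsionFree_iff_algebraMap_injective.2 hg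
  have : Module.IsTorsionFree (MvPolynomial (Fin n) ℚ) Ω :=
    Module.isTorsionFree_iff_algebraMap_injective.2 he'
  have : Algebra.IsIntegral (MvPolynomial (Fin n) ℚ) R := ⟨hint⟩
  let ψ : R →ₐ[MvPolynomial (Fin n) ℚ] Ω := IsAlgClosed.lift
  have hψ : Function.Injective ψ := by
    rw [injective_iff_map_eq_zero]
    intro x hx
    have : RingHom.ker ψ.toRingHom = ⊥ := by
      refine Ideal.eq_bot_of_comap_eq_bot (R := MvPolynomial (Fin n) ℚ) ?_
      rw [eq_bot_iff]
      intro y hy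
      refine he' ?_
      rw [map_zero]
      have h : ψ (algebraMap _ R y) = 0 := hy
      rwa [ψ.commutes] at h
    exact this.le hx
  have heint : ∀ q : MvPolynomial (Fin n) ℚ, (∀ m ∈ q.support, ‖((q.coeff m : ℚ) : ℚ_[p])‖ ≤ 1) →
      ∃ z : ℤ_[p], (z : ℚ_[p]) = e q := by
    intro q hq
    suffices h : e q ∈ PadicInt.subring p from ⟨⟨e q, h⟩, rfl⟩
    rw [MvPolynomial.aeval_def, MvPolynomial.eval₂_eq]
    refine sum_mem fun m hm ↦ mul_mem ?_ (prod_mem fun i _ ↦ pow_mem (t i).2 _)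
    simpa using hq m hm
  have hintψ : ∀ x ∈ s, IsIntegral ℤ_[p] (ψ (χR x)) := by
    intro x hx
    have hlift : (P x).map e.toRingHom ∈ Polynomial.lifts (algebraMap ℤ_[p] ℚ_[p]) := by
      rw [Polynomial.lifts_iff_coeff_lifts]
      intro k
      rw [Polynomial.coeff_map]
      refine heint _ fun m hm ↦ Padic.norm_rat_le_one (hpD _ ?_)
      by_cases h : (P x).coeff k = 0
      · simp [h] at hm
      · simp only [D, Finset.mem_biUnion, Finset.mem_image]
        exact ⟨x, hx, _, Polynomial.coeff_mem_coeffs h, m, hm, rfl⟩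
    obtain ⟨Q, hQ, _, hQm⟩ :=
      Polynomial.lifts_and_natDegree_eq_and_monic hlift ((hPm x).map _)
    refine ⟨Q, hQm, ?_⟩
    rw [IsScalarTower.algebraMap_eq ℤ_[p] ℚ_[p] Ω, ← Polynomial.eval₂_map, hQ,
      Polynomial.eval₂_map]
    have hcomp : ψ.toRingHom.comp g.toRingHom = e' := ψ.comp_algebraMap
    have h := Polynomial.hom_eval₂ (P x) g.toRingHom ψ.toRingHom (χR x)
    rw [hP, hcomp, map_zero] at h
    exact h.symm
  let θ : B →+* Ω := ψ.toRingHom.comp χR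
  let O : Subalgebra ℤ_[p] Ω := Algebra.adjoin ℤ_[p] (θ '' s)
  have hθ : ∀ x, θ x ∈ O := RingHom.apply_mem_adjoin_image θ hs
  have hOfin : Module.Finite ℤ_[p] O := Module.Finite.iff_fg.2 <|
    fg_adjoin_of_finite (s.finite_toSet.image θ) (by rintro _ ⟨x, hx, rfl⟩; exact hintψ x hx)
  have hinj : Function.Injective (algebraMap ℤ_[p] Ω) := by
    rw [IsScalarTower.algebraMap_eq ℤ_[p] ℚ_[p] Ω]
    exact (algebraMap ℚ_[p] Ω).injective.comp (IsFractionRing.injective ℤ_[p] ℚ_[p])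
  have : Module.IsTorsionFree ℤ_[p] O :=
    Module.isTorsionFree_iff_algebraMap_injective.2 fun x y h ↦ hinj (congrArg Subtype.val h)
  refine ⟨p, ⟨hp⟩, O, inferInstance, inferInstance, hOfin,
    Module.free_of_finite_type_torsion_free', θ.codRestrict O hθ, fun x ↦ ?_⟩
  rw [← Subtype.coe_inj]
  change ψ (χR x) = 0 ↔ _
  rw [map_eq_zero_iff ψ hψ, ← Subtype.coe_inj]
  rfl

theorem RingEquiv.iterate_eq_pow_apply {B : Type*} [CommRing B] (ρ : B ≃+* B) (n : ℕ) (x : B) :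
    (ρ : B →+* B)^[n] x = (ρ ^ n) x := by
  induction n with
  | zero => rfl
  | succ n ih => rw [Function.iterate_succ_apply', ih, pow_succ']; rfl

theorem exists_period_finite_or_forall {B K : Type*} [CommRing B] [Algebra.FiniteType ℤ B]
    [Field K] [CharZero K] (χ : B →+* K) (σ : B ≃+* B) :
    ∃ b : ℕ, 0 < b ∧ ∀ f : B, {n : ℤ | χ ((σ ^ (b * n)) f) = 0}.Finite ∨
      ∀ n : ℤ, χ ((σ ^ (b * n)) f) = 0 := by
  obtain ⟨p, _, O, _, _, _, _, φ, hφ⟩ := exists_padicInt_algebra_ringHom χ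
  simp only [← hφ]
  let J : Ideal O := Ideal.span {(p : O) ^ 2}
  let I : Ideal B := J.comap φ
  have hI : ∀ x ∈ I, (p : O) ^ 2 ∣ φ x := fun x hx ↦ Ideal.mem_span_singleton.1 hx
  have : Finite (O ⧸ J) := finite_quotient_span_prime_pow (p := p) 2
  have : Finite (B ⧸ I) :=
    Finite.of_injective (Ideal.quotientMap J φ le_rfl) Ideal.quotientMap_injective
  have : IsNoetherianRing B := Algebra.FiniteType.isNoetherianRing ℤ B
  have : Finite (B ⧸ I ^ 2) := Ideal.finite_quotient_pow (IsNoetherian.noetherian I) 2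
  obtain ⟨b, hb, hσ⟩ := exists_pow_sub_mem σ (I ^ 2)
  have hσ' : ∀ x, (σ ^ b)⁻¹ x - x ∈ I ^ 2 := fun x ↦ by
    have h := neg_mem (hσ ((σ ^ b)⁻¹ x))
    rwa [← RingAut.mul_apply, mul_inv_cancel, neg_sub] at h
  have hup : ∀ (m : ℤ) (n : ℕ) (f : B), ((σ ^ b : B ≃+* B) : B →+* B)^[n] ((σ ^ (b * m)) f) =
      (σ ^ (b * (m + n))) f := fun m n f ↦ by
    rw [RingEquiv.iterate_eq_pow_apply, ← RingAut.mul_apply, ← pow_mul, ← zpow_natCast, ← zpow_add]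
    congr 2; push_cast; ring
  have hdown : ∀ (m : ℤ) (n : ℕ) (f : B),
      (((σ ^ b)⁻¹ : B ≃+* B) : B →+* B)^[n] ((σ ^ (b * m)) f) = (σ ^ (b * (m - n))) f :=
    fun m n f ↦ by
      rw [RingEquiv.iterate_eq_pow_apply, ← RingAut.mul_apply, inv_pow, ← pow_mul, ← zpow_natCast,
        ← zpow_neg, ← zpow_add]
      congr 2; push_cast; ring
  refine ⟨b, hb, fun f ↦ or_iff_not_imp_left.2 fun hinf m ↦ ?_⟩
  by_contra hm
  refine hinf ?_
  have h₁ : {n : ℕ | φ ((σ ^ (b * (m + n))) f) = 0}.Finite := by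
    by_contra h
    exact hm (forall_apply_iterate_eq_zero (p := p) φ ((σ ^ b : B ≃+* B) : B →+* B) I hI hσ
      ((σ ^ (b * m)) f) (by simp only [hup]; exact h) 0)
  have h₂ : {n : ℕ | φ ((σ ^ (b * (m - n))) f) = 0}.Finite := by
    by_contra h
    exact hm (forall_apply_iterate_eq_zero (p := p) φ (((σ ^ b)⁻¹ : B ≃+* B) : B →+* B) I hI hσ'
      ((σ ^ (b * m)) f) (by simp only [hdown]; exact h) 0)
  refine ((h₁.image fun n : ℕ ↦ m + n).union (h₂.image fun n : ℕ ↦ m - n)).subset fun k hk ↦ ?_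
  simp only [Set.mem_ofPred_eq] at hk
  rcases le_total m k with h | h
  · refine Or.inl ⟨(k - m).toNat, ?_, ?_⟩
    · simpa [Int.toNat_of_nonneg (sub_nonneg.2 h)] using hk
    · simp [Int.toNat_of_nonneg (sub_nonneg.2 h)]
  · refine Or.inr ⟨(m - k).toNat, ?_, ?_⟩
    · simpa [Int.toNat_of_nonneg (sub_nonneg.2 h)] using hk
    · simp [Int.toNat_of_nonneg (sub_nonneg.2 h)]

theorem TwoSidedSML.of_period {S : Set ℤ} {b : ℕ} (hb : 0 < b)
    (h : ∀ r : ℤ, {q : ℤ | b * q + r ∈ S}.Finite ∨ ∀ q : ℤ, b * q + r ∈ S) :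
    TwoSidedSML S := by
  classical
  let R : Finset ℤ := Finset.Ico 0 (b : ℤ)
  let U : ℤ → Prop := fun r ↦ ∀ q : ℤ, b * q + r ∈ S
  have hmod : ∀ k : ℤ, k % b ∈ R := fun k ↦ Finset.mem_Ico.2
    ⟨Int.emod_nonneg _ (by omega), Int.emod_lt_of_pos _ (by omega)⟩
  refine ⟨(R.filter U).image fun r ↦ ((b : ℤ), r),
    ⋃ r ∈ R.filter (¬ U ·), (fun q : ℤ ↦ b * q + r) '' {q : ℤ | b * q + r ∈ S}, ?_, ?_⟩
  · refine (R.filter (¬ U ·)).finite_toSet.biUnion fun r hr ↦ Set.Finite.image _ ?_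
    exact (h r).resolve_right (Finset.mem_filter.1 hr).2
  · ext k
    simp only [Set.mem_union, Set.mem_iUnion, Finset.mem_image, Finset.mem_filter, Set.mem_image,
      Set.mem_ofPred_eq]
    constructor
    · intro hk
      by_cases hU : U (k % b)
      · exact Or.inl ⟨_, ⟨_, ⟨hmod k, hU⟩, rfl⟩, k / b, (Int.mul_ediv_add_emod k b).symm⟩
      · exact Or.inr ⟨_, ⟨hmod k, hU⟩, k / b, by rwa [Int.mul_ediv_add_emod],
          Int.mul_ediv_add_emod k b⟩
    · rintro (⟨_, ⟨r, ⟨-, hU⟩, rfl⟩, q, rfl⟩ | ⟨r, -, q, hq, rfl⟩)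
      exacts [hU q, hq]

theorem Algebra.exists_finset_mem_adjoin_int {K A : Type*} [Field K] [CommRing A] [Algebra K A]
    {s : Set A} {x : A} (hx : x ∈ Algebra.adjoin K s) :
    ∃ T : Finset K, x ∈ Algebra.adjoin ℤ (algebraMap K A '' T ∪ s) := by
  classical
  have mono : ∀ {T T' : Finset K}, T ⊆ T' →
      Algebra.adjoin ℤ (algebraMap K A '' T ∪ s) ≤ Algebra.adjoin ℤ (algebraMap K A '' T' ∪ s) :=
    fun h ↦ Algebra.adjoin_mono (Set.union_subset_union_left _ (Set.image_mono h))
  induction hx using Algebra.adjoin_induction with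
  | mem x hx => exact ⟨∅, Algebra.subset_adjoin (Or.inr hx)⟩
  | algebraMap r => exact ⟨{r}, Algebra.subset_adjoin (Or.inl ⟨r, by simp, rfl⟩)⟩
  | add x y _ _ hx hy =>
    obtain ⟨T, hT⟩ := hx
    obtain ⟨T', hT'⟩ := hy
    exact ⟨T ∪ T', add_mem (mono Finset.subset_union_left hT) (mono Finset.subset_union_right hT')⟩
  | mul x y _ _ hx hy =>
    obtain ⟨T, hT⟩ := hx
    obtain ⟨T', hT'⟩ := hy
    exact ⟨T ∪ T', mul_mem (mono Finset.subset_union_left hT) (mono Finset.subset_union_right hT')⟩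

/-- An automorphism of a finitely generated algebra over a field restricts to a finitely generated
subring containing a given finite set. -/
theorem AlgEquiv.exists_fg_invariant_subalgebra {K A : Type*} [Field K] [CommRing A] [Algebra K A]
    [Algebra.FiniteType K A] (σ : A ≃ₐ[K] A) (G : Finset A) :
    ∃ A₀ : Subalgebra ℤ A, A₀.FG ∧ (G : Set A) ⊆ A₀ ∧ (∀ x ∈ A₀, σ x ∈ A₀) ∧
      ∀ x ∈ A₀, σ.symm x ∈ A₀ := by
  classical
  obtain ⟨s, hs⟩ := (inferInstance : Algebra.FiniteType K A).out
  choose T hT using fun x : A ↦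
    Algebra.exists_finset_mem_adjoin_int (hs ▸ Algebra.mem_top : x ∈ Algebra.adjoin K (s : Set A))
  let W : Finset A := G ∪ s.image σ ∪ s.image σ.symm
  let A₀ : Subalgebra ℤ A := Algebra.adjoin ℤ (algebraMap K A '' (W.biUnion T : Finset K) ∪ s)
  have hW : ∀ w ∈ W, w ∈ A₀ := fun w hw ↦ Algebra.adjoin_mono
    (Set.union_subset_union_left _ (Set.image_mono (Finset.subset_biUnion_of_mem T hw))) (hT w)
  have hstable : ∀ ρ : A ≃ₐ[K] A, (∀ x ∈ s, ρ x ∈ A₀) → ∀ x ∈ A₀, ρ x ∈ A₀ := by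
    intro ρ hρ x hx
    induction hx using Algebra.adjoin_induction with
    | mem x hx =>
      rcases hx with ⟨c, hc, rfl⟩ | hx
      · rw [ρ.commutes]; exact Algebra.subset_adjoin (Or.inl ⟨c, hc, rfl⟩)
      · exact hρ x hx
    | algebraMap r => simp
    | add x y _ _ hx hy => rw [map_add]; exact add_mem hx hy
    | mul x y _ _ hx hy => rw [map_mul]; exact mul_mem hx hy
  refine ⟨A₀, Subalgebra.fg_def.2 ⟨_, ?_, rfl⟩, fun g hg ↦ hW g ?_, hstable σ fun x hx ↦ hW _ ?_,
    hstable σ.symm fun x hx ↦ hW _ ?_⟩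
  · exact ((Finset.finite_toSet _).image _).union s.finite_toSet
  · exact Finset.mem_union_left _ (Finset.mem_union_left _ hg)
  · exact Finset.mem_union_left _ (Finset.mem_union_right _ (Finset.mem_image_of_mem _ hx))
  · exact Finset.mem_union_right _ (Finset.mem_image_of_mem _ hx)

theorem AlgEquiv.exists_restrict {K A : Type*} [Field K] [CommRing A] [Algebra K A]
    (σ : A ≃ₐ[K] A) (A₀ : Subalgebra ℤ A) (h : ∀ x ∈ A₀, σ x ∈ A₀)
    (h' : ∀ x ∈ A₀, σ.symm x ∈ A₀) :
    ∃ σ₀ : A₀ ≃+* A₀, ∀ (n : ℤ) (x : A₀), ((σ₀ ^ n) x : A) = (σ ^ n) x := by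
  let σ₀ : A₀ ≃+* A₀ := RingEquiv.ofRingHom
    ((σ : A →+* A).restrict A₀ A₀ h) ((σ.symm : A →+* A).restrict A₀ A₀ h')
    (by ext x; exact σ.apply_symm_apply x) (by ext x; exact σ.symm_apply_apply x)
  have hpow : ∀ (n : ℕ) (x : A₀), ((σ₀ ^ n) x : A) = (σ ^ n) x := fun n ↦ by
    induction n with
    | zero => exact fun x ↦ rfl
    | succ n ih => intro x; rw [pow_succ, pow_succ]; exact ih (σ₀ x)
  refine ⟨σ₀, fun n x ↦ ?_⟩
  obtain ⟨n, rfl | rfl⟩ := n.eq_nat_or_neg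
  · simpa only [zpow_natCast] using hpow n x
  · rw [zpow_neg, zpow_neg, zpow_natCast, zpow_natCast]
    apply (σ ^ n).injective
    rw [← hpow, ← RingAut.mul_apply, ← AlgEquiv.mul_apply, mul_inv_cancel, mul_inv_cancel]
    rfl

/-- **Algebraic form of the generalized Skolem–Mahler–Lech theorem for affine
varieties.** Let `K` be an algebraically closed field of characteristic zero,
`A` a finitely generated reduced commutative `K`-algebra, `σ` a `K`-algebra
automorphism of `A`, `M` a maximal ideal and `J` a radical ideal of `A`. Then
the set `{n ∈ ℤ : σⁿ(M) ⊇ J}` has the two-sided SML property. -/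
theorem stmt3 {K A : Type*} [Field K] [CharZero K] [IsAlgClosed K]
    [CommRing A] [Algebra K A] [Algebra.FiniteType K A] [IsReduced A]
    (σ : A ≃ₐ[K] A) (M J : Ideal A) (hM : M.IsMaximal) (hJ : J.IsRadical) :
    TwoSidedSML {n : ℤ | J ≤ M.map (σ ^ n : A ≃ₐ[K] A)} := by
  have : IsNoetherianRing A := Algebra.FiniteType.isNoetherianRing K A
  obtain ⟨G, hG⟩ := IsNoetherian.noetherian J
  obtain ⟨A₀, hfg, hGA₀, hσ, hσ'⟩ := σ.exists_fg_invariant_subalgebra G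
  obtain ⟨σ₀, hσ₀⟩ := σ.exists_restrict A₀ hσ hσ'
  have : Algebra.FiniteType ℤ A₀ := A₀.fg_iff_finiteType.1 hfg
  let : Field (A ⧸ M) := Ideal.Quotient.field M
  have : CharZero (A ⧸ M) :=
    charZero_of_injective_algebraMap (algebraMap K (A ⧸ M)).injective
  let χ : A₀ →+* A ⧸ M := (Ideal.Quotient.mk M).comp A₀.subtype
  have hmem : ∀ n : ℤ, J ≤ M.map (σ ^ n : A ≃ₐ[K] A) ↔
      ∀ g : G, χ ((σ₀ ^ (-n)) ⟨g, hGA₀ g.2⟩) = 0 := by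
    intro n
    rw [← hG, Ideal.span_le, Set.subset_def, Subtype.forall]
    refine forall₂_congr fun g hg ↦ ?_
    change _ ↔ Ideal.Quotient.mk M ((σ₀ ^ (-n)) ⟨g, hGA₀ hg⟩ : A₀) = 0
    rw [hσ₀, Ideal.Quotient.eq_zero_iff_mem, SetLike.mem_coe, Ideal.mem_map_of_equiv, zpow_neg]
    constructor
    · rintro ⟨x, hx, rfl⟩
      rwa [← AlgEquiv.mul_apply, inv_mul_cancel]
    · intro hx
      refine ⟨_, hx, ?_⟩
      rw [← AlgEquiv.mul_apply, mul_inv_cancel]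
      rfl
  obtain ⟨b, hb, hdich⟩ := exists_period_finite_or_forall χ σ₀
  have hsplit : ∀ (q r : ℤ) (g : A₀),
      (σ₀ ^ (-(b * q + r))) g = (σ₀ ^ (b * (-q))) ((σ₀ ^ (-r)) g) := fun q r g ↦ by
    rw [← RingAut.mul_apply, ← zpow_add]
    congr 2; ring
  refine TwoSidedSML.of_period hb fun r ↦ or_iff_not_imp_left.2 fun hinf q ↦ ?_
  simp only [Set.mem_ofPred_eq, hmem, hsplit] at hinf ⊢
  intro g
  refine (hdich ((σ₀ ^ (-r)) ⟨g, hGA₀ g.2⟩)).resolve_left (fun hfin ↦ hinf ?_) (-q)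
  exact (hfin.preimage neg_injective.injOn).subset fun q hq ↦ hq g
end

section
/- Let K be any field of characteristic zero, let A be a finitely generated commutative K-algebra, and let σ : A → A be a K-algebra automorphism. If I and J are ideals of A, then the set S(I, J) := {n ∈ ℤ : σ^n(I) ⊇ J} has the two-sided SML property. -/
theorem exists_interpolation_weights (K : Type*) [Field K] [CharZero K] (s : Finset ℕ) (x : ℕ) :
    ∃ L : ℕ → K, ∀ j : ℕ, ∃ z : ℤ, (j < s.card → z = 0) ∧
      (j.factorial : K) * ((x.choose j : K) - ∑ k ∈ s, L k * (k.choose j : K)) = z := by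
  classical
  have hinj : Set.InjOn (fun k : ℕ => (k : K)) s := fun a _ b _ h => Nat.cast_injective h
  refine ⟨fun k => (Lagrange.basis s (fun k : ℕ => (k : K)) k).eval (x : K), fun j => ?_⟩
  set w : Polynomial ℤ := ∏ k ∈ s, (Polynomial.X - Polynomial.C (k : ℤ)) with hw
  have hwm : w.Monic := Polynomial.monic_prod_of_monic _ _ fun k _ => Polynomial.monic_X_sub_C _
  have hwd : w.natDegree = s.card := Polynomial.natDegree_finsetProd_X_sub_C_eq_card s _
  set q : Polynomial ℤ := descPochhammer ℤ j with hq
  have hqK : ∀ t : ℕ, (j.factorial : K) * (t.choose j : K) = ((q.eval (t : ℤ) : ℤ) : K) := by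
    intro t
    rw [hq, descPochhammer_eval_eq_descFactorial, Nat.descFactorial_eq_factorial_mul_choose]
    push_cast; rfl
  have hdiv := Polynomial.modByMonic_add_div q w
  set r := q %ₘ w with hr
  have hrd : (r.map (Int.castRingHom K)).degree < s.card := by
    refine lt_of_le_of_lt Polynomial.degree_map_le ?_
    have := Polynomial.degree_modByMonic_lt q hwm
    rwa [Polynomial.degree_eq_natDegree hwm.ne_zero, hwd] at this
  have hre : ∀ k ∈ s, r.eval (k : ℤ) = q.eval (k : ℤ) := by
    intro k hk
    have h0 : w.eval (k : ℤ) = 0 := by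
      rw [hw, Polynomial.eval_prod]
      exact Finset.prod_eq_zero hk (by simp)
    rw [← hdiv]; simp [h0]
  have hlag := Lagrange.eq_interpolate hinj hrd
  have hlag' : ((r.eval (x : ℤ) : ℤ) : K) = ∑ k ∈ s, ((q.eval (k : ℤ) : ℤ) : K) *
      (Lagrange.basis s (fun k : ℕ => (k : K)) k).eval (x : K) := by
    have h := congrArg (Polynomial.eval (x : K)) hlag
    rw [Lagrange.interpolate_apply, Polynomial.eval_finsetSum] at h
    have hev : ∀ t : ℕ, (r.map (Int.castRingHom K)).eval (t : K) = ((r.eval (t : ℤ) : ℤ) : K) := by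
      intro t
      simp
    rw [hev] at h
    rw [h]
    refine Finset.sum_congr rfl fun k hk => ?_
    rw [Polynomial.eval_mul, Polynomial.eval_C, hev, hre k hk]
  refine ⟨q.eval (x : ℤ) - r.eval (x : ℤ), fun hj => ?_, ?_⟩
  · have : r = q := by
      rw [hr, Polynomial.modByMonic_eq_self_iff hwm, Polynomial.degree_eq_natDegree hwm.ne_zero, hwd]
      refine lt_of_le_of_lt Polynomial.degree_le_natDegree ?_
      rw [hq, descPochhammer_natDegree]
      exact_mod_cast hj
    rw [this, sub_self]
  · push_cast
    rw [hlag', mul_sub, hqK, Finset.mul_sum]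
    congr 1
    refine Finset.sum_congr rfl fun k _ => ?_
    rw [← hqK]; ring

theorem pow_eq_sum_choose_smul {K A : Type*} [Field K] [AddCommGroup A] [Module K A]
    (T : Module.End K A) (f : A) {x E : ℕ} (hx : x < E) :
    (T ^ x) f = ∑ j ∈ Finset.range E, (x.choose j : K) • ((T - 1) ^ j) f := by
  have h : T ^ x = ∑ j ∈ Finset.range (x + 1), (T - 1) ^ j * (x.choose j : Module.End K A) := by
    conv_lhs => rw [← sub_add_cancel T 1]
    rw [(Commute.one_right (T - 1)).add_pow]
    simp
  have h2 : ∑ j ∈ Finset.range E, (x.choose j : K) • ((T - 1) ^ j) f =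
      ∑ j ∈ Finset.range (x + 1), (x.choose j : K) • ((T - 1) ^ j) f := by
    symm
    apply Finset.sum_subset
    · intro a ha; simp at ha ⊢; omega
    · intro a _ ha
      simp at ha
      rw [Nat.choose_eq_zero_of_lt (by omega)]; simp
  rw [h2, h, LinearMap.sum_apply]
  refine Finset.sum_congr rfl fun j _ => ?_
  simp [Nat.cast_smul_eq_nsmul]

theorem exists_factorial_eq_pow_mul {p : ℕ} (hp : p.Prime) (hp2 : p ≠ 2) (j : ℕ) :
    ∃ v t : ℕ, 2 * v ≤ j ∧ t.Coprime p ∧ j.factorial = p ^ v * t := by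
  have := Fact.mk hp
  have h := sub_one_mul_padicValNat_factorial (p := p) j
  refine ⟨padicValNat p j.factorial, j.factorial / p ^ padicValNat p j.factorial, ?_, ?_, ?_⟩
  · have h3 : 2 ≤ p - 1 := by have := hp.two_le; omega
    calc 2 * _ ≤ (p - 1) * padicValNat p j.factorial := Nat.mul_le_mul_right _ h3
      _ ≤ j := by rw [h]; omega
  · have := Nat.coprime_ordCompl hp (Nat.factorial_ne_zero j)
    rw [Nat.factorization_def _ hp] at this
    exact this.symm
  · exact (Nat.mul_div_cancel' pow_padicValNat_dvd).symm

theorem exists_sub_pow_mul_mem {K A : Type*} [Field K] [CharZero K] [CommRing A] [Algebra K A]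
    (T : Module.End K A) (B : Subring A) {p : ℕ} (hp : p.Prime) (hp2 : p ≠ 2)
    (hT : ∀ b ∈ B, ∃ c ∈ B, T b - b = p * c) (I : Ideal A) (e : ℕ) {f : A} (hf : f ∈ B)
    (s : Finset ℕ) (hs : 2 * e ≤ s.card) (hsI : ∀ k ∈ s, (T ^ k) f ∈ I) (x : ℕ) :
    ∃ b ∈ B, (T ^ x) f - (p : A) ^ e * b ∈ I := by
  have hg : ∀ j : ℕ, ∃ g ∈ B, ((T - 1) ^ j) f = (p : A) ^ j * g := by
    intro j
    induction j with
    | zero => exact ⟨f, hf, by simp⟩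
    | succ j ih =>
      obtain ⟨g, hgB, hg⟩ := ih
      obtain ⟨c, hcB, hc⟩ := hT g hgB
      refine ⟨c, hcB, ?_⟩
      have : (p : A) ^ j * g = (p ^ j : ℕ) • g := by simp
      rw [pow_succ', Module.End.mul_apply, hg, this, map_nsmul, LinearMap.sub_apply,
        Module.End.one_apply, hc]
      simp; ring
  have hTB : ∀ k : ℕ, (T ^ k) f ∈ B := by
    intro k
    induction k with
    | zero => simpa using hf
    | succ k ih =>
      obtain ⟨c, hcB, hc⟩ := hT _ ih
      rw [pow_succ', Module.End.mul_apply, ← sub_add_cancel (T ((T ^ k) f)) ((T ^ k) f), hc]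
      exact B.add_mem (B.mul_mem (natCast_mem B p) hcB) ih
  choose g hgB hg using hg
  obtain ⟨L, hL⟩ := exists_interpolation_weights K s x
  set y : A := (T ^ x) f - ∑ k ∈ s, L k • (T ^ k) f with hy
  have hyI : (T ^ x) f - y ∈ I := by
    rw [hy, sub_sub_cancel]
    refine I.sum_mem fun k hk => ?_
    rw [Algebra.smul_def]
    exact I.mul_mem_left _ (hsI k hk)
  obtain ⟨E, hxE, hsE⟩ : ∃ E : ℕ, x < E ∧ ∀ k ∈ s, k < E :=
    ⟨x + s.sup id + 1, by omega, fun k hk => by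
      have := Finset.le_sup (f := id) hk
      simp only [id] at this; omega⟩
  have hysum : y = ∑ j ∈ Finset.range E,
      ((x.choose j : K) - ∑ k ∈ s, L k * (k.choose j : K)) • ((p : A) ^ j * g j) := by
    have h1 : ∑ k ∈ s, L k • (T ^ k) f = ∑ k ∈ s, ∑ j ∈ Finset.range E,
        (L k * (k.choose j : K)) • ((p : A) ^ j * g j) := by
      refine Finset.sum_congr rfl fun k hk => ?_
      rw [pow_eq_sum_choose_smul T f (hsE k hk), Finset.smul_sum]
      exact Finset.sum_congr rfl fun j _ => by rw [hg, mul_smul]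
    rw [hy, h1, Finset.sum_comm, pow_eq_sum_choose_smul T f hxE, ← Finset.sum_sub_distrib]
    refine Finset.sum_congr rfl fun j _ => ?_
    rw [hg, sub_smul, Finset.sum_smul]
  have hyB : ∃ t : ℕ, t.Coprime p ∧ ∃ b ∈ B, (t : A) * y = (p : A) ^ e * b := by
    rw [hysum]
    refine Finset.sum_induction _
      (fun y : A => ∃ t : ℕ, t.Coprime p ∧ ∃ b ∈ B, (t : A) * y = (p : A) ^ e * b) ?_ ?_ ?_
    · rintro y₁ y₂ ⟨t₁, ht₁, b₁, hb₁, h₁⟩ ⟨t₂, ht₂, b₂, hb₂, h₂⟩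
      refine ⟨t₁ * t₂, ht₁.mul_left ht₂, t₂ * b₁ + t₁ * b₂, B.add_mem
        (B.mul_mem (natCast_mem B _) hb₁) (B.mul_mem (natCast_mem B _) hb₂), ?_⟩
      push_cast
      linear_combination (t₂ : A) * h₁ + (t₁ : A) * h₂
    · exact ⟨1, Nat.coprime_one_left p, 0, B.zero_mem, by simp⟩
    · intro j _
      obtain ⟨z, hz0, hz⟩ := hL j
      obtain ⟨v, t, hvj, htp, hfac⟩ := exists_factorial_eq_pow_mul hp hp2 j
      set c : K := (x.choose j : K) - ∑ k ∈ s, L k * (k.choose j : K)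
      rcases lt_or_ge j s.card with hj | hj
      · have hc : c = 0 := by
          rw [hz0 hj] at hz
          simpa [Nat.factorial_ne_zero] using hz
        exact ⟨1, Nat.coprime_one_left p, 0, B.zero_mem, by simp [hc]⟩
      · refine ⟨t, htp, z * ((p : A) ^ (j - v - e) * g j), B.mul_mem (intCast_mem B z)
          (B.mul_mem (B.pow_mem (natCast_mem B p) _) (hgB j)), ?_⟩
        rw [hfac] at hz
        have hA : (p : A) ^ v * t * algebraMap K A c = z := by
          have := congrArg (algebraMap K A) hz
          simpa using this
        have hpow : (p : A) ^ j = (p : A) ^ v * ((p : A) ^ e * (p : A) ^ (j - v - e)) := by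
          rw [← pow_add, ← pow_add]; congr 1; omega
        rw [Algebra.smul_def, hpow]
        linear_combination ((p : A) ^ e * (p : A) ^ (j - v - e)) * g j * hA
  obtain ⟨t, htp, b, hb, hyb⟩ := hyB
  obtain ⟨a, c, hac⟩ : IsCoprime (t : ℤ) ((p : ℤ) ^ e) := (Nat.isCoprime_iff_coprime.mpr htp).pow_right
  refine ⟨a * b + c * (T ^ x) f, B.add_mem (B.mul_mem (intCast_mem B a) hb)
    (B.mul_mem (intCast_mem B c) (hTB x)), ?_⟩
  have hacA : (a : A) * t + c * (p : A) ^ e = 1 := by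
    have := congrArg (Int.cast : ℤ → A) hac
    simpa using this
  have : (T ^ x) f - (p : A) ^ e * (a * b + c * (T ^ x) f) = (a * t) * ((T ^ x) f - y) := by
    linear_combination (-(T ^ x) f) * hacA + (a : A) * hyb
  rw [this]
  exact I.mul_mem_left _ hyI


theorem exists_prime_not_dvd_and_dvd_eval (H : Polynomial ℤ) (hH : 0 < H.natDegree) {N : ℕ}
    (hN : N ≠ 0) : ∃ p : ℕ, p.Prime ∧ ¬ p ∣ N ∧ ∃ n : ℤ, (p : ℤ) ∣ H.eval n := by
  by_cases h0 : H.coeff 0 = 0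
  · obtain ⟨p, hpN, hp⟩ := Nat.exists_infinite_primes (N + 1)
    refine ⟨p, hp, fun h => ?_, 0, ?_⟩
    · have := Nat.le_of_dvd (Nat.pos_of_ne_zero hN) h
      omega
    · rw [← Polynomial.coeff_zero_eq_eval_zero, h0]; exact dvd_zero _
  · set a := H.coeff 0
    have hfac : ∀ x : ℤ, H.eval (a * N * x) = a * (1 + N * x * H.divX.eval (a * N * x)) := by
      intro x
      conv_lhs => rw [← Polynomial.divX_mul_X_add H]
      simp; ring
    obtain ⟨x, hx⟩ : ∃ x : ℤ, (1 + N * x * H.divX.eval (a * N * x)).natAbs ≠ 1 := by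
      by_contra! hall
      have hz : H ^ 2 - Polynomial.C (a ^ 2) = 0 := by
        refine Polynomial.eq_zero_of_infinite_isRoot _ (Set.Infinite.mono (s := Set.range
          fun x : ℤ => a * N * x) ?_ (Set.infinite_range_of_injective ?_))
        · rintro _ ⟨x, rfl⟩
          have h1 : (1 + N * x * H.divX.eval (a * N * x)) ^ 2 = 1 := by
            rw [← Int.natAbs_sq, hall x]; norm_num
          simp only [Set.mem_ofPred_eq, Polynomial.IsRoot.def, Polynomial.eval_sub,
            Polynomial.eval_pow, Polynomial.eval_C, hfac, mul_pow, h1]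
          ring
        · intro x y hxy
          exact mul_left_cancel₀ (mul_ne_zero h0 (by exact_mod_cast hN)) hxy
      have := congrArg Polynomial.natDegree (sub_eq_zero.mp hz)
      rw [Polynomial.natDegree_pow, Polynomial.natDegree_C] at this
      omega
    obtain ⟨p, hp, hpd⟩ := Nat.exists_prime_and_dvd hx
    have hpd' := Int.natCast_dvd.mpr hpd
    refine ⟨p, hp, fun h => ?_, a * N * x, ?_⟩
    · have h1 : (p : ℤ) ∣ N * x * H.divX.eval (a * N * x) :=
        ((Int.natCast_dvd_natCast.mpr h).mul_right _).mul_right _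
      have h2 : (p : ℤ) ∣ 1 := (Int.dvd_add_left h1).mp hpd'
      exact hp.one_lt.ne' (by exact_mod_cast Int.eq_one_of_dvd_one (by positivity) h2)
    · rw [hfac]; exact hpd'.mul_left _

theorem exists_forall_norm_aeval_le_one (g : Polynomial ℚ) :
    ∃ b : ℕ, b ≠ 0 ∧ ∀ (p : ℕ) [Fact p.Prime], ¬ p ∣ b → ∀ z : ℤ_[p],
      ‖Polynomial.aeval (z : ℚ_[p]) g‖ ≤ 1 := by
  induction g using Polynomial.induction_on' with
  | add f g hf hg =>
    obtain ⟨b, hb, hf⟩ := hf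
    obtain ⟨c, hc, hg⟩ := hg
    refine ⟨b * c, mul_ne_zero hb hc, fun p _ hp z => ?_⟩
    rw [map_add]
    exact (Padic.nonarchimedean _ _).trans (max_le
      (hf p (fun h => hp (h.mul_right _)) z) (hg p (fun h => hp (h.mul_left _)) z))
  | monomial n a =>
    refine ⟨a.den, a.den_ne_zero, fun p _ hp z => ?_⟩
    rw [Polynomial.aeval_monomial, norm_mul, norm_pow]
    refine mul_le_one₀ ?_ (by positivity) (pow_le_one₀ (norm_nonneg _) z.2)
    simpa using Padic.norm_rat_le_one hp

theorem exists_algHom_padic_norm_le_one {L : Type*} [Field L] [Algebra ℚ L]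
    [FiniteDimensional ℚ L] (S : Finset L) :
    ∃ (p : ℕ) (_ : Fact p.Prime) (ψ : L →ₐ[ℚ] ℚ_[p]), p ≠ 2 ∧ ∀ x ∈ S, ‖ψ x‖ ≤ 1 := by
  classical
  let pb := Field.powerBasisOfFiniteOfSeparable ℚ L
  have hgen : IsIntegral ℚ pb.gen := Algebra.IsIntegral.isIntegral _
  set h := minpoly ℚ pb.gen with hh
  have hirr : Irreducible h := minpoly.irreducible hgen
  obtain ⟨u, v, huv⟩ : IsCoprime h (Polynomial.derivative h) := hirr.separable
  obtain ⟨c, hc, hcH⟩ := IsLocalization.integerNormalization_spec (nonZeroDivisors ℤ) h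
  set H := IsLocalization.integerNormalization (nonZeroDivisors ℤ) h
  have hc0 : c ≠ 0 := nonZeroDivisors.ne_zero hc
  have hcH' : H.map (algebraMap ℤ ℚ) = Polynomial.C (c : ℚ) * h := by
    rw [hcH, ← Polynomial.smul_eq_C_mul, Int.cast_smul_eq_zsmul]
  have hHdeg : 0 < H.natDegree := by
    have h1 := congrArg Polynomial.natDegree hcH'
    rw [Polynomial.natDegree_map_eq_of_injective (algebraMap ℤ ℚ).injective_int,
      Polynomial.natDegree_C_mul (by exact_mod_cast hc0)] at h1
    rw [h1]
    exact minpoly.natDegree_pos hgen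
  choose g hg using fun x : L => pb.exists_eq_aeval' x
  choose b hb0 hb using exists_forall_norm_aeval_le_one
  obtain ⟨p, hp, hpN, n, hpn⟩ := exists_prime_not_dvd_and_dvd_eval H hHdeg
    (N := 2 * c.natAbs * b u * b v * ∏ x ∈ S, b (g x)) (by
      have := Finset.prod_ne_zero_iff.mpr fun x (_ : x ∈ S) => hb0 (g x)
      simp [hc0, hb0]
      exact this)
  have hpf : Fact p.Prime := ⟨hp⟩
  simp only [hp.dvd_mul, not_or] at hpN
  obtain ⟨⟨⟨⟨hp2, hpc⟩, hpu⟩, hpv⟩, hpS⟩ := hpN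
  have hcast : ∀ (G : Polynomial ℤ) (z : ℤ_[p]), Polynomial.aeval (z : ℚ_[p])
      (G.map (algebraMap ℤ ℚ)) = ((Polynomial.aeval z G : ℤ_[p]) : ℚ_[p]) := by
    intro G z
    rw [Polynomial.aeval_map_algebraMap]
    exact Polynomial.aeval_algebraMap_apply ℚ_[p] z G
  have hcn : ‖((c : ℤ_[p]))‖ = 1 := by
    refine le_antisymm (PadicInt.norm_le_one _) (not_lt.mp fun hlt => hpc ?_)
    exact Int.natCast_dvd.mp ((PadicInt.norm_int_lt_one_iff_dvd c).mp hlt)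
  have hHn : ‖Polynomial.aeval (n : ℤ_[p]) H‖ < 1 := by
    have : Polynomial.aeval (n : ℤ_[p]) H = ((H.eval n : ℤ) : ℤ_[p]) := by
      simpa using Polynomial.aeval_algebraMap_apply ℤ_[p] n H
    rw [this]
    exact (PadicInt.norm_int_lt_one_iff_dvd _).mpr hpn
  have hHd : ‖Polynomial.aeval (n : ℤ_[p]) (Polynomial.derivative H)‖ = 1 := by
    have key : Polynomial.aeval ((n : ℤ_[p]) : ℚ_[p]) u *
        ((Polynomial.aeval (n : ℤ_[p]) H : ℤ_[p]) : ℚ_[p]) +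
        Polynomial.aeval ((n : ℤ_[p]) : ℚ_[p]) v *
        ((Polynomial.aeval (n : ℤ_[p]) (Polynomial.derivative H) : ℤ_[p]) : ℚ_[p]) =
        ((c : ℤ_[p]) : ℚ_[p]) := by
      rw [← hcast, ← hcast, ← Polynomial.derivative_map, hcH', Polynomial.derivative_C_mul,
        ← map_mul, ← map_mul, ← map_add]
      have : u * (Polynomial.C (c : ℚ) * h) + v * (Polynomial.C (c : ℚ) * Polynomial.derivative h) =
          Polynomial.C (c : ℚ) := by linear_combination Polynomial.C (c : ℚ) * huv
      rw [this]; simp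
    refine le_antisymm (PadicInt.norm_le_one _) (not_lt.mp fun hlt => ?_)
    have h1 := congrArg norm key
    rw [← PadicInt.norm_def, hcn] at h1
    refine absurd h1 (ne_of_lt ((Padic.nonarchimedean _ _).trans_lt (max_lt ?_ ?_)))
    · rw [norm_mul]
      exact (mul_le_of_le_one_left (norm_nonneg _) (hb u p hpu _)).trans_lt hHn
    · rw [norm_mul]
      exact (mul_le_of_le_one_left (norm_nonneg _) (hb v p hpv _)).trans_lt hlt
  obtain ⟨z, hz, -⟩ := hensels_lemma (p := p) (F := H) (a := (n : ℤ_[p])) (by rw [hHd]; simpa using hHn)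
  have hroot : Polynomial.aeval (z : ℚ_[p]) (minpoly ℚ pb.gen) = 0 := by
    have h1 := hcast H z
    rw [hz, hcH', map_mul, Polynomial.aeval_C] at h1
    simpa [hc0] using h1
  refine ⟨p, hpf, pb.lift (z : ℚ_[p]) hroot, ?_, fun x hx => ?_⟩
  · rintro rfl; exact hp2 dvd_rfl
  · rw [hg x, PowerBasis.lift_aeval]
    exact hb (g x) p (fun hd => hpS (hd.trans (Finset.dvd_prod_of_mem _ hx))) z

theorem exists_algHom_finiteDimensional_field.{u} {R : Type u} [CommRing R] [Algebra ℚ R]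
    [Algebra.FiniteType ℚ R] (P : Ideal R) (hP : P ≠ ⊤) :
    ∃ (L : Type u) (_ : Field L) (_ : Algebra ℚ L) (_ : FiniteDimensional ℚ L) (q : R →ₐ[ℚ] L),
      ∀ a ∈ P, q a = 0 := by
  obtain ⟨M, hM, hPM⟩ := Ideal.exists_le_maximal _ hP
  let : Field (R ⧸ M) := Ideal.Quotient.field M
  exact ⟨R ⧸ M, Ideal.Quotient.field M, inferInstance,
    finite_of_finite_type_of_isJacobsonRing ℚ (R ⧸ M), Ideal.Quotient.mkₐ ℚ M,
    fun a ha => Ideal.Quotient.eq_zero_iff_mem.mpr (hPM ha)⟩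

theorem exists_ringHom_padicInt {A : Type*} [CommRing A] [Algebra ℚ A] (S : Finset A)
    (P : Ideal A) (hP : P ≠ ⊤) :
    ∃ (p : ℕ) (_ : Fact p.Prime) (φ : Subring.closure (S : Set A) →+* ℤ_[p]), p ≠ 2 ∧
      ∀ a : Subring.closure (S : Set A), (a : A) ∈ P → φ a = 0 := by
  classical
  set R := Algebra.adjoin ℚ (S : Set A)
  have hfg : Algebra.FiniteType ℚ R := (Subalgebra.fg_iff_finiteType R).mp ⟨S, rfl⟩
  have hPR : P.comap R.val ≠ ⊤ := Ideal.comap_ne_top _ hP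
  obtain ⟨L, _, _, _, q, hq⟩ := exists_algHom_finiteDimensional_field _ hPR
  have hSR : ∀ x ∈ S, x ∈ R := fun x hx => Algebra.subset_adjoin hx
  let S' : Finset L := S.attach.image fun x => q ⟨x.1, hSR x.1 x.2⟩
  obtain ⟨p, hp, ψ, hp2, hψ⟩ := exists_algHom_padic_norm_le_one S'
  have hle : Subring.closure (S : Set A) ≤ R.toSubring :=
    Subring.closure_le.mpr Algebra.subset_adjoin
  let φ₀ : Subring.closure (S : Set A) →+* ℚ_[p] :=
    ((ψ.comp q : R →ₐ[ℚ] ℚ_[p]) : R →+* ℚ_[p]).comp (Subring.inclusion hle)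
  have hφ₀ : ∀ a, φ₀ a ∈ PadicInt.subring p := by
    rintro ⟨a, ha⟩
    induction ha using Subring.closure_induction with
    | mem x hx => exact hψ _ (Finset.mem_image.mpr ⟨⟨x, hx⟩, Finset.mem_attach _ _, rfl⟩)
    | zero => exact (map_zero φ₀).symm ▸ Subring.zero_mem _
    | one => exact (map_one φ₀).symm ▸ Subring.one_mem _
    | add x y hx hy h1 h2 => exact (map_add φ₀ ⟨x, hx⟩ ⟨y, hy⟩).symm ▸ Subring.add_mem _ h1 h2
    | neg x hx h1 => exact (map_neg φ₀ ⟨x, hx⟩).symm ▸ Subring.neg_mem _ h1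
    | mul x y hx hy h1 h2 => exact (map_mul φ₀ ⟨x, hx⟩ ⟨y, hy⟩).symm ▸ Subring.mul_mem _ h1 h2
  refine ⟨p, hp, φ₀.codRestrict (PadicInt.subring p) hφ₀, hp2, fun a ha => ?_⟩
  apply Subtype.ext
  change ψ (q ⟨a, hle a.2⟩) = 0
  rw [show q ⟨a, hle a.2⟩ = 0 from hq _ ha, map_zero]


theorem exists_pow_sub_mem_s4 {K A : Type*} [Field K] [CommRing A] [Algebra K A]
    (σ : A ≃ₐ[K] A) (R : Subring A) (T : Finset A) (hR : Subring.closure (T : Set A) = R)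
    (hσ : ∀ (k : ℤ), ∀ a ∈ R, (σ ^ k) a ∈ R) (J : AddSubgroup A)
    (hJ : ∀ r ∈ R, ∀ a ∈ J, r * a ∈ J) (V : Set A) (hV : V.Finite)
    (hTV : ∀ t ∈ T, ∀ k : ℕ, ∃ v ∈ V, (σ ^ k) t - v ∈ J) :
    ∃ n : ℕ, 0 < n ∧ ∀ a ∈ R, (σ ^ n) a - a ∈ J := by
  have : Finite V := hV
  choose! v hvV hv using hTV
  obtain ⟨i, j, hij, heq⟩ : ∃ i j : ℕ, i < j ∧ ∀ t ∈ T, v t i = v t j := by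
    obtain ⟨i, j, hne, h⟩ := Finite.exists_ne_map_eq_of_infinite
      fun (k : ℕ) (t : T) => (⟨v t k, hvV t t.2 k⟩ : V)
    have h' : ∀ t ∈ T, v t i = v t j := fun t ht => congrArg Subtype.val (congrFun h ⟨t, ht⟩)
    rcases lt_or_gt_of_ne hne with hlt | hlt
    · exact ⟨i, j, hlt, h'⟩
    · exact ⟨j, i, hlt, fun t ht => (h' t ht).symm⟩
  have hnat : ∀ (k : ℕ), ∀ a ∈ R, (σ ^ k) a ∈ R := fun k a ha => by
    simpa using hσ k a ha
  have hcong : ∀ a ∈ R, (σ ^ j) a - (σ ^ i) a ∈ J := by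
    intro a ha
    rw [← hR] at ha
    induction ha using Subring.closure_induction with
    | mem t ht =>
      have := J.sub_mem (hv t ht j) (hv t ht i)
      rwa [heq t ht, sub_sub_sub_cancel_right] at this
    | zero => simp
    | one => simp
    | add x y _ _ hx hy =>
      rw [map_add, map_add, add_sub_add_comm]
      exact J.add_mem hx hy
    | neg x _ hx =>
      rw [map_neg, map_neg, neg_sub_neg, ← neg_sub]
      exact J.neg_mem hx
    | mul x y hxR hyR hx hy =>
      rw [hR] at hxR hyR
      have : (σ ^ j) (x * y) - (σ ^ i) (x * y) =
          (σ ^ j) x * ((σ ^ j) y - (σ ^ i) y) + (σ ^ i) y * ((σ ^ j) x - (σ ^ i) x) := by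
        rw [map_mul, map_mul]; ring
      rw [this]
      exact J.add_mem (hJ _ (hnat j x hxR) _ hy) (hJ _ (hnat i y hyR) _ hx)
  refine ⟨j - i, Nat.sub_pos_of_lt hij, fun a ha => ?_⟩
  have h := hcong _ (hσ (-i) a ha)
  rw [← zpow_natCast, ← zpow_natCast, ← AlgEquiv.mul_apply, ← AlgEquiv.mul_apply, ← zpow_add,
    ← zpow_add] at h
  rw [← zpow_natCast, Nat.cast_sub hij.le]
  simpa [← sub_eq_add_neg] using h

theorem AlgEquiv.toLinearMap_pow_apply {K A : Type*} [Field K] [CommRing A] [Algebra K A]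
    (σ : A ≃ₐ[K] A) (n : ℕ) (a : A) : (σ.toLinearMap ^ n) a = (σ ^ n) a := by
  induction n with
  | zero => simp
  | succ n ih => rw [pow_succ', pow_succ', Module.End.mul_apply, ih]; rfl

theorem exists_mem_one_sub_mul_mem {A : Type*} [CommRing A] (B : Subring A) [IsNoetherianRing B]
    (I : Ideal A) (p : ℕ) {w : A} (hw : w ∈ B) (h : ∀ e : ℕ, ∃ b ∈ B, w - (p : A) ^ e * b ∈ I) :
    ∃ b ∈ B, (1 - p * b) * w ∈ I := by
  set I' : Ideal B := I.comap B.subtype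
  have hmem : Ideal.Quotient.mk I' ⟨w, hw⟩ ∈
      (⨅ i : ℕ, (Ideal.span {(p : B)}) ^ i • ⊤ : Submodule B (B ⧸ I')) := by
    rw [Submodule.mem_iInf]
    intro e
    obtain ⟨b, hb, hbI⟩ := h e
    have : Ideal.Quotient.mk I' ⟨w, hw⟩ = ((p : B) ^ e) • Ideal.Quotient.mk I' ⟨b, hb⟩ := by
      rw [Algebra.smul_def, Ideal.Quotient.algebraMap_eq, ← map_mul, Ideal.Quotient.mk_eq_mk_iff_sub_mem]
      simpa [I', Ideal.mem_comap] using hbI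
    rw [this]
    exact Submodule.smul_mem_smul (Ideal.pow_mem_pow (Ideal.mem_span_singleton_self _) e) trivial
  obtain ⟨⟨r, hr⟩, hrw⟩ := (Ideal.mem_iInf_smul_pow_eq_bot_iff _ _).mp hmem
  obtain ⟨b, rfl⟩ := Ideal.mem_span_singleton.mp hr
  refine ⟨b, b.2, ?_⟩
  rw [Algebra.smul_def, Ideal.Quotient.algebraMap_eq, ← map_mul, eq_comm,
    Ideal.Quotient.mk_eq_mk_iff_sub_mem] at hrw
  have := Ideal.mem_comap.mp hrw
  rw [sub_mul, one_mul]
  simpa using this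


theorem exists_step_eventually_or_all {K A : Type*} [Field K] [CharZero K] [CommRing A]
    [Algebra K A] (σ : A ≃ₐ[K] A) (R : Subring A) (S : Finset A)
    (hR : Subring.closure (S : Set A) = R) (hσ : ∀ (k : ℤ), ∀ a ∈ R, (σ ^ k) a ∈ R)
    (P : Ideal A) (hP : P ≠ ⊤) :
    ∃ N : ℕ, 0 < N ∧ ∀ (I : Ideal A), ∀ f ∈ R,
      {k : ℤ | (σ ^ (N * k : ℤ)) f ∈ I}.Infinite →
        ∀ k : ℤ, ∃ u, u ∉ P ∧ u * (σ ^ (N * k : ℤ)) f ∈ I := by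
  classical
  obtain ⟨p, hpf, φ, hp2, hφP⟩ :
      ∃ (p : ℕ) (_ : Fact p.Prime) (φ : R →+* ℤ_[p]), p ≠ 2 ∧
        ∀ a : R, (a : A) ∈ P → φ a = 0 := by
    subst hR
    let : Algebra ℚ A := ((algebraMap K A).comp (algebraMap ℚ K)).toAlgebra
    exact exists_ringHom_padicInt S P hP
  have hp : p.Prime := hpf.out
  have hRnoeth : IsNoetherianRing R := hR ▸ is_noetherian_subring_closure _ S.finite_toSet
  set χ : R →+* ZMod p := PadicInt.toZMod.comp φ with hχ
  set c : A := algebraMap K A (p : K)⁻¹ with hc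
  have hpc : (p : A) * c = 1 := by
    have h0 : (p : K) ≠ 0 := by exact_mod_cast hp.ne_zero
    rw [hc, ← map_natCast (algebraMap K A), ← map_mul, mul_inv_cancel₀ h0, map_one]
  have hSR : ∀ s ∈ S, s ∈ R := fun s hs => hR ▸ Subring.subset_closure hs
  -- the maximal ideal `M` of `R`, as a subgroup of `A`
  set M : AddSubgroup A := (RingHom.ker χ).toAddSubgroup.map R.subtype.toAddMonoidHom
  have hM : ∀ a : A, a ∈ M ↔ ∃ h : a ∈ R, χ ⟨a, h⟩ = 0 := by
    intro a
    constructor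
    · rintro ⟨r, hr, rfl⟩
      exact ⟨r.2, hr⟩
    · rintro ⟨h, h0⟩
      exact ⟨⟨a, h⟩, h0, rfl⟩
  have hMR : ∀ a ∈ M, a ∈ R := fun a ha => ((hM a).mp ha).1
  have hMmul : ∀ r ∈ R, ∀ a ∈ M, r * a ∈ M := by
    intro r hr a ha
    obtain ⟨h, h0⟩ := (hM a).mp ha
    refine (hM _).mpr ⟨R.mul_mem hr h, ?_⟩
    have := map_mul χ ⟨r, hr⟩ ⟨a, h⟩
    rwa [h0, mul_zero] at this
  have hMres : ∀ r ∈ R, ∃ n : Fin p, r - (n : ℕ) ∈ M := by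
    intro r hr
    refine ⟨⟨(χ ⟨r, hr⟩).val, ZMod.val_lt _⟩, (hM _).mpr ⟨R.sub_mem hr (natCast_mem R _), ?_⟩⟩
    have := map_sub χ ⟨r, hr⟩ ((χ ⟨r, hr⟩).val : R)
    rw [map_natCast, ZMod.natCast_zmod_val, sub_self] at this
    exact this
  -- some power of `σ` stabilises `M`
  obtain ⟨n₁, hn₁, hσM⟩ := exists_pow_sub_mem_s4 σ R S hR hσ M hMmul
    (Set.range fun n : Fin p => ((n : ℕ) : A)) (Set.finite_range _) (by
      intro t ht k
      obtain ⟨n, hn⟩ := hMres ((σ ^ k) t) (by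
        simpa using hσ k t (hSR t ht))
      exact ⟨_, ⟨n, rfl⟩, hn⟩)
  set τ : A ≃ₐ[K] A := σ ^ n₁ with hτ
  have hτM : ∀ a ∈ M, τ a ∈ M := fun a ha => by
    simpa using M.add_mem (hσM a (hMR a ha)) ha
  have hτM' : ∀ a ∈ M, τ⁻¹ a ∈ M := by
    intro a ha
    have hb : τ⁻¹ a ∈ R := by
      have := hσ (-(n₁ : ℤ)) a (hMR a ha)
      rwa [zpow_neg, zpow_natCast] at this
    have h := hσM _ hb
    rw [← AlgEquiv.mul_apply, mul_inv_cancel, AlgEquiv.one_apply] at h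
    simpa using M.sub_mem ha h
  have hτzM : ∀ (k : ℤ), ∀ a ∈ M, (τ ^ k) a ∈ M := by
    intro k
    induction k using Int.induction_on with
    | zero => intro a ha; simpa using ha
    | succ k ih => intro a ha; rw [zpow_add_one]; exact ih _ (hτM a ha)
    | pred k ih => intro a ha; rw [zpow_sub_one]; exact ih _ (hτM' a ha)
  -- the affine blow-up algebra `B = R[M / p]`
  obtain ⟨G, hG⟩ : (RingHom.ker χ).FG := IsNoetherian.noetherian _
  choose! ν hν using hMres
  set T : Finset A := (G.image fun g : R => c * (g : A)) ∪ S.image fun s => c * (s - (ν s : ℕ)) with hT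
  set B : Subring A := Subring.closure (T : Set A) with hB
  have hBnoeth : IsNoetherianRing B := is_noetherian_subring_closure _ T.finite_toSet
  have hTM : ∀ t ∈ T, ∃ a ∈ M, t = c * a := by
    intro t ht
    rcases Finset.mem_union.mp ht with h | h
    · obtain ⟨g, hg, rfl⟩ := Finset.mem_image.mp h
      have : g ∈ RingHom.ker χ := hG ▸ Submodule.subset_span hg
      exact ⟨g, (hM _).mpr ⟨g.2, this⟩, rfl⟩
    · obtain ⟨s, hs, rfl⟩ := Finset.mem_image.mp h
      exact ⟨_, hν s (hSR s hs), rfl⟩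
  have hRB : R ≤ B := by
    rw [← hR]
    refine Subring.closure_le.mpr fun s hs => ?_
    have h1 : c * (s - (ν s : ℕ)) ∈ B :=
      Subring.subset_closure (Finset.mem_union_right _ (Finset.mem_image_of_mem _ hs))
    have h2 := B.add_mem (B.mul_mem (natCast_mem B p) h1) (natCast_mem B (ν s : ℕ))
    rwa [← mul_assoc, hpc, one_mul, sub_add_cancel] at h2
  have hMG : ∀ a ∈ M, ∃ r : R → R, a = ∑ g ∈ G, (r g : A) * g := by
    intro a ha
    obtain ⟨h, h0⟩ := (hM a).mp ha
    have h1 : (⟨a, h⟩ : R) ∈ Submodule.span R (G : Set R) :=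
      (congrArg (fun Q : Ideal R => (⟨a, h⟩ : R) ∈ Q) hG).mpr h0
    obtain ⟨r, -, hr⟩ := Submodule.mem_span_finset.mp h1
    refine ⟨r, ?_⟩
    have := congrArg R.subtype hr
    simpa using this.symm
  have hGB : ∀ g ∈ G, c * (g : A) ∈ B := fun g hg =>
    Subring.subset_closure (Finset.mem_union_left _ (Finset.mem_image_of_mem _ hg))
  have hMB : ∀ a ∈ M, c * a ∈ B := by
    intro a ha
    obtain ⟨r, rfl⟩ := hMG a ha
    rw [Finset.mul_sum]
    refine B.sum_mem fun g hg => ?_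
    rw [mul_left_comm]
    exact B.mul_mem (hRB (r g).2) (hGB g hg)
  have hτB : ∀ (k : ℤ), ∀ b ∈ B, (τ ^ k) b ∈ B := by
    intro k b hb
    have hle : B ≤ B.comap ((τ ^ k : A ≃ₐ[K] A) : A →+* A) := by
      refine Subring.closure_le.mpr fun t ht => ?_
      obtain ⟨a, ha, rfl⟩ := hTM t ht
      change (τ ^ k) (c * a) ∈ B
      have hck : (τ ^ k) c = c := (τ ^ k).commutes _
      rw [map_mul, hck]
      exact hMB _ (hτzM k a ha)
    exact hle hb
  -- some power of `τ` is the identity modulo `p` on `B`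
  set J : AddSubgroup A := B.toAddSubgroup.map (AddMonoidHom.mulLeft (p : A)) with hJ
  have hJmem : ∀ a : A, a ∈ J ↔ ∃ b ∈ B, a = p * b := by
    intro a
    constructor
    · rintro ⟨b, hb, rfl⟩; exact ⟨b, hb, rfl⟩
    · rintro ⟨b, hb, rfl⟩; exact ⟨b, hb, rfl⟩
  obtain ⟨n₂, hn₂, hτJ⟩ := exists_pow_sub_mem_s4 τ B T rfl hτB J
    (by
      intro r hr a ha
      obtain ⟨b, hb, rfl⟩ := (hJmem a).mp ha
      exact (hJmem _).mpr ⟨r * b, B.mul_mem hr hb, by ring⟩)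
    (Set.range fun m : G → Fin p => ∑ g : G, ((m g : ℕ) : A) * (c * ((g : R) : A)))
    (Set.finite_range _) (by
      intro t ht k
      obtain ⟨a, ha, rfl⟩ := hTM t ht
      obtain ⟨r, hr⟩ := hMG _ (hτzM k a ha)
      refine ⟨_, ⟨fun g => ν (r g), rfl⟩, (hJmem _).mpr
        ⟨∑ g : G, (c * ((r g : A) - (ν (r g) : ℕ))) * (c * ((g : R) : A)), ?_, ?_⟩⟩
      · exact B.sum_mem fun g _ => B.mul_mem (hMB _ (hν _ (r g).2)) (hGB g g.2)
      · rw [zpow_natCast] at hr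
        have hck : (τ ^ k) c = c := (τ ^ k).commutes _
        rw [map_mul, hck, hr, ← Finset.sum_coe_sort G, Finset.mul_sum, Finset.mul_sum,
          ← Finset.sum_sub_distrib]
        refine Finset.sum_congr rfl fun g _ => ?_
        linear_combination (-((r g : A) - (ν (r g) : ℕ)) * (c * ((g : R) : A))) * hpc)
  set ρ : A ≃ₐ[K] A := τ ^ n₂ with hρ
  have hρσ : ∀ k : ℤ, σ ^ (((n₁ * n₂ : ℕ) : ℤ) * k) = ρ ^ k := by
    intro k
    rw [zpow_mul, zpow_natCast, pow_mul]
  have hρB : ∀ (k : ℤ), ∀ b ∈ B, (ρ ^ k) b ∈ B := by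
    intro k b hb
    have := hτB (n₂ * k) b hb
    rwa [zpow_mul, zpow_natCast] at this
  -- denominators of elements of `B`
  have hden : ∀ b ∈ B, ∃ (k : ℕ) (h : (p : A) ^ k * b ∈ R) (w : ℤ_[p]),
      φ ⟨(p : A) ^ k * b, h⟩ = (p : ℤ_[p]) ^ k * w := by
    intro b hb
    induction hb using Subring.closure_induction with
    | mem t ht =>
      obtain ⟨a, ha, rfl⟩ := hTM t ht
      obtain ⟨h, h0⟩ := (hM a).mp ha
      have hpa : (p : A) ^ 1 * (c * a) = a := by rw [pow_one, ← mul_assoc, hpc, one_mul]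
      have h1 : φ ⟨a, h⟩ ∈ RingHom.ker (PadicInt.toZMod (p := p)) := h0
      rw [PadicInt.ker_toZMod, PadicInt.maximalIdeal_eq_span_p, Ideal.mem_span_singleton] at h1
      obtain ⟨w, hw⟩ := h1
      have hmem : (p : A) ^ 1 * (c * a) ∈ R := hpa.symm ▸ h
      refine ⟨1, hmem, w, ?_⟩
      rw [show (⟨_, hmem⟩ : R) = ⟨a, h⟩ from Subtype.ext hpa, pow_one]
      exact hw
    | zero =>
      have hmem : (p : A) ^ 0 * 0 ∈ R := by simp
      refine ⟨0, hmem, 0, ?_⟩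
      rw [show (⟨_, hmem⟩ : R) = 0 from Subtype.ext (by simp)]
      simp
    | one =>
      have hmem : (p : A) ^ 0 * 1 ∈ R := by simp
      refine ⟨0, hmem, 1, ?_⟩
      rw [show (⟨_, hmem⟩ : R) = 1 from Subtype.ext (by simp)]
      simp
    | add x y _ _ hx hy =>
      obtain ⟨k, h, w, hw⟩ := hx
      obtain ⟨k', h', w', hw'⟩ := hy
      have e : (p : A) ^ (k + k') * (x + y) =
          (p : A) ^ k' * ((p : A) ^ k * x) + (p : A) ^ k * ((p : A) ^ k' * y) := by ring
      have hmem : (p : A) ^ (k + k') * (x + y) ∈ R := e ▸ R.add_mem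
        (R.mul_mem (R.pow_mem (natCast_mem R p) _) h) (R.mul_mem (R.pow_mem (natCast_mem R p) _) h')
      refine ⟨k + k', hmem, w + w', ?_⟩
      have : (⟨_, hmem⟩ : R) = (p : R) ^ k' * ⟨_, h⟩ + (p : R) ^ k * ⟨_, h'⟩ :=
        Subtype.ext (by simpa using e)
      rw [this, map_add, map_mul, map_mul, hw, hw']
      simp; ring
    | neg x _ hx =>
      obtain ⟨k, h, w, hw⟩ := hx
      have e : (p : A) ^ k * -x = -((p : A) ^ k * x) := by ring
      have hmem : (p : A) ^ k * -x ∈ R := e ▸ R.neg_mem h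
      refine ⟨k, hmem, -w, ?_⟩
      have : (⟨_, hmem⟩ : R) = -⟨_, h⟩ := Subtype.ext e
      rw [this, map_neg, hw]; ring
    | mul x y _ _ hx hy =>
      obtain ⟨k, h, w, hw⟩ := hx
      obtain ⟨k', h', w', hw'⟩ := hy
      have e : (p : A) ^ (k + k') * (x * y) = ((p : A) ^ k * x) * ((p : A) ^ k' * y) := by ring
      have hmem : (p : A) ^ (k + k') * (x * y) ∈ R := e ▸ R.mul_mem h h'
      refine ⟨k + k', hmem, w * w', ?_⟩
      have : (⟨_, hmem⟩ : R) = ⟨_, h⟩ * ⟨_, h'⟩ := Subtype.ext e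
      rw [this, map_mul, hw, hw']; ring
  have hunit : ∀ b ∈ B, 1 - p * b ∉ P := by
    intro b hb hP'
    obtain ⟨k, h, w, hw⟩ := hden b hb
    have h1 : (((p : R) ^ k - p * ⟨_, h⟩ : R) : A) ∈ P := by
      have := P.mul_mem_left ((p : A) ^ k) hP'
      convert this using 1
      simp; ring
    have h2 := hφP _ h1
    rw [map_sub, map_mul, map_pow, map_natCast, hw] at h2
    have hp0 : (p : ℤ_[p]) ≠ 0 := by exact_mod_cast hp.ne_zero
    have h3 : (p : ℤ_[p]) ^ k * (1 - p * w) = 0 := by linear_combination h2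
    rcases mul_eq_zero.mp h3 with h4 | h4
    · exact pow_ne_zero k hp0 h4
    · exact PadicInt.p_nonunit (p := p) (IsUnit.of_mul_eq_one w (sub_eq_zero.mp h4).symm)
  refine ⟨n₁ * n₂, Nat.mul_pos hn₁ hn₂, fun I f hf hinf x => ?_⟩
  simp only [hρσ] at hinf ⊢
  obtain ⟨b, hb, hbI⟩ := exists_mem_one_sub_mul_mem B I p (hρB x f (hRB hf)) (by
    intro e
    obtain ⟨s, hsub, hcard⟩ := hinf.exists_subset_card_eq (2 * e)
    obtain ⟨b₀, hb₀⟩ := (insert x s).finite_toSet.bddBelow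
    have hx₀ : b₀ ≤ x := hb₀ (by simp)
    have hs₀ : ∀ k ∈ s, b₀ ≤ k := fun k hk => hb₀ (by simp [hk])
    have hshift : ∀ k : ℤ, b₀ ≤ k →
        (ρ.toLinearMap ^ (k - b₀).toNat) ((ρ ^ b₀) f) = (ρ ^ k) f := by
      intro k hk
      rw [AlgEquiv.toLinearMap_pow_apply, ← zpow_natCast, Int.toNat_of_nonneg (by omega),
        ← AlgEquiv.mul_apply, ← zpow_add, sub_add_cancel]
    obtain ⟨b, hb, h⟩ := exists_sub_pow_mul_mem ρ.toLinearMap B hp hp2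
      (fun b hb => (hJmem _).mp (hτJ b hb)) I e (hρB b₀ f (hRB hf))
      (s.image fun k => (k - b₀).toNat) (by
        rw [Finset.card_image_of_injOn, hcard]
        intro a ha b hb hab
        have := hs₀ a ha
        have := hs₀ b hb
        simp only at hab
        omega) (by
        intro k hk
        obtain ⟨i, hi, rfl⟩ := Finset.mem_image.mp hk
        rw [hshift i (hs₀ i hi)]
        exact hsub hi) (x - b₀).toNat
    rw [hshift x hx₀] at h
    exact ⟨b, hb, h⟩)
  exact ⟨_, hunit b hb, hbI⟩


/-- A set of integers which, along every residue class of a suitable fixed modulus, is either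
everything or finite. -/
def UniformSML (S : Set ℤ) : Prop :=
  ∃ N : ℕ, 0 < N ∧ ∀ c : ℤ, (∀ k : ℤ, c + N * k ∈ S) ∨ {k : ℤ | c + N * k ∈ S}.Finite

theorem forall_or_finite_of_dvd {S : Set ℤ} {N N' : ℕ} (hN' : 0 < N') (hd : N ∣ N')
    (h : ∀ c : ℤ, (∀ k : ℤ, c + N * k ∈ S) ∨ {k : ℤ | c + N * k ∈ S}.Finite) (c : ℤ) :
    (∀ k : ℤ, c + N' * k ∈ S) ∨ {k : ℤ | c + N' * k ∈ S}.Finite := by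
  obtain ⟨M, rfl⟩ := hd
  have hM : (M : ℤ) ≠ 0 := by
    rintro h0
    simp [Nat.cast_eq_zero.mp h0] at hN'
  have heq : ∀ k : ℤ, c + ((N * M : ℕ) : ℤ) * k = c + N * (M * k) := fun k => by push_cast; ring
  simp only [heq]
  rcases h c with h | h
  · exact Or.inl fun k => h _
  · exact Or.inr (h.preimage (f := fun k : ℤ => M * k)
      fun a _ b _ hab => mul_left_cancel₀ hM hab)

theorem UniformSML.twoSidedSML {S : Set ℤ} (hS : UniformSML S) : TwoSidedSML S := by
  classical
  obtain ⟨N, hN, h⟩ := hS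
  have hN' : (0 : ℤ) < N := by exact_mod_cast hN
  set P : Finset (ℤ × ℤ) := ((Finset.range N).filter fun c : ℕ => ∀ k : ℤ, (c : ℤ) + N * k ∈ S).image
    fun c : ℕ => ((N : ℤ), (c : ℤ)) with hP
  set F : Set ℤ := ⋃ c : ℕ, ⋃ _ : c ∈ Finset.range N,
    {n : ℤ | n ∈ S ∧ ¬ (∀ k : ℤ, (c : ℤ) + N * k ∈ S) ∧ ∃ k : ℤ, n = c + N * k} with hF
  refine ⟨P, F, ?_, ?_⟩
  · refine Set.Finite.biUnion (Finset.finite_toSet _) fun c _ => ?_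
    rcases h c with hc | hc
    · convert Set.finite_empty
      ext n
      simp [hc]
    · refine (hc.image fun k : ℤ => (c : ℤ) + N * k).subset ?_
      rintro n ⟨hn, -, k, rfl⟩
      exact ⟨k, hn, rfl⟩
  · ext n
    simp only [hP, hF, Set.mem_union, Set.mem_iUnion, Finset.mem_image, Finset.mem_filter,
      Finset.mem_range, exists_prop]
    constructor
    · intro hn
      obtain ⟨c, hc⟩ := Int.eq_ofNat_of_zero_le (Int.emod_nonneg n hN'.ne')
      have hcN : c < N := by
        have := Int.emod_lt_of_pos n hN'
        omega
      have hnk : n = c + N * (n / N) := by rw [← hc, Int.emod_add_mul_ediv]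
      by_cases hfull : ∀ k : ℤ, (c : ℤ) + N * k ∈ S
      · exact Or.inl ⟨_, ⟨c, ⟨hcN, hfull⟩, rfl⟩, n / N, by linarith⟩
      · exact Or.inr ⟨c, hcN, hn, hfull, n / N, hnk⟩
    · rintro (⟨_, ⟨c, ⟨-, hfull⟩, rfl⟩, k, rfl⟩ | ⟨c, -, hn, -⟩)
      · rw [add_comm]; exact hfull k
      · exact hn

theorem UniformSML.biInter {ι : Type*} (G : Finset ι) (S : ι → Set ℤ)
    (h : ∀ i ∈ G, UniformSML (S i)) : UniformSML {n | ∀ i ∈ G, n ∈ S i} := by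
  choose! N hN h using h
  have hprod : 0 < ∏ i ∈ G, N i := Finset.prod_pos hN
  refine ⟨∏ i ∈ G, N i, hprod, fun c => ?_⟩
  by_cases hall : ∀ i ∈ G, ∀ k : ℤ, c + (∏ i ∈ G, N i : ℕ) * k ∈ S i
  · exact Or.inl fun k i hi => hall i hi k
  · push Not at hall
    obtain ⟨i, hi, k, hk⟩ := hall
    rcases forall_or_finite_of_dvd hprod (Finset.dvd_prod_of_mem N hi) (h i hi) c with h' | h'
    · exact absurd (h' k) hk
    · exact Or.inr (h'.subset fun n hn => hn i hi)

theorem exists_finset_mem_closure {K A : Type*} [Field K] [CommRing A] [Algebra K A]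
    [DecidableEq A] (X : Finset A) (hX : Algebra.adjoin K (X : Set A) = ⊤) (a : A) :
    ∃ T : Finset K, a ∈ Subring.closure ((T.image (algebraMap K A) ∪ X : Finset A) : Set A) := by
  classical
  have hmono : ∀ {T T' : Finset K}, T ⊆ T' → Subring.closure
      ((T.image (algebraMap K A) ∪ X : Finset A) : Set A) ≤
      Subring.closure ((T'.image (algebraMap K A) ∪ X : Finset A) : Set A) := fun hT =>
    Subring.closure_mono (Finset.coe_subset.mpr
      (Finset.union_subset_union_left (Finset.image_subset_image hT)))
  have ha : a ∈ Algebra.adjoin K (X : Set A) := hX ▸ Algebra.mem_top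
  induction ha using Algebra.adjoin_induction with
  | mem x hx => exact ⟨∅, Subring.subset_closure (Finset.mem_union_right _ hx)⟩
  | algebraMap r => exact ⟨{r}, Subring.subset_closure (Finset.mem_union_left _
      (Finset.mem_image_of_mem _ (Finset.mem_singleton_self r)))⟩
  | add x y _ _ hx hy =>
    obtain ⟨T, hT⟩ := hx
    obtain ⟨T', hT'⟩ := hy
    exact ⟨T ∪ T', Subring.add_mem _ (hmono Finset.subset_union_left hT)
      (hmono Finset.subset_union_right hT')⟩
  | mul x y _ _ hx hy =>
    obtain ⟨T, hT⟩ := hx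
    obtain ⟨T', hT'⟩ := hy
    exact ⟨T ∪ T', Subring.mul_mem _ (hmono Finset.subset_union_left hT)
      (hmono Finset.subset_union_right hT')⟩

theorem exists_stable_subring {K A : Type*} [Field K] [CommRing A] [Algebra K A]
    [Algebra.FiniteType K A] (σ : A ≃ₐ[K] A) (f : A) :
    ∃ S : Finset A, f ∈ Subring.closure (S : Set A) ∧
      ∀ (k : ℤ), ∀ a ∈ Subring.closure (S : Set A), (σ ^ k) a ∈ Subring.closure (S : Set A) := by
  classical
  obtain ⟨X, hX⟩ := Algebra.FiniteType.out (R := K) (A := A)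
  choose T hT using exists_finset_mem_closure X hX
  set U : Finset K := T f ∪ X.biUnion fun x => T (σ x) ∪ T (σ⁻¹ x) with hU
  set S : Finset A := U.image (algebraMap K A) ∪ X with hS
  have hmem : ∀ a, T a ⊆ U → a ∈ Subring.closure (S : Set A) := fun a ha =>
    Subring.closure_mono (Finset.coe_subset.mpr
      (Finset.union_subset_union_left (Finset.image_subset_image ha))) (hT a)
  have hstep : ∀ ρ : A ≃ₐ[K] A, (∀ x ∈ X, T (ρ x) ⊆ U) →
      ∀ a ∈ Subring.closure (S : Set A), ρ a ∈ Subring.closure (S : Set A) := by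
    intro ρ hρ a ha
    have hle : Subring.closure (S : Set A) ≤
        (Subring.closure (S : Set A)).comap ((ρ : A ≃ₐ[K] A) : A →+* A) := by
      refine Subring.closure_le.mpr fun s hs => ?_
      change ρ s ∈ Subring.closure (S : Set A)
      rcases Finset.mem_union.mp hs with h | h
      · obtain ⟨c, hc, rfl⟩ := Finset.mem_image.mp h
        rw [ρ.commutes]
        exact Subring.subset_closure hs
      · exact hmem _ (hρ s h)
    exact hle ha
  have h1 := hstep σ fun x hx => (Finset.subset_union_left.trans
    (Finset.subset_biUnion_of_mem (fun x => T (σ x) ∪ T (σ⁻¹ x)) hx)).trans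
      Finset.subset_union_right
  have h2 := hstep σ⁻¹ fun x hx => (Finset.subset_union_right.trans
    (Finset.subset_biUnion_of_mem (fun x => T (σ x) ∪ T (σ⁻¹ x)) hx)).trans
      Finset.subset_union_right
  refine ⟨S, hmem f Finset.subset_union_left, fun k => ?_⟩
  induction k using Int.induction_on with
  | zero => intro a ha; simpa using ha
  | succ k ih => intro a ha; rw [zpow_add_one]; exact ih _ (h1 a ha)
  | pred k ih => intro a ha; rw [zpow_sub_one]; exact ih _ (h2 a ha)

theorem mem_of_forall_associatedPrimes {A : Type*} [CommRing A] [IsNoetherianRing A]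
    (I : Ideal A) (a : A) (h : ∀ P ∈ associatedPrimes A (A ⧸ I), ∃ u, u ∉ P ∧ u * a ∈ I) :
    a ∈ I := by
  by_contra ha
  have ha' : Ideal.Quotient.mk I a ≠ 0 := fun h0 => ha (Ideal.Quotient.eq_zero_iff_mem.mp h0)
  obtain ⟨P, hP, hle⟩ := exists_le_isAssociatedPrime_of_isNoetherianRing A _ ha'
  obtain ⟨u, hu, hua⟩ := h P hP
  refine hu (hle ?_)
  rw [Submodule.mem_colon_singleton, Submodule.mem_bot, Algebra.smul_def,
    Ideal.Quotient.algebraMap_eq, ← map_mul]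
  exact Ideal.Quotient.eq_zero_iff_mem.mpr hua

theorem uniformSML_orbit_mem_ideal {K A : Type*} [Field K] [CharZero K] [CommRing A]
    [Algebra K A] [Algebra.FiniteType K A] (σ : A ≃ₐ[K] A) (I : Ideal A) (f : A) :
    UniformSML {n : ℤ | (σ ^ n) f ∈ I} := by
  have : IsNoetherianRing A := Algebra.FiniteType.isNoetherianRing K A
  obtain ⟨S, hfS, hσ⟩ := exists_stable_subring σ f
  have hfin : (associatedPrimes A (A ⧸ I)).Finite := associatedPrimes.finite A (A ⧸ I)
  have hloc : ∀ P ∈ hfin.toFinset, ∃ N : ℕ, 0 < N ∧ ∀ (I : Ideal A),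
      ∀ f ∈ Subring.closure (S : Set A), {k : ℤ | (σ ^ (N * k : ℤ)) f ∈ I}.Infinite →
        ∀ k : ℤ, ∃ u, u ∉ P ∧ u * (σ ^ (N * k : ℤ)) f ∈ I := fun P hP =>
    exists_step_eventually_or_all σ _ S rfl hσ P (hfin.mem_toFinset.mp hP).isPrime.ne_top
  choose! N hN hloc using hloc
  refine ⟨∏ P ∈ hfin.toFinset, N P, Finset.prod_pos hN, fun c => ?_⟩
  refine or_iff_not_imp_right.mpr fun hinf k => mem_of_forall_associatedPrimes I _ fun P hP => ?_
  have hP' := hfin.mem_toFinset.mpr hP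
  obtain ⟨M, hM⟩ := Finset.dvd_prod_of_mem N hP'
  have hM0 : (M : ℤ) ≠ 0 := by
    rintro h0
    have := Finset.prod_pos hN
    simp [hM, Nat.cast_eq_zero.mp h0] at this
  have hpow : ∀ k : ℤ, (σ ^ (c + (∏ P ∈ hfin.toFinset, N P : ℕ) * k)) f =
      (σ ^ (N P * (M * k) : ℤ)) ((σ ^ c) f) := by
    intro k
    rw [← AlgEquiv.mul_apply, ← zpow_add, hM, add_comm]
    push_cast
    rw [mul_assoc]
  rw [hpow]
  refine hloc P hP' I _ (hσ c f hfS) (fun hfinite => hinf ?_) (M * k)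
  refine (hfinite.preimage (f := fun k : ℤ => M * k)
    fun a _ b _ hab => mul_left_cancel₀ hM0 hab).subset fun k hk => ?_
  change (σ ^ (N P * (M * k) : ℤ)) ((σ ^ c) f) ∈ I
  rw [← hpow]
  exact hk

/-- **Generalized Skolem–Mahler–Lech theorem for ideal inclusions.**
Let `K` be a field of characteristic zero, `A` a finitely generated commutative
`K`-algebra, and `σ : A → A` a `K`-algebra automorphism. For any ideals `I`, `J`
of `A`, the set `S(I, J) = {n ∈ ℤ : σⁿ(I) ⊇ J}` has the two-sided SML property. -/
theorem stmt4 {K A : Type*} [Field K] [CharZero K]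
    [CommRing A] [Algebra K A] [Algebra.FiniteType K A]
    (σ : A ≃ₐ[K] A) (I J : Ideal A) :
    TwoSidedSML {n : ℤ | J ≤ I.map (σ ^ n : A ≃ₐ[K] A)} := by
  have : IsNoetherianRing A := Algebra.FiniteType.isNoetherianRing K A
  obtain ⟨G, hG⟩ : J.FG := IsNoetherian.noetherian J
  have key : {n : ℤ | J ≤ I.map (σ ^ n : A ≃ₐ[K] A)} =
      {n | ∀ g ∈ G, n ∈ {n : ℤ | (σ⁻¹ ^ n) g ∈ I}} := by
    ext n
    rw [Set.mem_ofPred_eq, ← hG, Ideal.span_le]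
    refine forall₂_congr fun g _ => ?_
    change g ∈ I.map (σ ^ n : A ≃ₐ[K] A) ↔ (σ⁻¹ ^ n) g ∈ I
    rw [Ideal.mem_map_of_equiv, inv_zpow]
    constructor
    · rintro ⟨x, hx, rfl⟩
      rwa [← AlgEquiv.mul_apply, inv_mul_cancel, AlgEquiv.one_apply]
    · intro h
      exact ⟨_, h, by rw [← AlgEquiv.mul_apply, mul_inv_cancel, AlgEquiv.one_apply]⟩
  rw [key]
  exact (UniformSML.biInter G _ fun g _ => uniformSML_orbit_mem_ideal σ⁻¹ I g).twoSidedSML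
end

section
/- Let K be a finitely generated field extension of ℚ and let 𝒮 be a finite subset of K. Then there exist infinitely many primes p for which there is a field embedding of K into ℚ_p that sends every nonzero element of 𝒮 to a unit of ℤ_p. -/
/-- `p` is a "good prime" for the finite set `𝒮 ⊆ K`: `p` is prime and there is
a field embedding `K → ℚ_p` sending every nonzero element of `𝒮` to a unit of
`ℤ_p` (i.e. an element of `p`-adic absolute value `1`). -/
def GoodPrime (K : Type*) [Field K] (𝒮 : Finset K) (p : ℕ) : Prop :=
  ∃ hp : p.Prime,
    haveI : Fact p.Prime := ⟨hp⟩
    ∃ f : K →+* ℚ_[p], ∀ x ∈ 𝒮, x ≠ 0 → ‖f x‖ = 1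

open Polynomial

/-- A nonconstant integer polynomial has values divisible by arbitrarily large primes. -/
theorem Polynomial.exists_prime_gt_dvd_eval (g : ℤ[X]) (hg : 0 < g.natDegree) (N : ℕ) :
    ∃ p : ℕ, p.Prime ∧ N < p ∧ ∃ m : ℤ, (p : ℤ) ∣ g.eval m := by
  by_cases h0 : g.eval 0 = 0
  · obtain ⟨p, hp, hpp⟩ := Nat.exists_infinite_primes (N + 1)
    exact ⟨p, hpp, hp, 0, by simp [h0]⟩
  set c := g.eval 0 with hc
  have hM : c * (N.factorial : ℤ) ≠ 0 := mul_ne_zero h0 (by exact_mod_cast N.factorial_ne_zero)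
  have hfin : {k : ℤ | g.eval (c * N.factorial * k) = c ∨ g.eval (c * N.factorial * k) = -c}.Finite := by
    have key : ∀ d : ℤ, {k : ℤ | g.eval (c * N.factorial * k) = d}.Finite := fun d ↦ by
      have hne : g - C d ≠ 0 := fun h ↦ by
        rw [sub_eq_zero] at h
        simp [h] at hg
      refine ((g - C d).roots.toFinset.finite_toSet.preimage
        (f := fun k : ℤ ↦ c * N.factorial * k)
        (mul_right_injective₀ hM).injOn).subset fun k hk ↦ ?_
      simpa only [Set.mem_ofPred_eq, Set.mem_preimage, Finset.mem_coe, Multiset.mem_toFinset, mem_roots hne,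
        IsRoot.def, eval_sub, eval_C, sub_eq_zero] using! hk
    exact (key c).union (key (-c))
  obtain ⟨k, hk⟩ := hfin.exists_notMem
  obtain ⟨w, hw⟩ : c * N.factorial * k - 0 ∣ g.eval (c * N.factorial * k) - g.eval 0 :=
    sub_dvd_eval_sub _ _ g
  have hv : g.eval (c * N.factorial * k) = c * (1 + N.factorial * (k * w)) := by
    linear_combination hw
  have hu : (1 + N.factorial * (k * w) : ℤ).natAbs ≠ 1 := fun h ↦ by
    rcases Int.natAbs_eq_iff.1 h with h | h <;> exact hk (by simp [hv, h])
  obtain ⟨p, hp, hpd⟩ := Nat.exists_prime_and_dvd hu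
  have hpd' : (p : ℤ) ∣ 1 + N.factorial * (k * w) := Int.natCast_dvd.2 hpd
  refine ⟨p, hp, ?_, _, hv ▸ hpd'.mul_left c⟩
  by_contra! hle
  have h1 : (p : ℤ) ∣ N.factorial := by exact_mod_cast (hp.dvd_factorial).2 hle
  have h2 : (p : ℤ) ∣ 1 := (dvd_add_left (h1.mul_right _)).1 hpd'
  exact hp.one_lt.ne' (by exact_mod_cast Int.natCast_dvd_natCast.1 (by simpa using h2) |> Nat.dvd_one.1)


theorem PadicInt.toZMod_eq_zero_iff {p : ℕ} [Fact p.Prime] {z : ℤ_[p]} :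
    PadicInt.toZMod z = 0 ↔ ‖z‖ < 1 := by
  rw [← RingHom.mem_ker, PadicInt.ker_toZMod, IsLocalRing.mem_maximalIdeal, PadicInt.mem_nonunits]

/-- A finite family of residues mod `p` lifts to a family of `p`-adic integers algebraically
independent over `ℤ`. -/
theorem PadicInt.exists_algebraicIndependent_toZMod_eq (p : ℕ) [Fact p.Prime] {ι : Type*}
    [Finite ι] (a : ι → ZMod p) :
    ∃ x : ι → ℤ_[p], AlgebraicIndependent ℤ x ∧ ∀ i, PadicInt.toZMod (x i) = a i := by
  revert a
  induction ι using Finite.induction_empty_option with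
  | of_equiv e ih =>
    intro a
    obtain ⟨x, hx, hxa⟩ := ih (a ∘ e)
    exact ⟨x ∘ e.symm, (algebraicIndependent_equiv e.symm).2 hx, fun i ↦ by simp [hxa]⟩
  | h_empty =>
    refine fun a ↦ ⟨isEmptyElim, ?_, fun i ↦ i.elim⟩
    exact algebraicIndependent_empty_type_iff.2 Int.cast_injective
  | @h_option ι _ ih =>
    intro a
    obtain ⟨x, hx, hxa⟩ := ih (a ∘ some)
    have : Countable (MvPolynomial ι ℤ) :=
      Cardinal.mk_le_aleph0_iff.1 (MvPolynomial.cardinalMk_le_max_lift.trans (by simp))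
    have : Countable (Algebra.adjoin ℤ (Set.range x)) := hx.aevalEquiv.symm.injective.countable
    have hc := (Algebraic.countable (Algebra.adjoin ℤ (Set.range x)) ℤ_[p]).image
      ((↑) : ℤ_[p] → ℚ_[p])
    obtain ⟨b, hb⟩ := ZMod.ringHom_surjective (PadicInt.toZMod (p := p)) (a none)
    obtain ⟨y, hyc, hy⟩ := (hc.dense_compl ℚ_[p]).exists_dist_lt (b : ℚ_[p]) one_pos
    rw [dist_eq_norm, norm_sub_rev] at hy
    have hy1 : ‖y‖ ≤ 1 := by
      simpa using (Padic.nonarchimedean (y - (b : ℚ_[p])) (b : ℚ_[p])).trans (max_le hy.le b.2)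
    obtain ⟨y, rfl⟩ : ∃ z : ℤ_[p], (z : ℚ_[p]) = y := ⟨⟨y, hy1⟩, rfl⟩
    refine ⟨fun o ↦ o.elim y x, (hx.option_iff_transcendental _).2 fun h ↦ hyc ⟨y, h, rfl⟩, ?_⟩
    rintro (_ | i)
    · change PadicInt.toZMod y = _
      rw [← hb, ← sub_eq_zero, ← map_sub, PadicInt.toZMod_eq_zero_iff]
      exact hy
    · exact hxa i

section PrimitiveElement

open IntermediateField

variable {R F K : Type*} [CommRing R] [IsDomain R] [Field F] [Field K] [Algebra R F]
  [IsFractionRing R F] [Algebra F K] [Algebra R K] [IsScalarTower R F K]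

/-- A finite separable extension of `Frac R` has a primitive element integral over `R`. -/
theorem exists_isIntegral_adjoin_simple_eq_top (R F K : Type*) [CommRing R] [IsDomain R] [Field F]
    [Field K] [Algebra R F] [IsFractionRing R F] [Algebra F K] [Algebra R K] [IsScalarTower R F K]
    [FiniteDimensional F K] [Algebra.IsSeparable F K] :
    ∃ α : K, IsIntegral R α ∧ F⟮α⟯ = ⊤ := by
  obtain ⟨β, hβ⟩ := Field.exists_primitive_element F K
  have hβR : IsAlgebraic R β :=
    (IsFractionRing.isAlgebraic_iff R F K).2 (Algebra.IsAlgebraic.isAlgebraic β)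
  obtain ⟨y, hy, hint⟩ := hβR.exists_integral_multiple
  refine ⟨y • β, hint, ?_⟩
  rw [eq_top_iff, ← hβ, adjoin_simple_le_iff]
  have hy' : algebraMap R F y ≠ 0 := by simpa using hy
  have : β = (algebraMap R F y)⁻¹ • (y • β) := by
    rw [← IsScalarTower.algebraMap_smul F y β, inv_smul_smul₀ hy']
  have hmem := F⟮y • β⟯.smul_mem (x := (algebraMap R F y)⁻¹) (mem_adjoin_simple_self F (y • β))
  rwa [← this] at hmem

theorem exists_mul_eq_aeval_of_adjoin_simple_eq_top [Algebra.IsAlgebraic F K] {α : K}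
    (hα : F⟮α⟯ = ⊤) (x : K) :
    ∃ d : R, d ≠ 0 ∧ ∃ P : R[X], algebraMap R K d * x = aeval α P := by
  have hx : x ∈ Algebra.adjoin F {α} := by
    rw [(adjoin_simple_eq_top_iff_of_isAlgebraic (Algebra.IsAlgebraic.isAlgebraic α)).1 hα]
    trivial
  rw [Algebra.adjoin_singleton_eq_range_aeval] at hx
  obtain ⟨q, rfl⟩ := hx
  obtain ⟨d, hd, hq⟩ := IsLocalization.integerNormalization_spec (S := F) (nonZeroDivisors R) q
  refine ⟨d, nonZeroDivisors.ne_zero hd, IsLocalization.integerNormalization (nonZeroDivisors R) q, ?_⟩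
  rw [← aeval_map_algebraMap F, hq, ← IsScalarTower.algebraMap_smul F d q, map_smul,
    Algebra.smul_def, ← IsScalarTower.algebraMap_apply]
  rfl

theorem exists_ringHom_of_adjoin_simple_eq_top [IsIntegrallyClosed R] {L : Type*} [Field L]
    {α : K} (hint : IsIntegral R α) (hα : F⟮α⟯ = ⊤) {φ : R →+* L} (hφ : Function.Injective φ)
    {η : L} (hη : (minpoly R α).eval₂ φ η = 0) :
    ∃ ψ : K →+* L, (∀ r, ψ (algebraMap R K r) = φ r) ∧ ψ α = η := by
  let : Algebra F L := (IsFractionRing.lift hφ).toAlgebra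
  have hφF (r : R) : algebraMap F L (algebraMap R F r) = φ r := IsFractionRing.lift_algebraMap hφ r
  have hintF : IsIntegral F α := hint.tower_top
  have hroot : η ∈ (minpoly F α).aroots L := by
    rw [mem_aroots]
    refine ⟨minpoly.ne_zero hintF, ?_⟩
    rw [minpoly.isIntegrallyClosed_eq_field_fractions' F hint, aeval_def, eval₂_map]
    rwa [show (algebraMap F L).comp (algebraMap R F) = φ from RingHom.ext hφF]
  let ψ : F⟮α⟯ →ₐ[F] L := (algHomAdjoinIntegralEquiv F hintF).symm ⟨η, hroot⟩
  let e : K →ₐ[F] F⟮α⟯ := (((equivOfEq hα).trans topEquiv).symm : K ≃ₐ[F] F⟮α⟯)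
  refine ⟨ψ.comp e, fun r ↦ ?_, ?_⟩
  · rw [IsScalarTower.algebraMap_apply R F K, ← hφF]
    exact (ψ.comp e).commutes _
  · exact algHomAdjoinIntegralEquiv_symm_apply_gen F hintF ⟨η, hroot⟩

/-- The minimal polynomial over `R` of an integral separable element and its derivative generate an
ideal containing a nonzero constant. -/
theorem exists_mul_add_mul_derivative_minpoly_eq_C [IsIntegrallyClosed R] [Module.IsTorsionFree R K]
    [Algebra.IsAlgebraic F K] [Algebra.IsSeparable F K] {α : K} (hint : IsIntegral R α)
    (hα : F⟮α⟯ = ⊤) :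
    ∃ d : R, d ≠ 0 ∧ ∃ u v : R[X],
      u * minpoly R α + v * derivative (minpoly R α) = C d := by
  have hne : aeval α (derivative (minpoly R α)) ≠ 0 := by
    have h := (Algebra.IsSeparable.isSeparable F α).aeval_derivative_ne_zero (minpoly.aeval F α)
    rwa [minpoly.isIntegrallyClosed_eq_field_fractions' F hint, derivative_map,
      aeval_map_algebraMap] at h
  obtain ⟨d, hd, v, hv⟩ := exists_mul_eq_aeval_of_adjoin_simple_eq_top (R := R) hα
    (aeval α (derivative (minpoly R α)))⁻¹
  obtain ⟨u, hu⟩ := minpoly.isIntegrallyClosed_dvd hint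
    (p := C d - v * derivative (minpoly R α)) (by
      rw [map_sub, map_mul, aeval_C, ← hv, inv_mul_cancel_right₀ hne, sub_self])
  exact ⟨d, hd, u, v, by linear_combination -hu⟩

end PrimitiveElement

/-- Hensel's lemma for a simple root mod `p`. -/
theorem PadicInt.exists_root_of_toZMod {p : ℕ} [Fact p.Prime] {F : ℤ_[p][X]} {a : ℤ_[p]}
    (h : PadicInt.toZMod (F.eval a) = 0) (h' : PadicInt.toZMod (F.derivative.eval a) ≠ 0) :
    ∃ z, F.eval z = 0 := by
  rw [PadicInt.toZMod_eq_zero_iff] at h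
  rw [Ne, PadicInt.toZMod_eq_zero_iff, not_lt] at h'
  obtain ⟨z, hz, -⟩ := hensels_lemma (F := F) (a := a) (by
    simpa [coe_aeval_eq_eval, (PadicInt.norm_le_one _).antisymm h'] using h)
  exact ⟨z, by simpa [coe_aeval_eq_eval] using hz⟩

/-- If the points `R →+* ℤ` are dense and their reductions mod `p` lift to embeddings `R →+* ℤ_[p]`,
then every finite separable extension of `Frac R` has infinitely many good primes. -/
theorem infinite_goodPrime_of_specialization {R F K : Type*} [CommRing R] [IsDomain R]
    [IsIntegrallyClosed R] [Field F] [Field K] [Algebra R F] [IsFractionRing R F] [Algebra F K]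
    [Algebra R K] [IsScalarTower R F K] [Module.IsTorsionFree R K] [FiniteDimensional F K]
    [Algebra.IsSeparable F K]
    (hR : ∀ d : R, d ≠ 0 → ∃ a : R →+* ℤ, a d ≠ 0)
    (hlift : ∀ (p : ℕ) [Fact p.Prime] (a : R →+* ℤ), ∃ τ : R →+* ℤ_[p],
      Function.Injective τ ∧ PadicInt.toZMod.comp τ = (Int.castRingHom (ZMod p)).comp a)
    (S : Finset K) : {p : ℕ | GoodPrime K S p}.Infinite := by
  obtain ⟨α, hint, hα⟩ := exists_isIntegral_adjoin_simple_eq_top R F K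
  choose d hd P hP using exists_mul_eq_aeval_of_adjoin_simple_eq_top (R := R) hα
  obtain ⟨d₀, hd₀, u, v, huv⟩ := exists_mul_add_mul_derivative_minpoly_eq_C hint hα
  set f := minpoly R α with hf
  have hmonic : f.Monic := minpoly.monic hint
  obtain ⟨a, ha⟩ := hR (d₀ * ∏ x ∈ S, d x * d x⁻¹)
    (mul_ne_zero hd₀ (Finset.prod_ne_zero_iff.2 fun x _ ↦ mul_ne_zero (hd _) (hd _)))
  set D := d₀ * ∏ x ∈ S, d x * d x⁻¹ with hD
  refine Set.infinite_of_forall_exists_gt fun n ↦ ?_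
  obtain ⟨p, hp, hpn, m, hm⟩ := (f.map a).exists_prime_gt_dvd_eval
    (by rw [hmonic.natDegree_map]; exact minpoly.natDegree_pos hint) (max n (a D).natAbs)
  have : Fact p.Prime := ⟨hp⟩
  obtain ⟨τ, hτ, hτa⟩ := hlift p a
  have hτa' (r : R) : PadicInt.toZMod (τ r) = (a r : ZMod p) := RingHom.congr_fun hτa r
  have hDp : ∀ e, e ∣ D → PadicInt.toZMod (τ e) ≠ 0 := fun e he h0 ↦ by
    have h : ((a D : ℤ) : ZMod p) = 0 := by
      rw [← hτa', ← zero_dvd_iff, ← h0]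
      exact map_dvd _ (map_dvd _ he)
    rw [ZMod.intCast_zmod_eq_zero_iff_dvd, Int.natCast_dvd] at h
    exact (Nat.le_of_dvd (Int.natAbs_pos.2 ha) h).not_gt ((le_max_right _ _).trans_lt hpn)
  have hfm : PadicInt.toZMod ((f.map τ).eval (m : ℤ_[p])) = 0 := by
    rw [← (ZMod.intCast_zmod_eq_zero_iff_dvd _ p).2 hm, eval_map, eval_map, hom_eval₂, hτa,
      map_intCast, ← eq_intCast (Int.castRingHom (ZMod p)) (eval₂ _ _ _), hom_eval₂,
      eq_intCast]
  have hfm' : PadicInt.toZMod ((f.map τ).derivative.eval (m : ℤ_[p])) ≠ 0 := fun h0 ↦ by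
    have h := congr(PadicInt.toZMod (($huv).map τ |>.eval (m : ℤ_[p])))
    simp only [Polynomial.map_add, Polynomial.map_mul, ← derivative_map, eval_add, eval_mul,
      map_add, map_mul, hfm, h0, map_C, eval_C, mul_zero, add_zero] at h
    exact hDp d₀ (dvd_mul_right _ _) h.symm
  obtain ⟨η, hη⟩ := PadicInt.exists_root_of_toZMod hfm hfm'
  let φ : R →+* ℚ_[p] := PadicInt.Coe.ringHom.comp τ
  have hη' : f.eval₂ φ (η : ℚ_[p]) = 0 := by
    rw [eval_map] at hη
    have := congr(PadicInt.Coe.ringHom $hη)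
    rwa [hom_eval₂, map_zero] at this
  obtain ⟨ψ, hψR, hψα⟩ := exists_ringHom_of_adjoin_simple_eq_top hint hα
    (φ := φ) (Subtype.coe_injective.comp hτ) hη'
  have hle (x : K) (hx : d x ∣ D) : ‖ψ x‖ ≤ 1 := by
    have h := congr(‖ψ $(hP x)‖)
    have hunit : ‖τ (d x)‖ = 1 := (PadicInt.norm_le_one _).antisymm
      (not_lt.1 (PadicInt.toZMod_eq_zero_iff.not.1 (hDp _ hx)))
    have hval : ψ (aeval α (P x)) = ((P x).eval₂ τ η : ℤ_[p]) := by
      rw [aeval_def, hom_eval₂, hψα, show ψ.comp (algebraMap R K) = φ from RingHom.ext hψR]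
      exact (hom_eval₂ _ τ PadicInt.Coe.ringHom η).symm
    rw [map_mul, hψR, norm_mul, hval, show φ (d x) = (τ (d x) : ℚ_[p]) from rfl,
      PadicInt.padic_norm_e_of_padicInt, hunit, one_mul] at h
    exact h.trans_le (PadicInt.norm_le_one _)
  refine ⟨p, ⟨hp, ψ, fun x hx hx0 ↦ ?_⟩, (le_max_left _ _).trans_lt hpn⟩
  have hdvd : d x * d x⁻¹ ∣ D := (Finset.dvd_prod_of_mem (fun x ↦ d x * d x⁻¹) hx).trans (dvd_mul_left _ _)
  refine (hle x ((dvd_mul_right _ _).trans hdvd)).antisymm ?_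
  have h := hle x⁻¹ ((dvd_mul_left _ _).trans hdvd)
  rw [map_inv₀, norm_inv] at h
  exact (inv_le_one₀ (by simpa using hx0)).1 h

/-- **Lech's embedding lemma (Lemma 2.3).** Let `K` be a finitely generated
field extension of `ℚ` and let `𝒮` be a finite subset of `K`. Then there are
infinitely many primes `p` for which `K` embeds in `ℚ_p` with every nonzero
element of `𝒮` sent to a unit of `ℤ_p`. -/
theorem stmt6 {K : Type*} [Field K] [Algebra ℚ K]
    (hfg : ∃ s : Finset K, IntermediateField.adjoin ℚ (s : Set K) = ⊤)
    (𝒮 : Finset K) :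
    {p : ℕ | GoodPrime K 𝒮 p}.Infinite := by
  have : Algebra.EssFiniteType ℚ K := IntermediateField.fg_top_iff.1 hfg
  have : CharZero K := algebraRat.charZero K
  have : Algebra.EssFiniteType ℤ ℚ := .of_isLocalization ℚ (nonZeroDivisors ℤ)
  have : Algebra.EssFiniteType ℤ K := .comp ℤ ℚ K
  have : Algebra.IsAlgebraic ℤ ℚ := IsLocalization.isAlgebraic ℚ (nonZeroDivisors ℤ)
  obtain ⟨t, ht, -⟩ :=
    IntermediateField.exists_finset_maximalFor_isTranscendenceBasis_separableClosure ℚ K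
  have htℤ := (Algebra.IsAlgebraic.isTranscendenceBasis_iff ℤ ℚ).2 ht
  let R := Algebra.adjoin ℤ (Set.range ((↑) : t → K))
  let e : MvPolynomial t ℤ ≃ₐ[ℤ] R := htℤ.1.aevalEquiv
  have : IsIntegrallyClosed R := .of_equiv e.toRingEquiv
  have : Algebra.IsAlgebraic R K := htℤ.isAlgebraic
  let : Algebra (FractionRing R) K := FractionRing.liftAlgebra R K
  have : Algebra.IsAlgebraic (FractionRing R) K :=
    (IsFractionRing.comap_isAlgebraic_iff (A := R)).1 inferInstance
  have : Algebra.EssFiniteType (FractionRing R) K := .of_comp ℤ _ K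
  have : FiniteDimensional (FractionRing R) K := Algebra.finite_of_essFiniteType_of_isAlgebraic
  have : CharZero (FractionRing R) := (algebraMap (FractionRing R) K).charZero
  refine infinite_goodPrime_of_specialization (R := R) (F := FractionRing R)
    (fun d hd ↦ ?_) (fun p _ a ↦ ?_) 𝒮
  · have hd' : e.symm d ≠ 0 := by simpa using hd
    obtain ⟨a, ha⟩ := not_forall.1 (mt (MvPolynomial.funext (q := 0)) hd')
    exact ⟨(MvPolynomial.eval a).comp (e.symm : R →+* MvPolynomial t ℤ), by simpa using ha⟩
  · obtain ⟨x, hx, hxa⟩ := PadicInt.exists_algebraicIndependent_toZMod_eq p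
      fun i ↦ ((a (e (MvPolynomial.X i)) : ℤ) : ZMod p)
    refine ⟨(MvPolynomial.aeval x : _ →ₐ[ℤ] ℤ_[p]).toRingHom.comp
      (e.symm : R →+* MvPolynomial t ℤ), Function.Injective.comp (g := MvPolynomial.aeval x) hx e.symm.injective, ?_⟩
    rw [← RingHom.cancel_right (f := (e : MvPolynomial t ℤ →+* R)) e.surjective]
    ext i <;> simp [hxa]
end

section
/- Let p ≥ 5 be a prime and let σ = (H₁, …, H_d) be a ℤ_p-algebra automorphism of ℤ_p[x₁, …, x_d]. Let S be a ℤ_p-algebra that is finitely generated and torsion-free as a ℤ_p-module, and let f_σ : S^d → S^d be the induced dynamical evaluation map. Suppose s₀ = (s₁, …, s_d) ∈ S^d satisfies: (i) H_i(s₁, …, s_d) ≡ s_i (mod pS) for all 1 ≤ i ≤ d, and (ii) the Jacobian matrix M = J(σ; x) evaluated at x = s₀ is congruent to the identity matrix modulo pS. Then there exist power series f₁(z), …, f_d(z) ∈ (S ⊗_{ℤ_p} ℚ_p)[[z]] which converge for all z ∈ ℤ_p and satisfy (1) f_i(z+1) = H_i(f₁(z), …, f_d(z)) for 1 ≤ i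 ≤ d, and (2) f_i(0) = s_i for 1 ≤ i ≤ d. -/
open MvPolynomial TensorProduct

section DifferenceFiltration

variable {A : Type*} [CommRing A] (T : A →+* A) {L Q : Ideal A}

theorem map_mul_sub_mul (x y : A) :
    T (x * y) - x * y = (T x - x) * T y + x * (T y - y) := by
  rw [map_mul]; ring

theorem map_mem_of_map_sub_mem {I J : Ideal A} (hJ : J ≤ I) {x : A} (hx : x ∈ I)
    (h : T x - x ∈ J) : T x ∈ I := by
  simpa using add_mem (hJ h) hx

/-- If `T - 1` maps `I` into `I'` and `J` into `J'`, and `T` preserves `J`, then `T - 1` maps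
`I * J` into any ideal containing `I' * J` and `I * J'`. -/
theorem map_sub_self_mem_of_mem_mul {I I' J J' N : Ideal A}
    (hI : ∀ x ∈ I, T x - x ∈ I') (hJ : ∀ x ∈ J, T x - x ∈ J') (hJJ : J' ≤ J)
    (h1 : I' * J ≤ N) (h2 : I * J' ≤ N) :
    ∀ x ∈ I * J, T x - x ∈ N := by
  intro x hx
  induction hx using Submodule.mul_induction_on' with
  | mem_mul_mem m hm n hn =>
    rw [map_mul_sub_mul]
    exact add_mem (h1 (Ideal.mul_mem_mul (hI m hm)
      (map_mem_of_map_sub_mem T hJJ hn (hJ n hn)))) (h2 (Ideal.mul_mem_mul hm (hJ n hn)))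
  | add x _ y _ ihx ihy =>
    rw [map_add, add_sub_add_comm]
    exact add_mem ihx ihy

theorem map_sub_self_mem_mul_pow (hLQ : L ≤ Q) (hQL : Q * Q ≤ L) (hA : ∀ x, T x - x ∈ L)
    (hL : ∀ x ∈ L, T x - x ∈ Q * L) (n : ℕ) :
    (∀ x ∈ L ^ n, T x - x ∈ Q * L ^ n) ∧ ∀ x ∈ Q * L ^ n, T x - x ∈ L ^ (n + 1) := by
  have key (n : ℕ) (h : ∀ x ∈ L ^ n, T x - x ∈ Q * L ^ n) :
      ∀ x ∈ Q * L ^ n, T x - x ∈ L ^ (n + 1) := by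
    refine map_sub_self_mem_of_mem_mul T (fun x _ => hA x) h Ideal.mul_le_right
      (pow_succ' L n).ge ?_
    rw [← mul_assoc, pow_succ']
    exact Ideal.mul_mono_left hQL
  refine ⟨?_, key n ?_⟩ <;>
  · induction n with
    | zero => intro x _; simpa using hLQ (hA x)
    | succ n ih =>
      rw [pow_succ']
      refine map_sub_self_mem_of_mem_mul T hL ih Ideal.mul_le_right (mul_assoc _ _ _).le ?_
      rw [mul_left_comm]

theorem iterate_map_sub_self_mem_pow (hLQ : L ≤ Q) (hQL : Q * Q ≤ L) (hA : ∀ x, T x - x ∈ L)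
    (hL : ∀ x ∈ L, T x - x ∈ Q * L) (x : A) (k : ℕ) :
    (fun y => T y - y)^[k] x ∈ L ^ (k / 2) := by
  have h := map_sub_self_mem_mul_pow T hLQ hQL hA hL
  have even (n : ℕ) : (fun y => T y - y)^[2 * n] x ∈ L ^ n := by
    induction n with
    | zero => simp
    | succ n ih =>
      rw [show 2 * (n + 1) = 2 * n + 1 + 1 by ring, Function.iterate_succ_apply',
        Function.iterate_succ_apply']
      exact (h n).2 _ ((h n).1 _ ih)
  obtain ⟨n, rfl | rfl⟩ := Nat.even_or_odd' k
  · simpa using even n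
  · rw [Function.iterate_succ_apply', show (2 * n + 1) / 2 = n by omega]
    exact Ideal.mul_le_right ((h n).1 _ (even n))

theorem iterate_map_eq_sum_choose (x : A) (n : ℕ) :
    T^[n] x = ∑ k ∈ Finset.range (n + 1), n.choose k • (fun y => T y - y)^[k] x := by
  have h (k : ℕ) (x : A) : (fwdDiff 1)^[k] (fun n : ℕ => T^[n] x) =
      fun n => T^[n] ((fun y => T y - y)^[k] x) := by
    induction k generalizing x with
    | zero => rfl
    | succ k ih =>
      rw [Function.iterate_succ_apply, Function.iterate_succ_apply, ← ih]
      congr 1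
      funext n
      rw [fwdDiff, Function.iterate_succ_apply, iterate_map_sub]
  have := shift_eq_sum_fwdDiff_iter (1 : ℕ) (fun n : ℕ => T^[n] x) n 0
  simpa [h] using this

end DifferenceFiltration

namespace MvPolynomial

variable {ι S : Type*} [CommRing S]

/-- The ideal of the point `s` of affine space. -/
noncomputable def pointIdeal (s : ι → S) : Ideal (MvPolynomial ι S) :=
  Ideal.span (Set.range fun i => X i - C (s i))

theorem X_sub_C_mem_pointIdeal (s : ι → S) (i : ι) : X i - C (s i) ∈ pointIdeal s :=
  Ideal.subset_span ⟨i, rfl⟩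

theorem pointIdeal_le_ker_eval (s : ι → S) : pointIdeal s ≤ RingHom.ker (eval s) := by
  rw [pointIdeal, Ideal.span_le]
  rintro _ ⟨i, rfl⟩
  simp

/-- First order Taylor expansion of a polynomial at a point. -/
theorem sub_taylor_mem_pointIdeal_sq [Fintype ι] (s : ι → S) (g : MvPolynomial ι S) :
    g - C (eval s g) - ∑ j, C (eval s (pderiv j g)) * (X j - C (s j)) ∈ pointIdeal s ^ 2 := by
  classical
  induction g using MvPolynomial.induction_on with
  | C a => simp
  | add f g hf hg =>
    convert add_mem hf hg using 1
    simp only [map_add, add_mul, Finset.sum_add_distrib]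
    ring
  | mul_X g i hg =>
    have hK : ∑ j, C (eval s (pderiv j g)) * (X j - C (s j)) ∈ pointIdeal s :=
      sum_mem fun j _ => Ideal.mul_mem_left _ _ (X_sub_C_mem_pointIdeal s j)
    convert add_mem (Ideal.mul_mem_right (X i) _ hg) (pow_two (pointIdeal s) ▸
      Ideal.mul_mem_mul hK (X_sub_C_mem_pointIdeal s i)) using 1
    have h (j : ι) : C (eval s (pderiv j (g * X i))) * (X j - C (s j)) =
        C (eval s (pderiv j g)) * (X j - C (s j)) * C (s i) +
          if i = j then C (eval s g) * (X i - C (s i)) else 0 := by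
      by_cases hij : i = j
      · subst hij
        simp [Derivation.leibniz]
        ring
      · simp [Derivation.leibniz, hij, pderiv_X]
        ring
    rw [Finset.sum_congr rfl fun j _ => h j, Finset.sum_add_distrib, ← Finset.sum_mul]
    simp
    ring

variable (s : ι → S) (H : ι → MvPolynomial ι S) (q : S)

theorem bind₁_sub_self_mem {L : Ideal (MvPolynomial ι S)} (h : ∀ i, H i - X i ∈ L)
    (g : MvPolynomial ι S) : bind₁ H g - g ∈ L := by
  induction g using MvPolynomial.induction_on with
  | C a => simp
  | add f g hf hg =>
    rw [map_add, add_sub_add_comm]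
    exact add_mem hf hg
  | mul_X g i hg =>
    have := map_mul_sub_mul (bind₁ H).toRingHom g (X i)
    simp only [AlgHom.toRingHom_eq_coe, RingHom.coe_coe, bind₁_X_right] at this
    rw [this]
    exact add_mem (Ideal.mul_mem_right _ _ hg) (Ideal.mul_mem_left _ _ (h i))

theorem sub_X_mem_of_eval_of_pderiv [Fintype ι] [DecidableEq ι]
    (h1 : ∀ i, eval s (H i) - s i ∈ Ideal.span {q})
    (h2 : ∀ i j, eval s (pderiv j (H i)) - (if i = j then 1 else 0) ∈ Ideal.span {q}) (i : ι) :
    H i - X i ∈ Ideal.span {C q} ⊔ pointIdeal s ^ 2 := by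
  have hC {a : S} (ha : a ∈ Ideal.span {q}) :
      (C a : MvPolynomial ι S) ∈ Ideal.span {C q} ⊔ pointIdeal s ^ 2 := by
    rw [Ideal.mem_span_singleton] at ha
    exact Ideal.mem_sup_left (Ideal.mem_span_singleton.2 (map_dvd C ha))
  have hT := Ideal.mem_sup_right (S := Ideal.span {C q}) (sub_taylor_mem_pointIdeal_sq s (H i))
  have hS := sum_mem (t := Finset.univ) fun j _ =>
    Ideal.mul_mem_right (X j - C (s j)) _ (hC (h2 i j))
  convert add_mem (add_mem hT hS) (hC (h1 i)) using 1
  simp only [map_sub, sub_mul, Finset.sum_sub_distrib]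
  simp
  ring

theorem eval_iterate_bind₁_sub_self_dvd [Fintype ι] [DecidableEq ι]
    (h1 : ∀ i, eval s (H i) - s i ∈ Ideal.span {q})
    (h2 : ∀ i j, eval s (pderiv j (H i)) - (if i = j then 1 else 0) ∈ Ideal.span {q})
    (g : MvPolynomial ι S) (k : ℕ) :
    q ^ (k / 2) ∣ eval s ((fun y => bind₁ H y - y)^[k] g) := by
  set P : Ideal (MvPolynomial ι S) := Ideal.span {C q}
  set K := pointIdeal s
  set L := P ⊔ K ^ 2 with hLdef
  have hA := bind₁_sub_self_mem H (sub_X_mem_of_eval_of_pderiv s H q h1 h2)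
  have hLQ : L ≤ P ⊔ K := sup_le_sup_left (Ideal.pow_le_self two_ne_zero) P
  have hPL : P ≤ L := le_sup_left
  have hQL : (P ⊔ K) * (P ⊔ K) ≤ L := by
    rw [Ideal.mul_sup, Ideal.sup_mul, Ideal.sup_mul]
    exact sup_le (sup_le (Ideal.mul_le_left.trans hPL) (Ideal.mul_le_right.trans hPL))
      (sup_le (Ideal.mul_le_left.trans hPL) ((pow_two K).ge.trans le_sup_right))
  have hL : ∀ x ∈ L, (bind₁ H).toRingHom x - x ∈ (P ⊔ K) * L := by
    intro x hx
    obtain ⟨y, hy, z, hz, rfl⟩ := Submodule.mem_sup.1 hx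
    rw [map_add, add_sub_add_comm]
    refine add_mem ?_ ?_
    · obtain ⟨w, rfl⟩ := Ideal.mem_span_singleton.1 hy
      have : (bind₁ H).toRingHom (C q * w) - C q * w = C q * (bind₁ H w - w) := by
        simp [mul_sub]
      rw [this]
      exact Ideal.mul_mem_mul (Ideal.mem_sup_left (Ideal.mem_span_singleton_self _)) (hA w)
    · rw [pow_two] at hz
      refine map_sub_self_mem_of_mem_mul (bind₁ H).toRingHom (I := P ⊔ K) (J := P ⊔ K)
        (fun x _ => hA x) (fun x _ => hA x) hLQ (mul_comm _ _).le le_rfl z ?_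
      exact Ideal.mul_mono le_sup_right le_sup_right hz
  have hmem := Ideal.mem_map_of_mem (eval s)
    (iterate_map_sub_self_mem_pow (bind₁ H).toRingHom hLQ hQL hA hL g k)
  rw [← Ideal.mem_span_singleton, ← Ideal.span_singleton_pow]
  rw [Ideal.map_pow] at hmem
  refine Ideal.pow_right_mono ?_ (k / 2) hmem
  rw [hLdef, Ideal.map_sup, Ideal.map_span, Set.image_singleton, eval_C]
  refine sup_le le_rfl ?_
  rw [Ideal.map_le_iff_le_comap]
  intro x hx
  have : eval s x = 0 := pointIdeal_le_ker_eval s (Ideal.pow_le_self two_ne_zero hx)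
  simp [Ideal.mem_comap, this]

theorem eval_iterate_bind₁ (g : MvPolynomial ι S) (n : ℕ) :
    eval s ((bind₁ H)^[n] g) = eval ((fun v i => eval v (H i))^[n] s) g := by
  have h (v : ι → S) (g : MvPolynomial ι S) :
      eval v (bind₁ H g) = eval (fun i => eval v (H i)) g := by
    simpa [aeval_eq_eval] using aeval_bind₁ (R := S) v H g
  induction n generalizing g with
  | zero => rfl
  | succ n ih => rw [Function.iterate_succ_apply, ih, h, Function.iterate_succ_apply']

/-- If `H` fixes `s` to first order modulo `q`, the orbit of `s` under `H` is given by a Newton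
series whose coefficients are increasingly divisible by `q`. -/
theorem exists_orbit_eq_sum_choose [Fintype ι] [DecidableEq ι]
    (h1 : ∀ i, eval s (H i) - s i ∈ Ideal.span {q})
    (h2 : ∀ i j, eval s (pderiv j (H i)) - (if i = j then 1 else 0) ∈ Ideal.span {q}) :
    ∃ c : ι → ℕ → S, ∀ i n, (fun v i => eval v (H i))^[n] s i =
      ∑ k ∈ Finset.range (n + 1), n.choose k • (q ^ (k / 2) * c i k) := by
  choose c hc using fun i => eval_iterate_bind₁_sub_self_dvd s H q h1 h2 (X i)
  refine ⟨c, fun i n => ?_⟩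
  have h := congrArg (eval s) (iterate_map_eq_sum_choose (bind₁ H).toRingHom (X i) n)
  have h' : eval s ((bind₁ H)^[n] (X i)) = _ := h
  rw [eval_iterate_bind₁, eval_X] at h'
  rw [h', map_sum]
  refine Finset.sum_congr rfl fun k _ => ?_
  rw [map_nsmul, ← hc]
  rfl

end MvPolynomial

section NewtonSeries

theorem summable_inv_pow_div_four {p : ℕ} (hp : 5 ≤ p) : Summable fun k : ℕ => ((p : ℝ) ^ (k / 4))⁻¹ := by
  refine Summable.of_nonneg_of_le (fun k => by positivity) (fun k => ?_)
    ((summable_geometric_of_lt_one (r := (0.7 : ℝ)) (by norm_num) (by norm_num)).mul_left 3)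
  have h5 : (5 : ℝ) ≤ p := by exact_mod_cast hp
  have h : ((p : ℝ) ^ (k / 4))⁻¹ ≤ ((0.7 : ℝ) ^ 4) ^ (k / 4) := by
    rw [← inv_pow]
    refine pow_le_pow_left₀ (by positivity) ?_ _
    exact (inv_anti₀ (by norm_num) h5).trans (by norm_num)
  have h3 : (1 : ℝ) ≤ 3 * 0.7 ^ (k % 4) := by
    have : k % 4 < 4 := Nat.mod_lt _ (by norm_num)
    interval_cases k % 4 <;> norm_num
  calc _ ≤ ((0.7 : ℝ) ^ 4) ^ (k / 4) := h
    _ ≤ ((0.7 : ℝ) ^ 4) ^ (k / 4) * (3 * 0.7 ^ (k % 4)) := le_mul_of_one_le_right (by positivity) h3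
    _ = 3 * 0.7 ^ k := by
      rw [← pow_mul, mul_left_comm, ← pow_add, Nat.div_add_mod]

variable {p : ℕ} [Fact p.Prime]

/-- A rapidly convergent `p`-adic Newton series is a power series converging on `ℤ_[p]`. -/
theorem exists_hasSum_pow_eq_sum_descFactorial (b : ℕ → ℚ_[p]) (hb : Summable fun k => ‖b k‖) :
    ∃ (a : ℕ → ℚ_[p]) (g : ℤ_[p] → ℚ_[p]), Continuous g ∧
      (∀ z : ℤ_[p], HasSum (fun k => a k * (z : ℚ_[p]) ^ k) (g z)) ∧
      ∀ n : ℕ, g n = ∑ k ∈ Finset.range (n + 1), b k * n.descFactorial k := by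
  let D (k : ℕ) (z : ℤ_[p]) : ℚ_[p] := ((descPochhammer ℤ_[p] k).eval z : ℤ_[p])
  let F (z : ℤ_[p]) (x : ℕ × ℕ) : ℚ_[p] :=
    b x.1 * ((descPochhammer ℤ_[p] x.1).coeff x.2 : ℤ_[p]) * (z : ℚ_[p]) ^ x.2
  have hD (k : ℕ) (z : ℤ_[p]) : ‖b k * D k z‖ ≤ ‖b k‖ := by
    rw [norm_mul]
    exact mul_le_of_le_one_right (norm_nonneg _) (PadicInt.norm_le_one _)
  have hF (z : ℤ_[p]) : Summable (F z) := by
    refine NonarchimedeanAddGroup.summable_of_tendsto_cofinite_zero ?_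
    rw [Metric.tendsto_nhds]
    intro ε hε
    have hfin := (Metric.tendsto_nhds.1 hb.tendsto_cofinite_zero) ε hε
    rw [Filter.eventually_cofinite] at hfin ⊢
    refine (hfin.biUnion fun k _ => ((Set.finite_singleton k).prod (Set.finite_Iic k))).subset ?_
    rintro ⟨k, j⟩ hkj
    rw [Set.mem_ofPred_eq, dist_zero_right] at hkj
    simp only [Set.mem_iUnion, Set.mem_prod, Set.mem_singleton_iff, Set.mem_Iic]
    refine ⟨k, ?_, rfl, ?_⟩
    · refine fun h => hkj (lt_of_le_of_lt ?_ h)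
      rw [dist_zero_right, norm_norm]
      simp only [F, norm_mul, norm_pow, PadicInt.padic_norm_e_of_padicInt]
      rw [mul_assoc]
      exact mul_le_of_le_one_right (norm_nonneg _) (mul_le_one₀ (PadicInt.norm_le_one _)
        (by positivity) (pow_le_one₀ (norm_nonneg _) (PadicInt.norm_le_one _)))
    · by_contra! h
      refine hkj ?_
      have : (descPochhammer ℤ_[p] k).coeff j = 0 :=
        Polynomial.coeff_eq_zero_of_natDegree_lt (by rwa [descPochhammer_natDegree])
      simpa [F, this] using hε
  have hrow (z : ℤ_[p]) (k : ℕ) : HasSum (fun j => F z (k, j)) (b k * D k z) := by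
    have : D k z = ∑ j ∈ Finset.range (k + 1),
        ((descPochhammer ℤ_[p] k).coeff j : ℤ_[p]) * (z : ℚ_[p]) ^ j := by
      simp only [D]
      rw [Polynomial.eval_eq_sum_range, descPochhammer_natDegree]
      simp [PadicInt.coe_sum]
    rw [this, Finset.mul_sum]
    simp only [← mul_assoc]
    refine hasSum_sum_of_ne_finset_zero fun j hj => ?_
    have : (descPochhammer ℤ_[p] k).coeff j = 0 :=
      Polynomial.coeff_eq_zero_of_natDegree_lt (by
        rw [descPochhammer_natDegree]; simpa [Nat.succ_le_iff] using hj)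
    simp [F, this]
  have hcol (j : ℕ) : Summable fun k => b k * ((descPochhammer ℤ_[p] k).coeff j : ℤ_[p]) := by
    refine Summable.of_norm_bounded hb fun k => ?_
    rw [norm_mul]
    exact mul_le_of_le_one_right (norm_nonneg _) (PadicInt.norm_le_one _)
  refine ⟨fun j => ∑' k, b k * ((descPochhammer ℤ_[p] k).coeff j : ℤ_[p]),
    fun z => ∑' k, b k * D k z, ?_, fun z => ?_, fun n => ?_⟩
  · refine continuous_tsum (fun k => ?_) hb hD
    exact continuous_const.mul (continuous_subtype_val.comp (Polynomial.continuous _))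
  · have h := ((Equiv.prodComm ℕ ℕ).hasSum_iff.2 (hF z).hasSum).prod_fiberwise fun j =>
      (hcol j).hasSum.mul_right ((z : ℚ_[p]) ^ j)
    rwa [← ((hF z).hasSum.prod_fiberwise (hrow z)).tsum_eq] at h
  · have (k : ℕ) : D k n = n.descFactorial k := by
      simp only [D]
      rw [descPochhammer_eval_eq_descFactorial]
      simp
    simp only [this]
    refine tsum_eq_sum fun k hk => ?_
    rw [Nat.descFactorial_of_lt (by simpa [Nat.succ_le_iff] using hk)]
    simp

theorem norm_inv_factorial_le (hp : 5 ≤ p) (k : ℕ) :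
    ‖(k.factorial : ℚ_[p])⁻¹‖ ≤ (p : ℝ) ^ (k / 4) := by
  have hk : (k.factorial : ℚ_[p]) ≠ 0 := by exact_mod_cast k.factorial_ne_zero
  have h1 : (1 : ℝ) ≤ p := by exact_mod_cast (by omega : 1 ≤ p)
  rw [norm_inv, Padic.norm_eq_zpow_neg_valuation hk, Padic.valuation_natCast, zpow_neg, inv_inv,
    zpow_natCast]
  refine pow_le_pow_right₀ h1 ?_
  have hle := sub_one_mul_padicValNat_factorial (p := p) k
  have : 4 * padicValNat p k.factorial ≤ (p - 1) * padicValNat p k.factorial :=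
    Nat.mul_le_mul_right _ (by omega)
  omega

/-- The image of a finite `ℤ_[p]`-module under a functional on its rationalization is bounded. -/
theorem exists_norm_apply_one_tmul_le {M : Type*} [AddCommGroup M] [Module ℤ_[p] M]
    [Module.Finite ℤ_[p] M] (φ : (ℚ_[p] ⊗[ℤ_[p]] M) →ₗ[ℚ_[p]] ℚ_[p]) :
    ∃ B : ℝ, ∀ x : M, ‖φ (1 ⊗ₜ x)‖ ≤ B := by
  obtain ⟨n, v, hv⟩ := Module.Finite.exists_fin (R := ℤ_[p]) (M := M)
  refine ⟨∑ i, ‖φ (1 ⊗ₜ v i)‖, fun x => ?_⟩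
  obtain ⟨c, rfl⟩ := (Submodule.mem_span_range_iff_exists_fun ℤ_[p]).1
    (hv ▸ Submodule.mem_top : x ∈ Submodule.span ℤ_[p] (Set.range v))
  rw [tmul_sum, map_sum]
  refine (norm_sum_le _ _).trans (Finset.sum_le_sum fun i _ => ?_)
  have : (1 : ℚ_[p]) ⊗ₜ[ℤ_[p]] (c i • v i) = (c i : ℚ_[p]) • (1 ⊗ₜ v i) := by
    rw [← TensorProduct.smul_tmul, TensorProduct.smul_tmul', Algebra.smul_def]
    rfl
  rw [this, map_smul, smul_eq_mul, norm_mul]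
  exact mul_le_of_le_one_left (norm_nonneg _) (PadicInt.norm_le_one _)

variable {V : Type*} [AddCommGroup V] [Module ℚ_[p] V] [FiniteDimensional ℚ_[p] V]

theorem exists_hasSum_pow_apply_eq_sum_descFactorial_smul (m : ℕ → V)
    (hm : ∀ φ : V →ₗ[ℚ_[p]] ℚ_[p], Summable fun k => ‖φ (m k)‖) :
    ∃ (a : ℕ → V) (f : ℤ_[p] → V),
      (∀ φ : V →ₗ[ℚ_[p]] ℚ_[p], Continuous fun z => φ (f z)) ∧
      (∀ (z : ℤ_[p]) (φ : V →ₗ[ℚ_[p]] ℚ_[p]),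
        HasSum (fun k => φ (a k) * (z : ℚ_[p]) ^ k) (φ (f z))) ∧
      ∀ n : ℕ, f n = ∑ k ∈ Finset.range (n + 1), (n.descFactorial k : ℚ_[p]) • m k := by
  let e := Module.finBasis ℚ_[p] V
  choose a g hg hs hn using fun l =>
    exists_hasSum_pow_eq_sum_descFactorial (fun k => e.coord l (m k)) (hm (e.coord l))
  refine ⟨fun k => ∑ l, a l k • e l, fun z => ∑ l, g l z • e l, fun φ => ?_, fun z φ => ?_,
    fun n => ?_⟩
  · simp only [map_sum, map_smul, smul_eq_mul]
    exact continuous_finsetSum _ fun l _ => (hg l).mul continuous_const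
  · simp only [map_sum, map_smul, smul_eq_mul, Finset.sum_mul]
    refine hasSum_sum fun l _ => ?_
    simpa only [mul_right_comm] using (hs l z).mul_right (φ (e l))
  · simp only [hn, Finset.sum_smul]
    rw [Finset.sum_comm]
    refine Finset.sum_congr rfl fun k _ => ?_
    conv_rhs => rw [← e.sum_repr (m k), Finset.smul_sum]
    refine Finset.sum_congr rfl fun l _ => ?_
    rw [smul_smul, mul_comm, Module.Basis.coord_apply]

theorem continuous_apply_aeval {Z ι W : Type*} [TopologicalSpace Z] [CommRing W]
    [Algebra ℚ_[p] W] [FiniteDimensional ℚ_[p] W] [Algebra ℤ_[p] W] [IsScalarTower ℤ_[p] ℚ_[p] W]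
    (f : ι → Z → W) (hf : ∀ i (φ : W →ₗ[ℚ_[p]] ℚ_[p]), Continuous fun z => φ (f i z))
    (H : MvPolynomial ι ℤ_[p]) (φ : W →ₗ[ℚ_[p]] ℚ_[p]) :
    Continuous fun z => φ (aeval (fun i => f i z) H) := by
  induction H using MvPolynomial.induction_on generalizing φ with
  | C a => simpa using continuous_const
  | add g h hg hh => simpa only [map_add] using (hg φ).fun_add (hh φ)
  | mul_X g i hg =>
    let e := Module.finBasis ℚ_[p] W
    have h (z : Z) : φ (aeval (fun i => f i z) (g * X i)) =
        ∑ l, e.coord l (f i z) * (φ ∘ₗ LinearMap.mulRight ℚ_[p] (e l))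
          (aeval (fun i => f i z) g) := by
      rw [map_mul, aeval_X]
      conv_lhs => rw [← e.sum_repr (f i z), Finset.mul_sum, map_sum]
      refine Finset.sum_congr rfl fun l _ => ?_
      rw [mul_smul_comm, map_smul]
      rfl
    simp only [h]
    exact continuous_finsetSum _ fun l _ => (hf i (e.coord l)).mul (hg _)

end NewtonSeries

/-- **Generalized `p`-adic analytic arc theorem (Theorem 3.1).**
Let `p ≥ 5` be prime, `σ = (H₁, …, H_d)` a `ℤ_p`-algebra automorphism of
`ℤ_p[x₁, …, x_d]`, and `S` a `ℤ_p`-algebra that is finitely generated and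
torsion-free as a `ℤ_p`-module. Suppose that `s₀ = (s₁, …, s_d) ∈ S^d`
satisfies (i) `Hᵢ(s₀) ≡ sᵢ (mod pS)` for all `i`, and (ii) the Jacobian matrix
of `σ` at `s₀` is the identity mod `pS`. Then there exist power series
`f₁, …, f_d` with coefficients in `ℚ_p ⊗_{ℤ_p} S` converging for every
`z ∈ ℤ_p` (convergence being expressed through every `ℚ_p`-linear functional,
which is equivalent to norm convergence since `ℚ_p ⊗ S` is finite-dimensional),
such that `fᵢ(z + 1) = Hᵢ(f₁(z), …, f_d(z))` for all `z ∈ ℤ_p`, and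
`fᵢ(0) = sᵢ`. -/
theorem stmt9 (p : ℕ) [Fact p.Prime] (hp : 5 ≤ p) (d : ℕ)
    (σ : MvPolynomial (Fin d) ℤ_[p] ≃ₐ[ℤ_[p]] MvPolynomial (Fin d) ℤ_[p])
    (S : Type*) [CommRing S] [Algebra ℤ_[p] S] [Module.Finite ℤ_[p] S]
    [NoZeroSMulDivisors ℤ_[p] S] (s : Fin d → S)
    (h1 : ∀ i : Fin d, aeval s (σ (X i)) - s i ∈ Ideal.span {(p : S)})
    (h2 : ∀ i j : Fin d,
      aeval s (pderiv j (σ (X i))) - (if i = j then 1 else 0) ∈ Ideal.span {(p : S)}) :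
    ∃ (a : Fin d → ℕ → (ℚ_[p] ⊗[ℤ_[p]] S)) (f : Fin d → ℤ_[p] → (ℚ_[p] ⊗[ℤ_[p]] S)),
      (∀ (i : Fin d) (z : ℤ_[p]) (φ : (ℚ_[p] ⊗[ℤ_[p]] S) →ₗ[ℚ_[p]] ℚ_[p]),
        HasSum (fun k : ℕ => φ (a i k) * (z : ℚ_[p]) ^ k) (φ (f i z))) ∧
      (∀ (i : Fin d) (z : ℤ_[p]), f i (z + 1) = aeval (fun j => f j z) (σ (X i))) ∧
      (∀ i : Fin d, f i 0 = (1 : ℚ_[p]) ⊗ₜ[ℤ_[p]] s i) := by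
  let H (i : Fin d) : MvPolynomial (Fin d) S := map (algebraMap ℤ_[p] S) (σ (X i))
  have hH (v : Fin d → S) (i : Fin d) : eval v (H i) = aeval v (σ (X i)) := by
    rw [eval_map, aeval_def]
  obtain ⟨c, hc⟩ := exists_orbit_eq_sum_choose s H (p : S) (fun i => by rw [hH]; exact h1 i)
    (fun i j => by rw [pderiv_map, eval_map, ← aeval_def]; exact h2 i j)
  let x (n : ℕ) : Fin d → S := (fun v i => eval v (H i))^[n] s
  have hx (n : ℕ) (i : Fin d) : x (n + 1) i = aeval (x n) (σ (X i)) := by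
    simp only [x, Function.iterate_succ_apply', hH]
  let m (i : Fin d) (k : ℕ) : ℚ_[p] ⊗[ℤ_[p]] S :=
    (k.factorial : ℚ_[p])⁻¹ • (1 : ℚ_[p]) ⊗ₜ ((p : S) ^ (k / 2) * c i k)
  have hm (i : Fin d) (φ : (ℚ_[p] ⊗[ℤ_[p]] S) →ₗ[ℚ_[p]] ℚ_[p]) :
      Summable fun k => ‖φ (m i k)‖ := by
    obtain ⟨B, hB⟩ := exists_norm_apply_one_tmul_le φ
    refine Summable.of_nonneg_of_le (fun k => norm_nonneg _) (fun k => ?_)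
      ((summable_inv_pow_div_four hp).mul_left B)
    have : (1 : ℚ_[p]) ⊗ₜ[ℤ_[p]] ((p : S) ^ (k / 2) * c i k) =
        (p : ℚ_[p]) ^ (k / 2) • (1 ⊗ₜ c i k) := by
      rw [← Nat.cast_pow, ← nsmul_eq_mul, ← Nat.cast_pow, Nat.cast_smul_eq_nsmul]
      exact map_nsmul (TensorProduct.mk ℤ_[p] ℚ_[p] S 1) _ _
    simp only [m, this, map_smul, smul_eq_mul, norm_mul, norm_pow, Padic.norm_p]
    calc _ ≤ (p : ℝ) ^ (k / 4) * ((p : ℝ)⁻¹ ^ (k / 2) * B) := by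
          gcongr
          · exact norm_inv_factorial_le hp k
          · exact hB _
      _ ≤ (p : ℝ) ^ (k / 4) * ((p : ℝ)⁻¹ ^ (k / 4 + k / 4) * B) := by
          have hB0 : 0 ≤ B := (norm_nonneg _).trans (hB 0)
          gcongr ?_ * (?_ * B)
          refine pow_le_pow_of_le_one (by positivity) ?_ (by omega)
          exact inv_le_one_of_one_le₀ (by exact_mod_cast (by omega : 1 ≤ p))
      _ = B * ((p : ℝ) ^ (k / 4))⁻¹ := by
          rw [pow_add, inv_pow]
          field_simp
  choose a f hcont hsum hf using fun i =>
    exists_hasSum_pow_apply_eq_sum_descFactorial_smul (m i) (hm i)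
  have hfx (i : Fin d) (n : ℕ) : f i n = 1 ⊗ₜ x n i := by
    rw [hf, show x n i = _ from hc i n, tmul_sum]
    refine Finset.sum_congr rfl fun k _ => ?_
    have hk : (k.factorial : ℚ_[p]) ≠ 0 := by exact_mod_cast k.factorial_ne_zero
    rw [Nat.descFactorial_eq_factorial_mul_choose, smul_smul, Nat.cast_mul, mul_right_comm,
      mul_inv_cancel₀ hk, one_mul, Nat.cast_smul_eq_nsmul]
    exact (map_nsmul (TensorProduct.mk ℤ_[p] ℚ_[p] S 1) _ _).symm
  refine ⟨a, f, hsum, fun i z => ?_, fun i => ?_⟩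
  · rw [← sub_eq_zero, ← Module.forall_dual_apply_eq_zero_iff ℚ_[p]]
    intro φ
    rw [map_sub, sub_eq_zero]
    refine congrFun (PadicInt.denseRange_natCast.equalizer
      (g := fun z => φ (f i (z + 1))) (h := fun z => φ (aeval (fun j => f j z) (σ (X i))))
      ((hcont i φ).comp (continuous_id.add continuous_const))
      (continuous_apply_aeval f hcont _ φ) (funext fun n => congrArg φ ?_)) z
    have h := hfx i (n + 1)
    rw [Nat.cast_succ] at h
    simp only [h, hfx, hx]
    exact comp_aeval_apply (x n) (Algebra.TensorProduct.includeRight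
      (R := ℤ_[p]) (A := ℚ_[p]) (B := S)) (σ (X i))
  · simpa [x] using hfx i 0
end
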